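/- Let S be a finite alphabet with a complementation and consider the 7-dimensional Keller graph on S^7: its vertices are the words of S^7, and two words are adjacent if and only if they are dichotomous but do not form a twin pair. Every clique U in this graph which contains five vertices u^1,…,u^5 for which there exists i ∈ {1,…,7} with u^n_i ∉ {u^m_i, (u^m_i)'} for all n ≠ m, n,m ∈ {1,…,5}, satisfies |U| < 2^7 = 128. -/

import Mathlib

variable {S : Type}

/-- Two words are dichotomous: at some position they carry complementary letters. -/
def Dicho {d : ℕ} (c : S → S) (u v : Fin d → S) : Prop := ∃ j, v j = c (u j)

/-- Two words form a twin pair. -/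
def TwinPair {d : ℕ} (c : S → S) (u v : Fin d → S) : Prop :=
  ∃ j, v j = c (u j) ∧ ∀ i, i ≠ j → v i = u i

/-- A polybox code: a set of pairwise dichotomous words. -/
def PolyboxCode {d : ℕ} (c : S → S) (V : Set (Fin d → S)) : Prop :=
  ∀ u ∈ V, ∀ v ∈ V, u ≠ v → Dicho c u v

/-- The code contains no twin pair. -/
def NoTwinPair {d : ℕ} (c : S → S) (V : Set (Fin d → S)) : Prop :=
  ∀ u ∈ V, ∀ v ∈ V, ¬ TwinPair c u v

/-- `ES`: sets containing exactly one of `s`, `s'` for every letter `s`. -/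
def ESet (c : S → S) : Set (Set S) := {B | ∀ s, Xor' (s ∈ B) (c s ∈ B)}

/-- `Es`: members of `ES` containing the letter `s`. -/
def ELetter (c : S → S) (s : S) : Set (Set S) := {B | B ∈ ESet c ∧ s ∈ B}

/-- The equicomplementary realization `v̌ ⊆ (ES)^d` of a word `v`. -/
def Realize {d : ℕ} (c : S → S) (v : Fin d → S) : Set (Fin d → Set S) :=
  {x | ∀ i, x i ∈ ELetter c (v i)}

/-- The union `⋃_{v ∈ V} v̌`. -/
def RealizeSet {d : ℕ} (c : S → S) (V : Set (Fin d → S)) : Set (Fin d → Set S) :=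
  ⋃ v ∈ V, Realize c v

/-- Two codes are equivalent if their realizations coincide. -/
def EquivCodes {d : ℕ} (c : S → S) (V W : Set (Fin d → S)) : Prop :=
  RealizeSet c V = RealizeSet c W

/-- A partition code: a polybox code whose realization is the whole box `(ES)^d`. -/
def PartitionCode {d : ℕ} (c : S → S) (U : Set (Fin d → S)) : Prop :=
  PolyboxCode c U ∧ RealizeSet c U = {x | ∀ i, x i ∈ ESet c}

/-- `V^{i,l}`: the words of `V` with letter `l` at position `i`. -/
def Subcode {d : ℕ} (V : Set (Fin d → S)) (i : Fin d) (l : S) : Set (Fin d → S) :=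
  {v | v ∈ V ∧ v i = l}

/-- Adjacency in the Keller graph: dichotomous but not a twin pair. -/
def KellerAdj {d : ℕ} (c : S → S) (u v : Fin d → S) : Prop :=
  Dicho c u v ∧ ¬ TwinPair c u v

set_option linter.unusedSectionVars false

namespace Keller

open scoped Classical

/-- An alphabet with a fixed-point-free involution. -/
class Cpl (S : Type) where
  cp : S → S
  cp_cp : ∀ s, cp (cp s) = s
  cp_ne : ∀ s, cp s ≠ s

open Cpl (cp)

section Basic

variable {S : Type} [Cpl S] {ι : Type}

@[simp, grind =] theorem cp_cp (s : S) : cp (cp s) = s := Cpl.cp_cp s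

@[simp] theorem cp_ne (s : S) : cp s ≠ s := Cpl.cp_ne s

@[simp] theorem ne_cp (s : S) : s ≠ cp s := (Cpl.cp_ne s).symm

grind_pattern cp_ne => cp s

theorem cp_inj {s t : S} (h : cp s = cp t) : s = t := by
  rw [← cp_cp s, h, cp_cp]

theorem cp_eq_comm {s t : S} : cp s = t ↔ s = cp t :=
  ⟨fun h => by rw [← h, cp_cp], fun h => by rw [h, cp_cp]⟩

theorem cp_inj_iff (s t : S) : cp s = cp t ↔ s = t := ⟨cp_inj, fun h => h ▸ rfl⟩

theorem cp_swap (s t : S) : cp s = t ↔ s = cp t := cp_eq_comm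

grind_pattern cp_inj_iff => cp s, cp t

grind_pattern cp_swap => cp s, cp t

/-- A selection of exactly one letter out of every complementary pair. -/
structure Sel (S : Type) [Cpl S] where
  val : S → Prop
  cp_iff : ∀ s, val (cp s) ↔ ¬ val s

theorem Sel.val_cp (ω : Sel S) (s : S) : ω.val (cp s) ↔ ¬ ω.val s := ω.cp_iff s

grind_pattern Sel.val_cp => ω.val s, cp s

theorem exists_sel (P : Set S) (hP : ∀ s ∈ P, cp s ∉ P) : ∃ ω : Sel S, ∀ s ∈ P, ω.val s := by
  refine ⟨⟨fun s => s ∈ P ∨ (cp s ∉ P ∧ WellOrderingRel s (cp s)), fun s => ?_⟩,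
    fun s hs => Or.inl hs⟩
  have h1 := hP s
  have h2 := hP (cp s)
  rw [cp_cp] at h2
  simp only [cp_cp]
  rcases trichotomous_of (WellOrderingRel (α := S)) s (cp s) with h | h | h
  · have h3 : ¬ WellOrderingRel (cp s) s := asymm h
    tauto
  · exact absurd h.symm (cp_ne s)
  · have h3 : ¬ WellOrderingRel s (cp s) := asymm h
    tauto

instance : Nonempty (Sel S) := ⟨(exists_sel (∅ : Set S) (by simp)).choose⟩

/-- Exchange the two letters of one complementary pair. -/
def Sel.tog (ω : Sel S) (t : S) : Sel S where
  val s := if s = t ∨ s = cp t then ¬ ω.val s else ω.val s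
  cp_iff s := by
    have h1 := ω.cp_iff s
    have h2 : cp s = t ∨ cp s = cp t ↔ s = t ∨ s = cp t := by
      rw [cp_eq_comm, or_comm]
      exact or_congr ⟨cp_inj, fun h => h ▸ rfl⟩ Iff.rfl
    by_cases hst : s = t ∨ s = cp t
    · simp only [if_pos (h2.2 hst), if_pos hst]
      tauto
    · simp only [if_neg (fun h => hst (h2.1 h)), if_neg hst]
      tauto

theorem Sel.tog_val (ω : Sel S) (t s : S) :
    (ω.tog t).val s ↔ if s = t ∨ s = cp t then ¬ ω.val s else ω.val s := Iff.rfl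

grind_pattern Sel.tog_val => (ω.tog t).val s

theorem Sel.tog_self (ω : Sel S) (t : S) : (ω.tog t).val t ↔ ¬ ω.val t := by grind

theorem Sel.tog_of_ne (ω : Sel S) {t s : S} (h1 : s ≠ t) (h2 : s ≠ cp t) :
    (ω.tog t).val s ↔ ω.val s := by grind

theorem exists_sel_two {a b : S} (h : b ≠ cp a) : ∃ ω : Sel S, ω.val a ∧ ω.val b := by
  obtain ⟨ω, hω⟩ := exists_sel ({a, b} : Set S) (by
    intro s hs
    simp only [Set.mem_insert_iff, Set.mem_singleton_iff] at *
    grind)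
  exact ⟨ω, hω a (by simp), hω b (by simp)⟩

theorem exists_pt (K : Finset ι) (P : ι → Sel S → Prop) (h : ∀ k ∈ K, ∃ ω, P k ω) :
    ∃ x : ι → Sel S, ∀ k ∈ K, P k (x k) := by
  refine ⟨fun k => if hk : k ∈ K then (h k hk).choose else Classical.arbitrary _, fun k hk => ?_⟩
  simp only [hk, dite_true]
  exact (h k hk).choose_spec

/-- The point `x` lies in the box of the word `v`, as far as the positions in `K` go. -/
def Inn (K : Finset ι) (x : ι → Sel S) (v : ι → S) : Prop := ∀ k ∈ K, (x k).val (v k)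

/-- The words are dichotomous on `K`. -/
def Dic (K : Finset ι) (v w : ι → S) : Prop := ∃ k ∈ K, w k = cp (v k)

/-- The words form a twin pair on `K`. -/
def Tw (K : Finset ι) (v w : ι → S) : Prop :=
  ∃ k ∈ K, w k = cp (v k) ∧ ∀ l ∈ K, l ≠ k → w l = v l

/-- The words agree on `K`. -/
def Agr (K : Finset ι) (v w : ι → S) : Prop := ∀ k ∈ K, v k = w k

theorem Agr.symm {K : Finset ι} {v w : ι → S} (h : Agr K v w) : Agr K w v :=
  fun k hk => (h k hk).symm

theorem Dic.symm {K : Finset ι} {v w : ι → S} (h : Dic K v w) : Dic K w v := by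
  obtain ⟨k, hk, h⟩ := h
  exact ⟨k, hk, by rw [h, cp_cp]⟩

theorem Dic.not_inn {K : Finset ι} {v w : ι → S} (h : Dic K v w) {x : ι → Sel S}
    (h1 : Inn K x v) (h2 : Inn K x w) : False := by
  obtain ⟨k, hk, h⟩ := h
  have a := h1 k hk
  have b := h2 k hk
  rw [h, Sel.val_cp] at b
  exact b a

theorem not_dic_of_inn {K : Finset ι} {v w : ι → S} {x : ι → Sel S}
    (h1 : Inn K x v) (h2 : Inn K x w) : ¬ Dic K v w := fun h => h.not_inn h1 h2

theorem exists_inn_two {K : Finset ι} {v w : ι → S} (h : ¬ Dic K v w) :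
    ∃ x, Inn K x v ∧ Inn K x w := by
  obtain ⟨x, hx⟩ := exists_pt K (fun k ω => ω.val (v k) ∧ ω.val (w k)) (fun k hk =>
    exists_sel_two (fun e => h ⟨k, hk, e⟩))
  exact ⟨x, fun k hk => (hx k hk).1, fun k hk => (hx k hk).2⟩

theorem not_dic_self (K : Finset ι) (v : ι → S) : ¬ Dic K v v := by
  rintro ⟨k, _, h⟩
  exact ne_cp _ h

theorem exists_inn (K : Finset ι) (v : ι → S) : ∃ x, Inn K x v := by
  obtain ⟨x, hx, _⟩ := exists_inn_two (not_dic_self K v)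
  exact ⟨x, hx⟩

theorem letters_of_sub {K : Finset ι} {w : ι → S} (P : ι → Set S)
    (hP : ∀ k ∈ K, ∀ s ∈ P k, cp s ∉ P k)
    (h : ∀ x : ι → Sel S, (∀ k ∈ K, ∀ s ∈ P k, (x k).val s) → Inn K x w) :
    ∀ k ∈ K, w k ∈ P k := by
  intro k hk
  by_contra hw
  obtain ⟨x, hx⟩ := exists_pt K
    (fun k' ω => (∀ s ∈ P k', ω.val s) ∧ (k' = k → ¬ ω.val (w k))) (fun k' hk' => by
      by_cases e : k' = k
      · subst e
        obtain ⟨ω, hω⟩ := exists_sel (insert (cp (w k')) (P k')) (by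
          intro s hs hs'
          have := hP k' hk' s
          simp only [Set.mem_insert_iff] at *
          have := hP k' hk'
          grind)
        refine ⟨ω, fun s hs => hω s (Set.mem_insert_of_mem _ hs), fun _ => ?_⟩
        have := hω _ (Set.mem_insert _ _)
        rwa [Sel.val_cp] at this
      · obtain ⟨ω, hω⟩ := exists_sel (P k') (hP k' hk')
        exact ⟨ω, hω, fun h => absurd h e⟩)
  exact (hx k hk).2 rfl (h x (fun k' hk' => (hx k' hk').1) k hk)

theorem letters_of_sub_two {K : Finset ι} {v y w : ι → S} (hvy : ¬ Dic K v y)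
    (h : ∀ x, Inn K x v → Inn K x y → Inn K x w) : ∀ k ∈ K, w k = v k ∨ w k = y k := by
  have := letters_of_sub (K := K) (w := w) (fun k => {v k, y k}) (by
    intro k hk s hs hs'
    have : y k ≠ cp (v k) := fun e => hvy ⟨k, hk, e⟩
    simp only [Set.mem_insert_iff, Set.mem_singleton_iff] at *
    grind) (fun x hx => h x (fun k hk => hx k hk _ (by simp)) (fun k hk => hx k hk _ (by simp)))
  simpa using this

/-- Boxes with the same trace on a third box belong to the same word. -/
theorem agr_of_trace {K : Finset ι} {v w y : ι → S} (hv : ¬ Dic K v y) (hw : ¬ Dic K w y)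
    (h : ∀ x, Inn K x y → (Inn K x v ↔ Inn K x w)) : Agr K v w := by
  have h1 := letters_of_sub_two hv (fun x a b => (h x b).1 a)
  have h2 := letters_of_sub_two hw (fun x a b => (h x b).2 a)
  intro k hk
  rcases h1 k hk with e | e <;> rcases h2 k hk with e' | e' <;> grind

/-- Pairwise dichotomous words without twin pairs, on the positions in `K`. -/
def IsCode (K : Finset ι) (A : Finset (ι → S)) : Prop :=
  ∀ v ∈ A, ∀ w ∈ A, v ≠ w → Dic K v w ∧ ¬ Tw K v w

/-- No word of `A` agrees with a word of `B`. -/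
def NoC (K : Finset ι) (A B : Finset (ι → S)) : Prop :=
  ∀ a ∈ A, ∀ b ∈ B, ¬ Agr K a b

/-- The point is covered by the code. -/
def Cov (K : Finset ι) (A : Finset (ι → S)) (x : ι → Sel S) : Prop := ∃ a ∈ A, Inn K x a

theorem NoC.symm {K : Finset ι} {A B : Finset (ι → S)} (h : NoC K A B) : NoC K B A :=
  fun b hb a ha e => h a ha b hb e.symm

theorem IsCode.mono {K : Finset ι} {A B : Finset (ι → S)} (h : IsCode K B) (hs : A ⊆ B) :
    IsCode K A := fun v hv w hw => h v (hs hv) w (hs hw)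

theorem IsCode.eq_of_inn {K : Finset ι} {A : Finset (ι → S)} (h : IsCode K A) {v w : ι → S}
    (hv : v ∈ A) (hw : w ∈ A) {x : ι → Sel S} (h1 : Inn K x v) (h2 : Inn K x w) : v = w := by
  by_contra e
  exact (h v hv w hw e).1.not_inn h1 h2

variable [DecidableEq ι]

theorem Inn.erase {K : Finset ι} {x : ι → Sel S} {v : ι → S} (h : Inn K x v) (k : ι) :
    Inn (K.erase k) x v := fun k' hk' => h k' (Finset.mem_of_mem_erase hk')

theorem inn_iff_erase {K : Finset ι} {x : ι → Sel S} {v : ι → S} {k : ι} (hk : k ∈ K) :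
    Inn K x v ↔ (x k).val (v k) ∧ Inn (K.erase k) x v := by
  constructor
  · exact fun h => ⟨h k hk, h.erase k⟩
  · rintro ⟨h1, h2⟩ k' hk'
    by_cases e : k' = k
    · exact e ▸ h1
    · exact h2 k' (Finset.mem_erase.2 ⟨e, hk'⟩)

@[simp] theorem inn_erase_update {K : Finset ι} {x : ι → Sel S} {v : ι → S} {k : ι} {ω : Sel S} :
    Inn (K.erase k) (Function.update x k ω) v ↔ Inn (K.erase k) x v := by
  refine forall₂_congr fun k' hk' => ?_
  rw [Function.update_of_ne (Finset.ne_of_mem_erase hk')]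

theorem inn_update {K : Finset ι} {x : ι → Sel S} {v : ι → S} {k : ι} (hk : k ∈ K) {ω : Sel S} :
    Inn K (Function.update x k ω) v ↔ ω.val (v k) ∧ Inn (K.erase k) x v := by
  rw [inn_iff_erase hk, inn_erase_update, Function.update_self]

theorem Dic.of_erase {K : Finset ι} {v w : ι → S} {k : ι} (h : Dic (K.erase k) v w) : Dic K v w := by
  obtain ⟨k', hk', e⟩ := h
  exact ⟨k', Finset.mem_of_mem_erase hk', e⟩

theorem Dic.erase {K : Finset ι} {v w : ι → S} {k : ι} (h : Dic K v w) (hk : w k ≠ cp (v k)) :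
    Dic (K.erase k) v w := by
  obtain ⟨k', hk', e⟩ := h
  exact ⟨k', Finset.mem_erase.2 ⟨by rintro rfl; exact hk e, hk'⟩, e⟩

theorem tw_of_agr_erase {K : Finset ι} {v w : ι → S} {k : ι} (hk : k ∈ K)
    (h : Agr (K.erase k) v w) (e : w k = cp (v k)) : Tw K v w :=
  ⟨k, hk, e, fun k' hk' hne => (h k' (Finset.mem_erase.2 ⟨hne, hk'⟩)).symm⟩

theorem IsCode.slice {K : Finset ι} {A : Finset (ι → S)} (h : IsCode K A) (k : ι) (z : S) :
    IsCode (K.erase k) (A.filter (fun v => v k = z)) := by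
  intro v hv w hw hne
  simp only [Finset.mem_filter] at hv hw
  obtain ⟨h1, h2⟩ := h v hv.1 w hw.1 hne
  refine ⟨h1.erase (by rw [hv.2, hw.2]; exact ne_cp z), fun h3 => h2 ?_⟩
  obtain ⟨k', hk', e, h4⟩ := h3
  refine ⟨k', Finset.mem_of_mem_erase hk', e, fun k'' a b => ?_⟩
  by_cases e' : k'' = k
  · rw [e', hv.2, hw.2]
  · exact h4 k'' (Finset.mem_erase.2 ⟨e', a⟩) b

/-- The trace on the box of `v` can be tested inside the box of `y`. -/
theorem cov_of_cov_meet {K : Finset ι} {A : Finset (ι → S)} {v y : ι → S} (hvy : ¬ Dic K v y)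
    (hA : ∀ a ∈ A, ∀ k ∈ K, v k ≠ y k → a k = v k)
    (h : ∀ x, Inn K x v → Inn K x y → Cov K A x) : ∀ x, Inn K x v → Cov K A x := by
  intro x hx
  obtain ⟨x', hx'⟩ := exists_pt K (fun k ω => ω.val (v k) ∧ ω.val (y k) ∧ (v k = y k → ω = x k))
    (fun k hk => by
      by_cases e : v k = y k
      · exact ⟨x k, hx k hk, e ▸ hx k hk, fun _ => rfl⟩
      · obtain ⟨ω, h1, h2⟩ := exists_sel_two (a := v k) (b := y k) (fun e => hvy ⟨k, hk, e⟩)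
        exact ⟨ω, h1, h2, fun h => absurd h e⟩)
  obtain ⟨a, ha, hxa⟩ := h x' (fun k hk => (hx' k hk).1) (fun k hk => (hx' k hk).2.1)
  refine ⟨a, ha, fun k hk => ?_⟩
  by_cases e : v k = y k
  · rw [← (hx' k hk).2.2 e]
    exact hxa k hk
  · rw [hA a ha k hk e]
    exact hx k hk

end Basic

section Local

variable {S : Type} [Cpl S] {ι : Type} [DecidableEq ι]

/-- The words of `A` with letter `z` at position `k`. -/
noncomputable def sl (A : Finset (ι → S)) (k : ι) (z : S) : Finset (ι → S) :=
  A.filter (fun v => v k = z)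

@[simp] theorem mem_sl {A : Finset (ι → S)} {k : ι} {z : S} {v : ι → S} :
    v ∈ sl A k z ↔ v ∈ A ∧ v k = z := by simp [sl]

theorem sl_sum_le (A : Finset (ι → S)) (k : ι) (L : List S) (hL : L.Nodup) :
    (L.map (fun z => (sl A k z).card)).sum ≤ A.card := by
  induction L generalizing A with
  | nil => simp
  | cons z L ih =>
    have h1 := ih (A.filter (fun v => v k ≠ z)) (List.nodup_cons.1 hL).2
    have h2 : L.map (fun t => (sl (A.filter (fun v => v k ≠ z)) k t).card) =
        L.map (fun t => (sl A k t).card) := by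
      refine List.map_congr_left fun t ht => ?_
      congr 1
      ext v
      simp only [mem_sl, Finset.mem_filter]
      have : t ≠ z := fun e => (List.nodup_cons.1 hL).1 (e ▸ ht)
      grind
    rw [h2] at h1
    have h3 : (A.filter (fun v => v k = z)).card + (A.filter (fun v => v k ≠ z)).card = A.card := by
      convert Finset.card_filter_add_card_filter_not (s := A) (fun v => v k = z)
    simp only [List.map_cons, List.sum_cons]
    change (A.filter (fun v => v k = z)).card + _ ≤ _
    omega

theorem card_sl_two (A : Finset (ι → S)) (k : ι) {z t : S} (h : z ≠ t) :
    (sl A k z).card + (sl A k t).card ≤ A.card := by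
  simpa using sl_sum_le A k [z, t] (by simpa using h)

theorem card_sl_four (A : Finset (ι → S)) (k : ι) {z t : S} (h : t ≠ z) (h' : t ≠ cp z) :
    (sl A k z).card + (sl A k (cp z)).card + (sl A k t).card + (sl A k (cp t)).card ≤ A.card := by
  have := sl_sum_le A k [z, cp z, t, cp t] (by
    simp only [List.nodup_cons, List.mem_cons, List.not_mem_nil, or_false, not_or, not_false_eq_true,
      List.nodup_nil, and_true]
    grind)
  simp only [List.map_cons, List.map_nil, List.sum_cons, List.sum_nil] at this
  omega

theorem sl_subset (A : Finset (ι → S)) (k : ι) (z : S) : sl A k z ⊆ A := Finset.filter_subset _ _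

theorem IsCode.sl {K : Finset ι} {A : Finset (ι → S)} (h : IsCode K A) (k : ι) (z : S) :
    IsCode (K.erase k) (sl A k z) := h.slice k z

/-- The slices of a code at complementary letters have no word in common. -/
theorem IsCode.noC_sl {K : Finset ι} {A : Finset (ι → S)} (h : IsCode K A) {k : ι} (hk : k ∈ K)
    (z : S) : NoC (K.erase k) (Keller.sl A k z) (Keller.sl A k (cp z)) := by
  intro a ha b hb e
  rw [mem_sl] at ha hb
  have hab : b k = cp (a k) := by rw [ha.2, hb.2]
  exact (h a ha.1 b hb.1 (by rintro rfl; exact ne_cp _ hab)).2 (tw_of_agr_erase hk e hab)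

theorem cov_update {K : Finset ι} {A : Finset (ι → S)} {x : ι → Sel S} {k : ι} (hk : k ∈ K)
    {ω : Sel S} : Cov K A (Function.update x k ω) ↔ ∃ s, ω.val s ∧ Cov (K.erase k) (sl A k s) x := by
  constructor
  · rintro ⟨a, ha, h⟩
    rw [inn_update hk] at h
    exact ⟨a k, h.1, a, by simp [ha], h.2⟩
  · rintro ⟨s, hs, a, ha, h⟩
    rw [mem_sl] at ha
    exact ⟨a, ha.1, (inn_update hk).2 ⟨ha.2 ▸ hs, h⟩⟩

theorem IsCode.cov_sl_unique {K : Finset ι} {A : Finset (ι → S)} (hA : IsCode K A)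
    {x : ι → Sel S} {k : ι} (hk : k ∈ K) {s t : S} (hst : s ≠ cp t)
    (h1 : Cov (K.erase k) (Keller.sl A k s) x) (h2 : Cov (K.erase k) (Keller.sl A k t) x) :
    s = t := by
  obtain ⟨a, ha, hxa⟩ := h1
  obtain ⟨b, hb, hxb⟩ := h2
  rw [mem_sl] at ha hb
  obtain ⟨ω, h1, h2⟩ := exists_sel_two hst
  have := hA.eq_of_inn ha.1 hb.1 (x := Function.update x k ω)
    ((inn_update hk).2 ⟨ha.2 ▸ h2, hxa⟩) ((inn_update hk).2 ⟨hb.2 ▸ h1, hxb⟩)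
  rw [← ha.2, ← hb.2, this]

theorem prop_square {a a' b b' p q : Prop} (h1 : a ∨ p ↔ b ∨ q) (h2 : a' ∨ p ↔ b' ∨ q)
    (h3 : ¬ (p ∧ a)) (h4 : ¬ (p ∧ a')) (h5 : ¬ (q ∧ b)) (h6 : ¬ (q ∧ b')) :
    ((a ∧ b') ↔ (a' ∧ b)) ∧ ((a ∨ b') ↔ (a' ∨ b)) := by
  by_cases hp : p <;> by_cases hq : q <;> simp_all <;> tauto

/-- The square lemma: exchanging two complementary letters at one position. -/
theorem square {K : Finset ι} {A B : Finset (ι → S)} (hA : IsCode K A) (hB : IsCode K B)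
    {k : ι} (hk : k ∈ K) (z : S) (x : ι → Sel S) (R : Sel S → Prop) (hR0 : ∃ ω, R ω)
    (hR : ∀ ω, R ω → R (ω.tog z))
    (h : ∀ ω, R ω → (Cov K A (Function.update x k ω) ↔ Cov K B (Function.update x k ω))) :
    ((Cov (K.erase k) (sl A k z) x ∧ Cov (K.erase k) (sl B k (cp z)) x) ↔
      (Cov (K.erase k) (sl A k (cp z)) x ∧ Cov (K.erase k) (sl B k z) x)) ∧
    ((Cov (K.erase k) (sl A k z) x ∨ Cov (K.erase k) (sl B k (cp z)) x) ↔
      (Cov (K.erase k) (sl A k (cp z)) x ∨ Cov (K.erase k) (sl B k z) x)) := by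
  obtain ⟨ω, hω, hz⟩ : ∃ ω, R ω ∧ ω.val z := by
    obtain ⟨ω, hω⟩ := hR0
    by_cases hz : ω.val z
    · exact ⟨ω, hω, hz⟩
    · exact ⟨ω.tog z, hR ω hω, (ω.tog_self z).2 hz⟩
  have key : ∀ C : Finset (ι → S), IsCode K C → ∃ P : Prop,
      (Cov K C (Function.update x k ω) ↔ (Cov (K.erase k) (sl C k z) x ∨ P)) ∧
      (Cov K C (Function.update x k (ω.tog z)) ↔ (Cov (K.erase k) (sl C k (cp z)) x ∨ P)) ∧
      ¬ (P ∧ Cov (K.erase k) (sl C k z) x) ∧ ¬ (P ∧ Cov (K.erase k) (sl C k (cp z)) x) := by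
    intro C hC
    refine ⟨∃ s, s ≠ z ∧ s ≠ cp z ∧ ω.val s ∧ Cov (K.erase k) (sl C k s) x, ?_, ?_, ?_, ?_⟩
    · rw [cov_update hk]
      constructor
      · rintro ⟨s, hs, hc⟩
        by_cases e : s = z
        · exact Or.inl (e ▸ hc)
        · exact Or.inr ⟨s, e, by rintro rfl; exact (ω.val_cp z).1 hs hz, hs, hc⟩
      · rintro (hc | ⟨s, -, -, hs, hc⟩)
        · exact ⟨z, hz, hc⟩
        · exact ⟨s, hs, hc⟩
    · rw [cov_update hk]
      constructor
      · rintro ⟨s, hs, hc⟩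
        by_cases e : s = cp z
        · exact Or.inl (e ▸ hc)
        · have e2 : s ≠ z := by rintro rfl; exact (ω.tog_self s).1 hs hz
          exact Or.inr ⟨s, e2, e, (ω.tog_of_ne e2 e).1 hs, hc⟩
      · rintro (hc | ⟨s, h1, h2, hs, hc⟩)
        · exact ⟨cp z, by rw [Sel.val_cp, Sel.tog_self]; exact fun h => h hz, hc⟩
        · exact ⟨s, (ω.tog_of_ne h1 h2).2 hs, hc⟩
    · rintro ⟨⟨s, h1, h2, -, hc⟩, hd⟩
      exact h1 (hC.cov_sl_unique hk h2 hc hd)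
    · rintro ⟨⟨s, h1, h2, -, hc⟩, hd⟩
      exact h2 (hC.cov_sl_unique hk (by rwa [cp_cp]) hc hd)
  obtain ⟨P, a1, a2, a3, a4⟩ := key A hA
  obtain ⟨Q, b1, b2, b3, b4⟩ := key B hB
  exact prop_square (a1.symm.trans ((h ω hω).trans b1)) (a2.symm.trans ((h _ (hR ω hω)).trans b2))
    a3 a4 b3 b4

/-- The traces of the two codes on the box of `y` coincide. -/
def TrEq (K : Finset ι) (A B : Finset (ι → S)) (y : ι → S) : Prop :=
  ∀ x, Inn K x y → (Cov K A x ↔ Cov K B x)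

theorem TrEq.symm {K : Finset ι} {A B : Finset (ι → S)} {y : ι → S} (h : TrEq K A B y) :
    TrEq K B A y := fun x hx => (h x hx).symm

/-- All words of the code meet the box of `y`. -/
def Meets (K : Finset ι) (A : Finset (ι → S)) (y : ι → S) : Prop := ∀ a ∈ A, ¬ Dic K a y

theorem Meets.sl {K : Finset ι} {A : Finset (ι → S)} {y : ι → S} (h : Meets K A y) (k : ι) (z : S) :
    Meets (K.erase k) (sl A k z) y := fun a ha hd => h a (mem_sl.1 ha).1 hd.of_erase

theorem TrEq.square {K : Finset ι} {A B : Finset (ι → S)} {y : ι → S} (h : TrEq K A B y)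
    (hA : IsCode K A) (hB : IsCode K B) {k : ι} (hk : k ∈ K) {z : S} (hz : z ≠ y k)
    (hz' : z ≠ cp (y k)) {x : ι → Sel S} (hx : Inn (K.erase k) x y) :
    ((Cov (K.erase k) (sl A k z) x ∧ Cov (K.erase k) (sl B k (cp z)) x) ↔
      (Cov (K.erase k) (sl A k (cp z)) x ∧ Cov (K.erase k) (sl B k z) x)) ∧
    ((Cov (K.erase k) (sl A k z) x ∨ Cov (K.erase k) (sl B k (cp z)) x) ↔
      (Cov (K.erase k) (sl A k (cp z)) x ∨ Cov (K.erase k) (sl B k z) x)) := by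
  refine Keller.square hA hB hk z x (fun ω => ω.val (y k)) ?_ ?_ ?_
  · obtain ⟨ω, h, -⟩ := exists_sel_two (ne_cp (y k))
    exact ⟨ω, h⟩
  · intro ω hω
    exact (ω.tog_of_ne hz.symm (by grind)).2 hω
  · intro ω hω
    exact h _ ((inn_update hk).2 ⟨hω, hx⟩)

theorem isCode_singleton (K : Finset ι) (w : ι → S) : IsCode K {w} := by
  intro v hv v' hv' hne
  simp only [Finset.mem_singleton] at hv hv'
  exact absurd (hv.trans hv'.symm) hne

@[simp] theorem cov_singleton {K : Finset ι} {w : ι → S} {x : ι → Sel S} :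
    Cov K {w} x ↔ Inn K x w := by simp [Cov]

@[simp] theorem cov_empty {K : Finset ι} {x : ι → Sel S} :
    ¬ Cov K (∅ : Finset (ι → S)) x := by simp [Cov]

/-- The code covers the box of `w`. -/
def Covers (K : Finset ι) (A : Finset (ι → S)) (w : ι → S) : Prop := ∀ x, Inn K x w → Cov K A x

theorem Covers.nonempty {K : Finset ι} {A : Finset (ι → S)} {w : ι → S} (h : Covers K A w) :
    A.Nonempty := by
  obtain ⟨x, hx⟩ := exists_inn K w
  obtain ⟨a, ha, -⟩ := h x hx
  exact ⟨a, ha⟩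

theorem Covers.trEq {K : Finset ι} {A : Finset (ι → S)} {w : ι → S} (h : Covers K A w) {k : ι}
    (hA : IsCode K A) (hk : k ∈ K) {z : S} (hz : z ≠ w k) (hz' : z ≠ cp (w k)) :
    TrEq (K.erase k) (sl A k z) (sl A k (cp z)) w := by
  intro x hx
  have h1 : TrEq K A {w} w := fun x hx => by simp [hx, h x hx]
  have h2 := (h1.square hA (isCode_singleton K w) hk hz hz' hx).2
  have h3 : sl {w} k z = ∅ := by ext v; simp; grind
  have h4 : sl {w} k (cp z) = ∅ := by ext v; simp; grind
  simpa [h3, h4] using h2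

theorem TrEq.nonempty {K : Finset ι} {A B : Finset (ι → S)} {y : ι → S} (h : TrEq K A B y)
    (hA : Meets K A y) (hA0 : A.Nonempty) : B.Nonempty := by
  obtain ⟨a, ha⟩ := hA0
  obtain ⟨x, hx, hxy⟩ := exists_inn_two (hA a ha)
  obtain ⟨b, hb, -⟩ := (h x hxy).1 ⟨a, ha, hx⟩
  exact ⟨b, hb⟩

/-- If a code has the same trace on `y` as a single word, then it covers that word. -/
theorem TrEq.covers_of_singleton {K : Finset ι} {B : Finset (ι → S)} {a y : ι → S}
    (h : TrEq K {a} B y) (hay : ¬ Dic K a y) (hB : Meets K B y) :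
    Meets K B a ∧ (∀ b ∈ B, ∀ k ∈ K, a k ≠ y k → b k = a k) ∧ Covers K B a := by
  have h2 : ∀ b ∈ B, ∀ k ∈ K, a k ≠ y k → b k = a k := by
    intro b hb k hk hne
    have := letters_of_sub_two (hB b hb) (w := a) (fun x hxb hxy => by
      simpa using (h x hxy).2 ⟨b, hb, hxb⟩) k hk
    grind
  refine ⟨fun b hb hd => ?_, h2, ?_⟩
  · obtain ⟨x, hx, hxy⟩ := exists_inn_two (hB b hb)
    exact hd.not_inn hx (cov_singleton.1 ((h x hxy).2 ⟨b, hb, hx⟩))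
  · exact cov_of_cov_meet hay h2 (fun x hxa hxy => (h x hxy).1 (by simpa using hxa))

/-- A code covering the box of a word not in it has at least five words, and it deviates from that
word in at least three positions. -/
theorem five_le_of_covers {K : Finset ι} {A : Finset (ι → S)} {w : ι → S} (hA : IsCode K A)
    (hm : Meets K A w) (hc : Covers K A w) (hno : ∀ a ∈ A, ¬ Agr K a w) :
    5 ≤ A.card ∧ 3 ≤ (K.filter (fun k => ∃ a ∈ A, a k ≠ w k)).card := by
  induction hn : K.card generalizing K A w with
  | zero =>
    obtain ⟨a, ha⟩ := hc.nonempty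
    rw [Finset.card_eq_zero] at hn
    subst hn
    exact absurd (fun k hk => by simp at hk) (hno a ha)
  | succ n ih =>
    have used : ∀ a ∈ A, ∀ k ∈ K, a k ≠ w k → a k ≠ cp (w k) := fun a ha k hk _ e =>
      hm a ha ⟨k, hk, by rw [e, cp_cp]⟩
    have htr : ∀ a ∈ A, ∀ k ∈ K, a k ≠ w k →
        TrEq (K.erase k) (sl A k (a k)) (sl A k (cp (a k))) w := fun a ha k hk h =>
      hc.trEq hA hk h (used a ha k hk h)
    by_cases hone : ∃ v ∈ A, ∃ k ∈ K, v k ≠ w k ∧ sl A k (v k) = {v}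
    · obtain ⟨v, hv, k, hk, hvk, hs⟩ := hone
      have h1 := htr v hv k hk hvk
      have hne := hA.noC_sl hk (v k)
      rw [hs] at h1 hne
      have hm' := hm.sl k (cp (v k))
      obtain ⟨g1, g2, g3⟩ := h1.covers_of_singleton (fun h => hm v hv h.of_erase) hm'
      obtain ⟨i1, i2⟩ := ih (hA.sl k _) g1 g3
        (fun b hb e => hne v (by simp) b hb e.symm) (by rw [Finset.card_erase_of_mem hk]; omega)
      refine ⟨i1.trans (Finset.card_le_card (sl_subset _ _ _)), i2.trans (Finset.card_le_card ?_)⟩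
      intro k' hk'
      simp only [Finset.mem_filter, Finset.mem_erase, mem_sl] at hk' ⊢
      obtain ⟨⟨-, hk''⟩, b, ⟨hb, -⟩, e⟩ := hk'
      refine ⟨hk'', ?_⟩
      by_cases e' : v k' = w k'
      · exact ⟨b, hb, e' ▸ e⟩
      · exact ⟨v, hv, e'⟩
    · have two : ∀ a ∈ A, ∀ k ∈ K, a k ≠ w k → ∃ v ∈ sl A k (a k), v ≠ a := by
        intro a ha k hk h
        by_contra hcon
        push Not at hcon
        refine hone ⟨a, ha, k, hk, h, ?_⟩
        ext v
        simp only [Finset.mem_singleton]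
        exact ⟨hcon v, fun e => by subst e; simp [ha]⟩
      have two' : ∀ a ∈ A, ∀ k ∈ K, a k ≠ w k → 2 ≤ (sl A k (a k)).card := by
        intro a ha k hk h
        obtain ⟨v, hv, hne⟩ := two a ha k hk h
        exact Finset.one_lt_card.2 ⟨v, hv, a, by simp [ha], hne⟩
      have two'' : ∀ a ∈ A, ∀ k ∈ K, a k ≠ w k → 2 ≤ (sl A k (cp (a k))).card := by
        intro a ha k hk h
        obtain ⟨b, hb⟩ := (htr a ha k hk h).nonempty (hm.sl k _) ⟨a, by simp [ha]⟩
        rw [mem_sl] at hb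
        have := two' b hb.1 k hk (by
          have := used a ha k hk h
          grind)
        rwa [hb.2] at this
      constructor
      · by_contra hlt
        have all : ∀ a ∈ A, ∀ k ∈ K, a k ≠ w k → ∀ b ∈ A, b k = a k ∨ b k = cp (a k) := by
          intro a ha k hk h b hb
          by_contra hcon
          push Not at hcon
          have h1 := two' a ha k hk h
          have h2 := two'' a ha k hk h
          have h3 := card_sl_four A k hcon.1 hcon.2
          have h4 : 0 < (sl A k (b k)).card := Finset.card_pos.2 ⟨b, by simp [hb]⟩
          omega
        obtain ⟨a, ha⟩ := hc.nonempty
        obtain ⟨k, hk, hak⟩ : ∃ k ∈ K, a k ≠ w k := by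
          have := hno a ha
          simpa [Agr] using this
        obtain ⟨x, hxa, hxw⟩ := exists_inn_two (hm a ha)
        have hx' : Inn K (Function.update x k ((x k).tog (a k))) w := by
          rw [inn_update hk]
          refine ⟨((x k).tog_of_ne (fun e => hak e.symm) ?_).2 (hxw k hk), hxw.erase k⟩
          have := used a ha k hk hak
          grind
        obtain ⟨b, hb, hxb⟩ := hc _ hx'
        rw [inn_update hk] at hxb
        have hbk : b k = cp (a k) := by
          rcases all a ha k hk hak b hb with e | e
          · rw [e, Sel.tog_self] at hxb
            exact absurd (hxa k hk) hxb.1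
          · exact e
        refine (hA a ha b hb (by rintro rfl; exact ne_cp _ hbk)).2 ⟨k, hk, hbk, fun k' hk' hne => ?_⟩
        have v1 := hxa k' hk'
        have v2 := hxb.2 k' (Finset.mem_erase.2 ⟨hne, hk'⟩)
        by_cases e : a k' = w k'
        · by_cases e' : b k' = w k'
          · rw [e, e']
          · rcases all b hb k' hk' e' a ha with e1 | e1
            · exact e1.symm
            · rw [e1, Sel.val_cp] at v1
              exact absurd v2 v1
        · rcases all a ha k' hk' e b hb with e1 | e1
          · exact e1
          · rw [e1, Sel.val_cp] at v2
            exact absurd v1 v2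
      · obtain ⟨a, ha⟩ := hc.nonempty
        obtain ⟨k, hk, hak⟩ : ∃ k ∈ K, a k ≠ w k := by
          have := hno a ha
          simpa [Agr] using this
        obtain ⟨v, hv, hva⟩ := two a ha k hk hak
        rw [mem_sl] at hv
        obtain ⟨⟨k', hk', e1⟩, ht⟩ := hA a ha v hv.1 (Ne.symm hva)
        obtain ⟨k'', hk'', hne, e2⟩ : ∃ k'' ∈ K, k'' ≠ k' ∧ v k'' ≠ a k'' := by
          by_contra hcon
          push Not at hcon
          exact ht ⟨k', hk', e1, hcon⟩
        have d1 : k ≠ k' := by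
          rintro rfl
          exact ne_cp _ (hv.2.symm.trans e1)
        have d2 : k ≠ k'' := by
          rintro rfl
          exact e2 hv.2
        have act : ∀ j ∈ K, v j ≠ a j → j ∈ K.filter (fun k => ∃ a ∈ A, a k ≠ w k) := by
          intro j hj h
          simp only [Finset.mem_filter]
          refine ⟨hj, ?_⟩
          by_cases e : a j = w j
          · exact ⟨v, hv.1, by rwa [← e]⟩
          · exact ⟨a, ha, e⟩
        have : ({k, k', k''} : Finset ι).card = 3 := Finset.card_eq_three.2
          ⟨k, k', k'', d1, d2, hne.symm, rfl⟩
        rw [← this]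
        refine Finset.card_le_card ?_
        intro j hj
        simp only [Finset.mem_insert, Finset.mem_singleton] at hj
        rcases hj with rfl | rfl | rfl
        · simp only [Finset.mem_filter]
          exact ⟨hk, a, ha, hak⟩
        · exact act _ hk' (by rw [e1]; exact cp_ne _)
        · exact act _ hk'' e2

end Local

section Tiles

variable {S : Type} [Cpl S] {ι : Type} [DecidableEq ι]

/-- Two codes with the same nonempty trace: either both have two words, or one has a single word and
the other has at least five. -/
theorem TrEq.card {K : Finset ι} {A B : Finset (ι → S)} {y : ι → S} (h : TrEq K A B y)
    (hA : IsCode K A) (hB : IsCode K B) (hAy : Meets K A y) (hBy : Meets K B y)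
    (hno : NoC K A B) (h0 : A.Nonempty) :
    (2 ≤ A.card ∧ 2 ≤ B.card) ∨ (A.card = 1 ∧ 5 ≤ B.card) ∨ (5 ≤ A.card ∧ B.card = 1) := by
  have one : ∀ {A B : Finset (ι → S)}, TrEq K A B y → IsCode K B → Meets K A y → Meets K B y →
      NoC K A B → A.card = 1 → 5 ≤ B.card := by
    intro A B h hB hAy hBy hno h1
    obtain ⟨a, rfl⟩ := Finset.card_eq_one.1 h1
    obtain ⟨g1, -, g3⟩ := h.covers_of_singleton (hAy a (by simp)) hBy
    exact (five_le_of_covers hB g1 g3 fun b hb e => hno a (by simp) b hb e.symm).1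
  have h1 : 1 ≤ A.card := Finset.card_pos.2 h0
  have h2 : 1 ≤ B.card := Finset.card_pos.2 (h.nonempty hAy h0)
  have h3 := one h hB hAy hBy hno
  have h4 := one h.symm hA hBy hAy hno.symm
  omega

theorem Covers.card_eq_one_or {K : Finset ι} {A : Finset (ι → S)} {w : ι → S} (hA : IsCode K A)
    (hm : Meets K A w) (hc : Covers K A w) :
    (∃ a, A = {a} ∧ Agr K a w) ∨ ((∀ a ∈ A, ¬ Agr K a w) ∧ 5 ≤ A.card) := by
  by_cases h : ∃ a ∈ A, Agr K a w
  · obtain ⟨a, ha, e⟩ := h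
    refine Or.inl ⟨a, ?_, e⟩
    ext b
    simp only [Finset.mem_singleton]
    refine ⟨fun hb => ?_, fun h => h ▸ ha⟩
    by_contra hne
    obtain ⟨⟨k, hk, h1⟩, -⟩ := hA a ha b hb (Ne.symm hne)
    exact hm b hb ⟨k, hk, by rw [h1, cp_cp, e k hk]⟩
  · push Not at h
    exact Or.inr ⟨h, (five_le_of_covers hA hm hc h).1⟩

/-- If a code covers the box of `w` and no word has the letter `w k` at position `k`, then it has at
least six words. -/
theorem six_le_of_covers {K : Finset ι} {A : Finset (ι → S)} {w : ι → S} (hA : IsCode K A)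
    (hm : Meets K A w) (hc : Covers K A w) {k : ι} (hk : k ∈ K) (hne : ∀ a ∈ A, a k ≠ w k) :
    6 ≤ A.card ∧ (A.card ≤ 7 → ∃ a ∈ A, Agr (K.erase k) a w ∧ sl A k (a k) = {a} ∧
      (∀ b ∈ A, b k = a k ∨ b k = cp (a k)) ∧ Covers (K.erase k) (sl A k (cp (a k))) w) := by
  have used : ∀ a ∈ A, a k ≠ cp (w k) := fun a ha e => hm a ha ⟨k, hk, by rw [e, cp_cp]⟩
  have htr : ∀ a ∈ A, TrEq (K.erase k) (sl A k (a k)) (sl A k (cp (a k))) w := fun a ha =>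
      hc.trEq hA hk (hne a ha) (used a ha)
  have hcd : ∀ a ∈ A, 4 ≤ (sl A k (a k)).card + (sl A k (cp (a k))).card := by
    intro a ha
    have := (htr a ha).card (hA.sl k _) (hA.sl k _) (hm.sl k _) (hm.sl k _) (hA.noC_sl hk _)
      ⟨a, by simp [ha]⟩
    omega
  by_cases htwo : ∃ a ∈ A, ∃ b ∈ A, b k ≠ a k ∧ b k ≠ cp (a k)
  · obtain ⟨a, ha, b, hb, h1, h2⟩ := htwo
    have := card_sl_four A k h1 h2
    have := hcd a ha
    have := hcd b hb
    exact ⟨by omega, by omega⟩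
  · push Not at htwo
    obtain ⟨a, ha⟩ := hc.nonempty
    have hall : ∀ b ∈ A, b k = a k ∨ b k = cp (a k) := fun b hb => by
      have := htwo a ha b hb
      tauto
    have cov : ∀ z : S, z ≠ w k → z ≠ cp (w k) → (∀ b ∈ A, b k = z ∨ b k = cp z) →
        Covers (K.erase k) (sl A k z) w := by
      intro z h1 h2 hall x hx
      obtain ⟨ω, hω, hω'⟩ := exists_sel_two (a := w k) (b := z) h2
      obtain ⟨b, hb, hxb⟩ := hc (Function.update x k ω) ((inn_update hk).2 ⟨hω, hx⟩)
      rw [inn_update hk] at hxb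
      refine ⟨b, mem_sl.2 ⟨hb, ?_⟩, hxb.2⟩
      rcases hall b hb with e | e
      · exact e
      · rw [e, Sel.val_cp] at hxb
        exact absurd hω' hxb.1
    have c1 := cov _ (hne a ha) (used a ha) hall
    have c2 := cov (cp (a k)) (by have := used a ha; grind) (by have := hne a ha; grind)
      (fun b hb => by have := hall b hb; rw [cp_cp]; tauto)
    have d1 := c1.card_eq_one_or (hA.sl k _) (hm.sl k _)
    have d2 := c2.card_eq_one_or (hA.sl k _) (hm.sl k _)
    have hcd := card_sl_two A k (ne_cp (a k))
    rcases d1 with ⟨v, hv, ev⟩ | ⟨-, h5⟩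
    · have hav : a = v := by
        have : a ∈ sl A k (a k) := by simp [ha]
        rw [hv] at this
        simpa using this
      subst hav
      rcases d2 with ⟨v', hv', ev'⟩ | ⟨-, h5⟩
      · exact absurd (fun j hj => (ev j hj).trans (ev' j hj).symm)
          (hA.noC_sl hk (a k) a (by simp [ha]) v' (by simp [hv']))
      · rw [hv, Finset.card_singleton] at hcd
        exact ⟨by omega, fun _ => ⟨a, ha, ev, hv, hall, c2⟩⟩
    · rcases d2 with ⟨v', hv', ev'⟩ | ⟨-, h5'⟩
      · have hm' : v' ∈ sl A k (cp (a k)) := by simp [hv']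
        rw [mem_sl] at hm'
        rw [hv', Finset.card_singleton] at hcd
        refine ⟨by omega, fun _ => ⟨v', hm'.1, ev', by rw [hm'.2, hv'], fun b hb => ?_, ?_⟩⟩
        · rw [hm'.2, cp_cp]
          exact (hall b hb).symm
        · rw [hm'.2, cp_cp]
          exact c1
      · exact ⟨by omega, by omega⟩

theorem exists_letter_of_five {K : Finset ι} {A : Finset (ι → S)} {w : ι → S} (hA : IsCode K A)
    (hm : Meets K A w) (hc : Covers K A w) (h5 : A.card ≤ 5) {k : ι} (hk : k ∈ K) :
    ∃ a ∈ A, a k = w k := by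
  by_contra h
  push Not at h
  have := (six_le_of_covers hA hm hc hk h).1
  omega

/-- A box which is, inside `y`, the union of two disjoint boxes. -/
theorem tile_two {K : Finset ι} {a b b' y : ι → S} (hay : ¬ Dic K a y) (hb : ¬ Dic K b y)
    (hb' : ¬ Dic K b' y) (hd : Dic K b b')
    (h : ∀ x, Inn K x y → (Inn K x a ↔ Inn K x b ∨ Inn K x b')) :
    ∃ κ ∈ K, a κ = y κ ∧ b' κ = cp (b κ) ∧ ∀ k ∈ K, k ≠ κ → b k = a k ∧ b' k = a k := by
  obtain ⟨κ, hκ, e⟩ := hd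
  have s1 := letters_of_sub_two hb (w := a) (fun x h1 h2 => (h x h2).2 (Or.inl h1))
  have s2 := letters_of_sub_two hb' (w := a) (fun x h1 h2 => (h x h2).2 (Or.inr h1))
  have key : ∀ c c' : ι → S, ¬ Dic K c y → c' κ = cp (c κ) →
      (∀ x, Inn K x y → (Inn K x a ↔ Inn K x c ∨ Inn K x c')) →
      a κ = y κ → ∀ k ∈ K, k ≠ κ → (a k = c k ∨ a k = y k) → c k = a k := by
    intro c c' hc e' h e1 k hk hne hs
    by_contra hck
    have hyk : a k = y k := by grind
    obtain ⟨x, hx⟩ := exists_pt K (fun j ω => ω.val (a j) ∧ ω.val (y j) ∧ (j = κ → ω.val (c κ)) ∧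
      (j = k → ¬ ω.val (c k))) (fun j hj => by
        by_cases ej : j = κ
        · subst ej
          obtain ⟨ω, h1, h2⟩ := exists_sel_two (a := c j) (b := y j) (fun e => hc ⟨j, hj, e⟩)
          exact ⟨ω, e1 ▸ h2, h2, fun _ => h1, fun e => absurd e.symm hne⟩
        · by_cases ek : j = k
          · subst ek
            obtain ⟨ω, h1, h2⟩ := exists_sel_two (a := cp (c j)) (b := y j) (by
              rw [cp_cp]; exact fun e => hck (by rw [hyk, e]))
            exact ⟨ω, hyk ▸ h2, h2, fun e => absurd e ej, fun _ => (ω.val_cp _).1 h1⟩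
          · obtain ⟨ω, h1, h2⟩ := exists_sel_two (a := a j) (b := y j) (fun e => hay ⟨j, hj, e⟩)
            exact ⟨ω, h1, h2, fun e => absurd e ej, fun e => absurd e ek⟩)
    rcases (h x (fun j hj => (hx j hj).2.1)).1 (fun j hj => (hx j hj).1) with g | g
    · exact (hx k hk).2.2.2 rfl (g k hk)
    · have := g κ hκ
      rw [e', Sel.val_cp] at this
      exact this ((hx κ hκ).2.2.1 rfl)
  have e1 : a κ = y κ := by
    rcases s1 κ hκ with e1 | e1
    · rcases s2 κ hκ with e2 | e2
      · rw [e2, e] at e1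
        exact absurd e1 (cp_ne _)
      · exact e2
    · exact e1
  refine ⟨κ, hκ, e1, e, fun k hk hne => ⟨key b b' hb e h e1 k hk hne (s1 k hk),
    key b' b hb' (by rw [e, cp_cp]) (fun x hx => by rw [h x hx, or_comm]) e1 k hk hne (s2 k hk)⟩⟩

/-- Two words dichotomous at `κ` with the same trace as a small code: the letters of that code. -/
theorem TrEq.pair {K : Finset ι} {B : Finset (ι → S)} {a a' y : ι → S} (h : TrEq K {a, a'} B y)
    (hA : IsCode K {a, a'}) (hB : IsCode K B) (ha : ¬ Dic K a y) (ha' : ¬ Dic K a' y)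
    (hBy : Meets K B y) (hcard : B.card ≤ 3) {κ : ι} (hκ : κ ∈ K) (e : a' κ = cp (a κ)) :
    y κ ≠ a κ ∧ y κ ≠ cp (a κ) ∧ (∀ b ∈ B, b κ = a κ ∨ b κ = cp (a κ) ∨ b κ = y κ) ∧
    (∀ x, Inn (K.erase κ) x y → (Inn (K.erase κ) x a ↔
      Cov (K.erase κ) (sl B κ (a κ)) x ∨ Cov (K.erase κ) (sl B κ (y κ)) x)) ∧
    (∀ x, Inn (K.erase κ) x y → (Inn (K.erase κ) x a' ↔
      Cov (K.erase κ) (sl B κ (cp (a κ))) x ∨ Cov (K.erase κ) (sl B κ (y κ)) x)) := by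
  have y1 : y κ ≠ a κ := fun e' => ha' ⟨κ, hκ, by rw [e, e', cp_cp]⟩
  have y2 : y κ ≠ cp (a κ) := fun e' => ha ⟨κ, hκ, e'⟩
  have hl : ∀ b ∈ B, b κ = a κ ∨ b κ = cp (a κ) ∨ b κ = y κ := by
    intro b hb
    by_contra hcon
    push Not at hcon
    have b1 : b κ ≠ cp (y κ) := fun e' => hBy b hb ⟨κ, hκ, by rw [e', cp_cp]⟩
    have he : ∀ z, z ≠ a κ → z ≠ cp (a κ) → sl {a, a'} κ z = ∅ := by
      intro z h1 h2
      ext v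
      simp only [mem_sl, Finset.mem_insert, Finset.mem_singleton, Finset.notMem_empty, iff_false]
      grind
    have t : TrEq (K.erase κ) (sl B κ (b κ)) (sl B κ (cp (b κ))) y := by
      intro x hx
      have := (h.symm.square hB hA hκ hcon.2.2 b1 hx).2
      rw [he _ hcon.1 hcon.2.1, he (cp (b κ)) (by grind) (by grind)] at this
      simpa using this
    have := t.card (hB.sl κ _) (hB.sl κ _) (hBy.sl κ _) (hBy.sl κ _) (hB.noC_sl hκ _)
      ⟨b, by simp [hb]⟩
    have := card_sl_two B κ (ne_cp (b κ))
    omega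
  refine ⟨y1, y2, hl, fun x hx => ?_, fun x hx => ?_⟩
  · obtain ⟨ω, w1, w2⟩ := exists_sel_two (a := a κ) (b := y κ) y2
    have := h (Function.update x κ ω) ((inn_update hκ).2 ⟨w2, hx⟩)
    have l1 : Cov K {a, a'} (Function.update x κ ω) ↔ Inn (K.erase κ) x a := by
      simp only [Cov, Finset.mem_insert, Finset.mem_singleton, exists_eq_or_imp, exists_eq_left,
        inn_update hκ, e, Sel.val_cp]
      tauto
    rw [← l1, this, cov_update hκ]
    constructor
    · rintro ⟨s, hs, b, hb, hxb⟩
      have hb' := mem_sl.1 hb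
      rcases hl b hb'.1 with g | g | g
      · exact Or.inl ⟨b, mem_sl.2 ⟨hb'.1, g⟩, hxb⟩
      · rw [← hb'.2, g, Sel.val_cp] at hs
        exact absurd w1 hs
      · exact Or.inr ⟨b, mem_sl.2 ⟨hb'.1, g⟩, hxb⟩
    · rintro (g | g)
      · exact ⟨_, w1, g⟩
      · exact ⟨_, w2, g⟩
  · obtain ⟨ω, w1, w2⟩ := exists_sel_two (a := cp (a κ)) (b := y κ) (by rwa [cp_cp])
    have := h (Function.update x κ ω) ((inn_update hκ).2 ⟨w2, hx⟩)
    have l1 : Cov K {a, a'} (Function.update x κ ω) ↔ Inn (K.erase κ) x a' := by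
      rw [Sel.val_cp] at w1
      simp only [Cov, Finset.mem_insert, Finset.mem_singleton, exists_eq_or_imp, exists_eq_left,
        inn_update hκ, e, Sel.val_cp]
      tauto
    rw [← l1, this, cov_update hκ]
    constructor
    · rintro ⟨s, hs, b, hb, hxb⟩
      have hb' := mem_sl.1 hb
      rcases hl b hb'.1 with g | g | g
      · rw [Sel.val_cp] at w1
        rw [← hb'.2, g] at hs
        exact absurd hs w1
      · exact Or.inl ⟨b, mem_sl.2 ⟨hb'.1, g⟩, hxb⟩
      · exact Or.inr ⟨b, mem_sl.2 ⟨hb'.1, g⟩, hxb⟩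
    · rintro (g | g)
      · exact ⟨_, w1, g⟩
      · exact ⟨_, w2, g⟩

end Tiles

section Forms

variable {S : Type} [Cpl S] {ι : Type} [DecidableEq ι]

/-- Two pairs of words with the same trace on `y`. -/
structure LForm (K : Finset ι) (a a' b b' y : ι → S) (κ₁ κ₂ : ι) : Prop where
  mem₁ : κ₁ ∈ K
  mem₂ : κ₂ ∈ K
  ne : κ₁ ≠ κ₂
  a₁ : a κ₁ ≠ y κ₁
  a₁' : a κ₁ ≠ cp (y κ₁)
  a'₁ : a' κ₁ = cp (a κ₁)
  b₁ : b κ₁ = y κ₁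
  b'₁ : b' κ₁ = a κ₁
  b₂ : b κ₂ ≠ y κ₂
  b₂' : b κ₂ ≠ cp (y κ₂)
  a₂ : a κ₂ = y κ₂
  a'₂ : a' κ₂ = b κ₂
  b'₂ : b' κ₂ = cp (b κ₂)
  off : ∀ k ∈ K, k ≠ κ₁ → k ≠ κ₂ → a' k = a k ∧ b k = a k ∧ b' k = a k

/-- Two words and three words with the same trace on `y`, first kind. -/
structure HForm (K : Finset ι) (a a' b₀ b₁ b₂ y : ι → S) (κ₁ κ₂ κ₃ : ι) : Prop where
  mem₁ : κ₁ ∈ K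
  mem₂ : κ₂ ∈ K
  mem₃ : κ₃ ∈ K
  ne₁₂ : κ₁ ≠ κ₂
  ne₁₃ : κ₁ ≠ κ₃
  ne₂₃ : κ₂ ≠ κ₃
  a_1 : a κ₁ ≠ y κ₁
  a_1' : a κ₁ ≠ cp (y κ₁)
  a'_1 : a' κ₁ = cp (a κ₁)
  b₀_1 : b₀ κ₁ = y κ₁
  b₁_1 : b₁ κ₁ = a κ₁
  b₂_1 : b₂ κ₁ = cp (a κ₁)
  b₀_2 : b₀ κ₂ ≠ y κ₂
  b₀_2' : b₀ κ₂ ≠ cp (y κ₂)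
  a_2 : a κ₂ = y κ₂
  a'_2 : a' κ₂ = b₀ κ₂
  b₁_2 : b₁ κ₂ = cp (b₀ κ₂)
  b₂_2 : b₂ κ₂ = b₀ κ₂
  b₀_3 : b₀ κ₃ ≠ y κ₃
  b₀_3' : b₀ κ₃ ≠ cp (y κ₃)
  a_3 : a κ₃ = b₀ κ₃
  a'_3 : a' κ₃ = y κ₃
  b₁_3 : b₁ κ₃ = b₀ κ₃
  b₂_3 : b₂ κ₃ = cp (b₀ κ₃)
  off : ∀ k ∈ K, k ≠ κ₁ → k ≠ κ₂ → k ≠ κ₃ → a' k = a k ∧ b₀ k = a k ∧ b₁ k = a k ∧ b₂ k = a k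

/-- Two words and three words with the same trace on `y`, second kind. -/
structure HForm' (K : Finset ι) (a a' b₀ b₁ b₂ y : ι → S) (κ₁ κ₂ κ₃ : ι) : Prop where
  mem₁ : κ₁ ∈ K
  mem₂ : κ₂ ∈ K
  mem₃ : κ₃ ∈ K
  ne₁₂ : κ₁ ≠ κ₂
  ne₁₃ : κ₁ ≠ κ₃
  ne₂₃ : κ₂ ≠ κ₃
  a_1 : a κ₁ ≠ y κ₁
  a_1' : a κ₁ ≠ cp (y κ₁)
  a'_1 : a' κ₁ = cp (a κ₁)
  b₀_1 : b₀ κ₁ = y κ₁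
  b₁_1 : b₁ κ₁ = cp (a κ₁)
  b₂_1 : b₂ κ₁ = cp (a κ₁)
  b₀_2 : b₀ κ₂ ≠ y κ₂
  b₀_2' : b₀ κ₂ ≠ cp (y κ₂)
  a_2 : a κ₂ = b₀ κ₂
  a'_2 : a' κ₂ = y κ₂
  b₁_2 : b₁ κ₂ = cp (b₀ κ₂)
  b₂_2 : b₂ κ₂ = y κ₂
  b₀_3 : b₀ κ₃ ≠ y κ₃
  b₀_3' : b₀ κ₃ ≠ cp (y κ₃)
  a_3 : a κ₃ = b₀ κ₃
  a'_3 : a' κ₃ = y κ₃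
  b₁_3 : b₁ κ₃ = b₀ κ₃
  b₂_3 : b₂ κ₃ = cp (b₀ κ₃)
  off : ∀ k ∈ K, k ≠ κ₁ → k ≠ κ₂ → k ≠ κ₃ → a' k = a k ∧ b₀ k = a k ∧ b₁ k = a k ∧ b₂ k = a k

theorem TrEq.pair' {K : Finset ι} {B : Finset (ι → S)} {a a' y : ι → S} (h : TrEq K {a, a'} B y)
    (hA : IsCode K {a, a'}) (hB : IsCode K B) (ha : ¬ Dic K a y) (ha' : ¬ Dic K a' y)
    (hBy : Meets K B y) (hcard : B.card ≤ 3) {κ : ι} (hκ : κ ∈ K) (e : a' κ = cp (a κ)) :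
    y κ ≠ a κ ∧ y κ ≠ cp (a κ) ∧ (∀ b ∈ B, b κ = a κ ∨ b κ = cp (a κ) ∨ b κ = y κ) ∧
    (∀ x, Inn (K.erase κ) x y → (Inn (K.erase κ) x a ↔
      ∃ b ∈ B, (b κ = a κ ∨ b κ = y κ) ∧ Inn (K.erase κ) x b)) ∧
    (∀ x, Inn (K.erase κ) x y → (Inn (K.erase κ) x a' ↔
      ∃ b ∈ B, (b κ = cp (a κ) ∨ b κ = y κ) ∧ Inn (K.erase κ) x b)) := by
  obtain ⟨h1, h2, h3, h4, h5⟩ := h.pair hA hB ha ha' hBy hcard hκ e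
  refine ⟨h1, h2, h3, fun x hx => ?_, fun x hx => ?_⟩
  · rw [h4 x hx]
    simp only [Cov, mem_sl]
    constructor
    · rintro (⟨b, ⟨hb, e⟩, g⟩ | ⟨b, ⟨hb, e⟩, g⟩)
      · exact ⟨b, hb, Or.inl e, g⟩
      · exact ⟨b, hb, Or.inr e, g⟩
    · rintro ⟨b, hb, e | e, g⟩
      · exact Or.inl ⟨b, ⟨hb, e⟩, g⟩
      · exact Or.inr ⟨b, ⟨hb, e⟩, g⟩
  · rw [h5 x hx]
    simp only [Cov, mem_sl]
    constructor
    · rintro (⟨b, ⟨hb, e⟩, g⟩ | ⟨b, ⟨hb, e⟩, g⟩)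
      · exact ⟨b, hb, Or.inl e, g⟩
      · exact ⟨b, hb, Or.inr e, g⟩
    · rintro ⟨b, hb, e | e, g⟩
      · exact Or.inl ⟨b, ⟨hb, e⟩, g⟩
      · exact Or.inr ⟨b, ⟨hb, e⟩, g⟩

theorem exists_y_letter {K : Finset ι} {B : Finset (ι → S)} {a y : ι → S} (hB : IsCode K B)
    (ha : ¬ Dic K a y) (hBy : Meets K B y) (hno : ∀ b ∈ B, ¬ Agr K a b)
    (hcard : B.card ≤ 3) {κ : ι} (hκ : κ ∈ K) (z : S) (hz : a κ = z)
    (h4 : ∀ x, Inn (K.erase κ) x y → (Inn (K.erase κ) x a ↔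
      ∃ b ∈ B, (b κ = z ∨ b κ = y κ) ∧ Inn (K.erase κ) x b)) : ∃ b ∈ B, b κ = y κ := by
  by_contra hcon
  push Not at hcon
  have ha' : ¬ Dic (K.erase κ) a y := fun h => ha h.of_erase
  have t : TrEq (K.erase κ) {a} (sl B κ z) y := by
    intro x hx
    rw [cov_singleton, h4 x hx]
    constructor
    · rintro ⟨b, hb, e | e, g⟩
      · exact ⟨b, mem_sl.2 ⟨hb, e⟩, g⟩
      · exact absurd e (hcon b hb)
    · rintro ⟨b, hb, g⟩
      rw [mem_sl] at hb
      exact ⟨b, hb.1, Or.inl hb.2, g⟩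
  have := t.card (isCode_singleton _ _) (hB.sl κ _) (fun v hv => by
    rw [Finset.mem_singleton] at hv; exact hv ▸ ha') (hBy.sl κ _) (by
    intro v hv b hb e
    rw [Finset.mem_singleton] at hv
    subst hv
    rw [mem_sl] at hb
    refine hno b hb.1 fun k hk => ?_
    by_cases ek : k = κ
    · rw [ek, hz, hb.2]
    · exact e k (Finset.mem_erase.2 ⟨ek, hk⟩)) (by simp)
  rw [Finset.card_singleton] at this
  have := Finset.card_le_card (sl_subset B κ z)
  omega

theorem agr_erase {K : Finset ι} {κ : ι} {v w : ι → S} (h : Agr (K.erase κ) v w) {k : ι} (hk : k ∈ K)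
    (hne : k ≠ κ) : v k = w k := h k (Finset.mem_erase.2 ⟨hne, hk⟩)

theorem lForm_aux {K : Finset ι} {a a' b b' y : ι → S} (hB : IsCode K {b, b'}) (hbb : b ≠ b')
    (ha : ¬ Dic K a y) (ha' : ¬ Dic K a' y)
    (hBy : Meets K {b, b'} y) {κ : ι} (hκ : κ ∈ K) (e : a' κ = cp (a κ))
    (y1 : y κ ≠ a κ) (y2 : y κ ≠ cp (a κ)) (hb : b κ = y κ) (hb' : b' κ = a κ)
    (h4 : ∀ x, Inn (K.erase κ) x y → (Inn (K.erase κ) x a ↔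
      Inn (K.erase κ) x b ∨ Inn (K.erase κ) x b'))
    (h5 : ∀ x, Inn (K.erase κ) x y → (Inn (K.erase κ) x a' ↔ Inn (K.erase κ) x b)) :
    ∃ κ₂, LForm K a a' b b' y κ κ₂ := by
  have my : ∀ v, ¬ Dic K v y → ¬ Dic (K.erase κ) v y := fun v h h' => h h'.of_erase
  have mb := hBy b (by simp)
  have mb' := hBy b' (by simp)
  obtain ⟨κ₂, hκ₂, t1, t2, t3⟩ := tile_two (my _ ha) (my _ mb) (my _ mb')
    ((hB b (by simp) b' (by simp) hbb).1.erase (by rw [hb, hb']; grind)) h4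
  rw [Finset.mem_erase] at hκ₂
  have ag := agr_of_trace (my _ ha') (my _ mb) h5
  refine ⟨κ₂, ⟨hκ, hκ₂.2, hκ₂.1.symm, y1.symm, by grind, e, hb, hb', ?_, ?_, t1, ?_, t2, ?_⟩⟩
  · exact fun h => mb' ⟨κ₂, hκ₂.2, by rw [t2, cp_cp, h]⟩
  · exact fun h => mb ⟨κ₂, hκ₂.2, by rw [h, cp_cp]⟩
  · exact agr_erase ag hκ₂.2 hκ₂.1
  · intro k hk h1 h2
    obtain ⟨g1, g2⟩ := t3 k (Finset.mem_erase.2 ⟨h1, hk⟩) h2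
    exact ⟨(agr_erase ag hk h1).trans g1, g1, g2⟩

theorem not_agr_of_code {K : Finset ι} {A : Finset (ι → S)} (hA : IsCode K A) {a a' : ι → S}
    (h : a ∈ A) (h' : a' ∈ A) {κ : ι} (hκ : κ ∈ K) (e : a' κ = cp (a κ)) :
    ¬ Agr (K.erase κ) a a' := fun h2 =>
  (hA a h a' h' (by rintro rfl; exact ne_cp _ e)).2 (tw_of_agr_erase hκ h2 e)

theorem TrEq.exists_lForm {K : Finset ι} {A B : Finset (ι → S)} {y : ι → S} (h : TrEq K A B y)
    (hA : IsCode K A) (hB : IsCode K B) (hAy : Meets K A y) (hBy : Meets K B y)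
    (hno : NoC K A B) (hA2 : A.card = 2) (hB2 : B.card = 2) :
    ∃ a a' b b' κ₁ κ₂, A = {a, a'} ∧ B = {b, b'} ∧ LForm K a a' b b' y κ₁ κ₂ := by
  obtain ⟨a, a', haa, rfl⟩ := Finset.card_eq_two.1 hA2
  obtain ⟨⟨κ, hκ, e⟩, -⟩ := hA a (by simp) a' (by simp) haa
  have ha := hAy a (by simp)
  have ha' := hAy a' (by simp)
  obtain ⟨y1, y2, hl, h4, h5⟩ := h.pair' hA hB ha ha' hBy (by omega) hκ e
  obtain ⟨b, hb, eb⟩ := exists_y_letter hB ha hBy (hno a (by simp)) (by omega) hκ _ rfl h4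
  have hcd : (B.erase b).card = 1 := by rw [Finset.card_erase_of_mem hb]; omega
  obtain ⟨b', hb'⟩ := Finset.card_eq_one.1 hcd
  have hbb : b ≠ b' := by
    have : b' ∈ B.erase b := by simp [hb']
    exact (Finset.ne_of_mem_erase this).symm
  have hBe : B = {b, b'} := by rw [← Finset.insert_erase hb, hb']
  subst hBe
  simp only [Finset.mem_insert, Finset.mem_singleton, exists_eq_or_imp, exists_eq_left, eb,
    or_true, true_and] at h4 h5
  rcases hl b' (by simp) with e' | e' | e'
  · obtain ⟨κ₂, hL⟩ := lForm_aux hB hbb ha ha' hBy hκ e y1 y2 eb e'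
      (fun x hx => by rw [h4 x hx]; simp [e'])
      (fun x hx => by rw [h5 x hx, e']; have := ne_cp (a κ); have := y1.symm; simp [*])
    exact ⟨a, a', b, b', κ, κ₂, rfl, rfl, hL⟩
  · obtain ⟨κ₂, hL⟩ := lForm_aux (a := a') (a' := a) hB hbb ha' ha hBy hκ (by rw [e, cp_cp])
      (by rwa [e]) (by rwa [e, cp_cp]) eb (by rw [e', e])
      (fun x hx => by rw [h5 x hx]; simp [e'])
      (fun x hx => by rw [h4 x hx, e']; have := cp_ne (a κ); have := y2.symm; simp [*])
    exact ⟨a', a, b, b', κ, κ₂, Finset.pair_comm _ _, rfl, hL⟩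
  · refine absurd (agr_of_trace (fun h => ha h.of_erase) (fun h => ha' h.of_erase) fun x hx => ?_)
      (not_agr_of_code hA (a := a) (a' := a') (by simp) (by simp) hκ e)
    rw [h4 x hx, h5 x hx, e']
    simp

theorem tile_three_aux {K : Finset ι} {a b₀ b₁ b₂ y : ι → S} (hay : ¬ Dic K a y)
    (h0 : ¬ Dic K b₀ y) (h1 : ¬ Dic K b₁ y) (h2 : ¬ Dic K b₂ y) (d01 : Dic K b₀ b₁)
    {κ : ι} (hκ : κ ∈ K) (e : b₂ κ = cp (b₁ κ)) (e0 : b₀ κ = b₁ κ) (ea : a κ = y κ)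
    (h : ∀ x, Inn K x y → (Inn K x a ↔ Inn K x b₀ ∨ Inn K x b₁ ∨ Inn K x b₂)) :
    ∃ κ₂ ∈ K, κ₂ ≠ κ ∧ b₂ κ₂ = y κ₂ ∧ a κ₂ = y κ₂ ∧ b₁ κ₂ = cp (b₀ κ₂) ∧
      ∀ k ∈ K, k ≠ κ → (b₂ k = a k ∧ (k ≠ κ₂ → b₀ k = a k ∧ b₁ k = a k)) := by
  have my : ∀ v, ¬ Dic K v y → ¬ Dic (K.erase κ) v y := fun v h h' => h h'.of_erase
  have g2 : Agr (K.erase κ) b₂ a := agr_of_trace (my _ h2) (my _ hay) fun x hx => by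
    obtain ⟨ω, w1, w2⟩ := exists_sel_two (a := b₂ κ) (b := y κ) (fun e => h2 ⟨κ, hκ, e⟩)
    have := h (Function.update x κ ω) ((inn_update hκ).2 ⟨w2, hx⟩)
    simp only [inn_update hκ, e0, ea, w1, w2, true_and] at this
    rw [e, Sel.val_cp] at w1
    tauto
  have g1 : ∀ x, Inn (K.erase κ) x y →
      (Inn (K.erase κ) x a ↔ Inn (K.erase κ) x b₀ ∨ Inn (K.erase κ) x b₁) := fun x hx => by
    obtain ⟨ω, w1, w2⟩ := exists_sel_two (a := b₁ κ) (b := y κ) (fun e => h1 ⟨κ, hκ, e⟩)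
    have := h (Function.update x κ ω) ((inn_update hκ).2 ⟨w2, hx⟩)
    simp only [inn_update hκ, e0, e, ea, w1, w2, true_and, Sel.val_cp] at this
    tauto
  obtain ⟨κ₂, hκ₂, t1, t2, t3⟩ := tile_two (my _ hay) (my _ h0) (my _ h1)
    (d01.erase (by rw [e0]; exact ne_cp _)) g1
  have hκ₂' := Finset.mem_erase.1 hκ₂
  refine ⟨κ₂, hκ₂'.2, hκ₂'.1, by rw [g2 _ hκ₂, t1], t1, t2, fun k hk hne => ?_⟩
  exact ⟨agr_erase g2 hk hne, fun h => t3 k (Finset.mem_erase.2 ⟨hne, hk⟩) h⟩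

theorem prop_cancel {p q r s : Prop} (h1 : p ↔ q ∨ r) (h2 : p ↔ q ∨ s) (h3 : ¬ (q ∧ r))
    (h4 : ¬ (q ∧ s)) : r ↔ s := by
  by_cases hq : q <;> simp_all

theorem tile_three {K : Finset ι} {a b₀ b₁ b₂ y : ι → S} (hay : ¬ Dic K a y)
    (h0 : ¬ Dic K b₀ y) (h1 : ¬ Dic K b₁ y) (h2 : ¬ Dic K b₂ y) (d01 : Dic K b₀ b₁)
    (d02 : Dic K b₀ b₂) (d12 : Dic K b₁ b₂) (t12 : ¬ Tw K b₁ b₂)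
    (h : ∀ x, Inn K x y → (Inn K x a ↔ Inn K x b₀ ∨ Inn K x b₁ ∨ Inn K x b₂)) :
    ∃ c₁ c₂, (c₁ = b₁ ∧ c₂ = b₂ ∨ c₁ = b₂ ∧ c₂ = b₁) ∧ ∃ κ₃ ∈ K, ∃ κ₂ ∈ K, κ₂ ≠ κ₃ ∧
      a κ₃ = y κ₃ ∧ c₂ κ₃ = cp (c₁ κ₃) ∧ b₀ κ₃ = c₁ κ₃ ∧
      c₂ κ₂ = y κ₂ ∧ a κ₂ = y κ₂ ∧ c₁ κ₂ = cp (b₀ κ₂) ∧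
      ∀ k ∈ K, k ≠ κ₃ → (c₂ k = a k ∧ (k ≠ κ₂ → b₀ k = a k ∧ c₁ k = a k)) := by
  obtain ⟨κ, hκ, e⟩ := d12
  have s1 := letters_of_sub_two h1 (w := a) (fun x g1 g2 => (h x g2).2 (Or.inr (Or.inl g1))) κ hκ
  have s2 := letters_of_sub_two h2 (w := a) (fun x g1 g2 => (h x g2).2 (Or.inr (Or.inr g1))) κ hκ
  have ea : a κ = y κ := by
    rcases s1 with g | g
    · rcases s2 with g' | g'
      · rw [g', e] at g
        exact absurd g (cp_ne _)
      · exact g'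
    · exact g
  by_cases c1 : b₀ κ = b₁ κ
  · obtain ⟨κ₂, r1, r2, r3, r4, r5, r6⟩ := tile_three_aux hay h0 h1 h2 d01 hκ e c1 ea h
    exact ⟨b₁, b₂, Or.inl ⟨rfl, rfl⟩, κ, hκ, κ₂, r1, r2, ea, e, c1, r3, r4, r5, r6⟩
  by_cases c2 : b₀ κ = b₂ κ
  · obtain ⟨κ₂, r1, r2, r3, r4, r5, r6⟩ := tile_three_aux hay h0 h2 h1 d02 hκ (by rw [e, cp_cp]) c2
      ea (fun x hx => by rw [h x hx]; tauto)
    exact ⟨b₂, b₁, Or.inr ⟨rfl, rfl⟩, κ, hκ, κ₂, r1, r2, ea, by rw [e, cp_cp], c2, r3, r4, r5, r6⟩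
  exfalso
  have y1 : y κ ≠ b₁ κ := fun g => h2 ⟨κ, hκ, by rw [e, cp_cp, g]⟩
  have y2 : y κ ≠ cp (b₁ κ) := fun g => h1 ⟨κ, hκ, g⟩
  refine t12 (tw_of_agr_erase hκ (agr_of_trace (fun h => h1 h.of_erase) (fun h => h2 h.of_erase)
    fun x hx => ?_) e)
  obtain ⟨ω, w1, w2⟩ := exists_sel_two (a := b₁ κ) (b := y κ) (fun e => h1 ⟨κ, hκ, e⟩)
  have p1 := h (Function.update x κ ω) ((inn_update hκ).2 ⟨w2, hx⟩)
  have w2' : (ω.tog (b₁ κ)).val (y κ) := (ω.tog_of_ne y1 y2).2 w2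
  have w1' : ¬ (ω.tog (b₁ κ)).val (b₁ κ) := by rw [Sel.tog_self]; exact fun h => h w1
  have p2 := h (Function.update x κ (ω.tog (b₁ κ))) ((inn_update hκ).2 ⟨w2', hx⟩)
  have q : (ω.tog (b₁ κ)).val (b₀ κ) ↔ ω.val (b₀ κ) := ω.tog_of_ne c1 (e ▸ c2)
  have n1 : ¬ (Inn K (Function.update x κ ω) b₀ ∧ Inn K (Function.update x κ ω) b₁) :=
    fun g => d01.not_inn g.1 g.2
  have n2 : ¬ (Inn K (Function.update x κ (ω.tog (b₁ κ))) b₀ ∧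
      Inn K (Function.update x κ (ω.tog (b₁ κ))) b₂) := fun g => d02.not_inn g.1 g.2
  simp only [inn_update hκ, ea, e, q, Sel.val_cp, w1, w2, w1', w2', true_and, not_true,
    not_false_eq_true, false_and, or_false, false_or] at p1 p2 n1 n2
  exact prop_cancel p1 p2 n1 n2

theorem hForm_aux {K : Finset ι} {a a' b₀ b₁ b₂ y : ι → S} (hA : IsCode K {a, a'})
    (hB : IsCode K {b₀, b₁, b₂}) (h01 : b₀ ≠ b₁) (h02 : b₀ ≠ b₂)
    (ha : ¬ Dic K a y) (ha' : ¬ Dic K a' y)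
    (hBy : Meets K {b₀, b₁, b₂} y) {κ : ι} (hκ : κ ∈ K) (e : a' κ = cp (a κ))
    (y1 : y κ ≠ a κ) (y2 : y κ ≠ cp (a κ)) (hb0 : b₀ κ = y κ) (hb1 : b₁ κ = a κ)
    (hb2 : b₂ κ = cp (a κ))
    (h4 : ∀ x, Inn (K.erase κ) x y → (Inn (K.erase κ) x a ↔
      Inn (K.erase κ) x b₀ ∨ Inn (K.erase κ) x b₁))
    (h5 : ∀ x, Inn (K.erase κ) x y → (Inn (K.erase κ) x a' ↔
      Inn (K.erase κ) x b₀ ∨ Inn (K.erase κ) x b₂)) :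
    ∃ κ₂ κ₃, HForm K a a' b₀ b₁ b₂ y κ κ₂ κ₃ := by
  have my : ∀ v, ¬ Dic K v y → ¬ Dic (K.erase κ) v y := fun v h h' => h h'.of_erase
  have m0 := hBy b₀ (by simp)
  have m1 := hBy b₁ (by simp)
  have m2 := hBy b₂ (by simp)
  obtain ⟨κ₂, hκ₂, s1, s2, s3⟩ := tile_two (my _ ha) (my _ m0) (my _ m1)
    ((hB b₀ (by simp) b₁ (by simp) h01).1.erase (by rw [hb0, hb1]; grind)) h4
  obtain ⟨κ₃, hκ₃, t1, t2, t3⟩ := tile_two (my _ ha') (my _ m0) (my _ m2)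
    ((hB b₀ (by simp) b₂ (by simp) h02).1.erase (by rw [hb0, hb2]; grind)) h5
  have hne : κ₂ ≠ κ₃ := by
    rintro rfl
    refine not_agr_of_code hA (a := a) (a' := a') (by simp) (by simp) hκ e fun k hk => ?_
    by_cases ek : k = κ₂
    · rw [ek, s1, t1]
    · rw [← (s3 k hk ek).1, ← (t3 k hk ek).1]
  have hκ₂' := Finset.mem_erase.1 hκ₂
  have hκ₃' := Finset.mem_erase.1 hκ₃
  have f1 := t3 κ₂ hκ₂ hne
  have f2 := s3 κ₃ hκ₃ hne.symm
  refine ⟨κ₂, κ₃, hκ, hκ₂'.2, hκ₃'.2, hκ₂'.1.symm, hκ₃'.1.symm, hne, y1.symm, by grind, e, hb0, hb1,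
    hb2, ?_, ?_, s1, f1.1.symm, s2, f1.2.trans f1.1.symm, ?_, ?_, f2.1.symm, t1,
    f2.2.trans f2.1.symm, t2, ?_⟩
  · exact fun h => m1 ⟨κ₂, hκ₂'.2, by rw [s2, cp_cp, h]⟩
  · exact fun h => m0 ⟨κ₂, hκ₂'.2, by rw [h, cp_cp]⟩
  · exact fun h => m2 ⟨κ₃, hκ₃'.2, by rw [t2, cp_cp, h]⟩
  · exact fun h => m0 ⟨κ₃, hκ₃'.2, by rw [h, cp_cp]⟩
  · intro k hk n1 n2 n3
    have g1 := s3 k (Finset.mem_erase.2 ⟨n1, hk⟩) n2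
    have g2 := t3 k (Finset.mem_erase.2 ⟨n1, hk⟩) n3
    exact ⟨g2.1.symm.trans g1.1, g1.1, g1.2, g2.2.trans (g2.1.symm.trans g1.1)⟩

theorem hForm'_aux {K : Finset ι} {a a' b₀ b₁ b₂ y : ι → S}
    (hB : IsCode K {b₀, b₁, b₂}) (h01 : b₀ ≠ b₁) (h02 : b₀ ≠ b₂) (h12 : b₁ ≠ b₂)
    (ha : ¬ Dic K a y) (ha' : ¬ Dic K a' y)
    (hBy : Meets K {b₀, b₁, b₂} y) {κ : ι} (hκ : κ ∈ K) (e : a' κ = cp (a κ))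
    (y1 : y κ ≠ a κ) (y2 : y κ ≠ cp (a κ)) (hb0 : b₀ κ = y κ) (hb1 : b₁ κ = cp (a κ))
    (hb2 : b₂ κ = cp (a κ))
    (h4 : ∀ x, Inn (K.erase κ) x y → (Inn (K.erase κ) x a ↔ Inn (K.erase κ) x b₀))
    (h5 : ∀ x, Inn (K.erase κ) x y → (Inn (K.erase κ) x a' ↔
      Inn (K.erase κ) x b₀ ∨ Inn (K.erase κ) x b₁ ∨ Inn (K.erase κ) x b₂)) :
    ∃ c₁ c₂ κ₂ κ₃, ({b₀, b₁, b₂} : Finset (ι → S)) = {b₀, c₁, c₂} ∧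
      HForm' K a a' b₀ c₁ c₂ y κ κ₂ κ₃ := by
  have my : ∀ v, ¬ Dic K v y → ¬ Dic (K.erase κ) v y := fun v h h' => h h'.of_erase
  have m0 := hBy b₀ (by simp)
  have m1 := hBy b₁ (by simp)
  have m2 := hBy b₂ (by simp)
  have hs := hB.sl κ (cp (a κ))
  have ag := agr_of_trace (my _ ha) (my _ m0) h4
  have q1 : b₁ ∈ sl {b₀, b₁, b₂} κ (cp (a κ)) := by simp [hb1]
  have q2 : b₂ ∈ sl {b₀, b₁, b₂} κ (cp (a κ)) := by simp [hb2]
  obtain ⟨c₁, c₂, hc, κ₃, hκ₃, κ₂, hκ₂, t1, t2, t3, t4, t5, t6, t7, t8⟩ :=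
    tile_three (my _ ha') (my _ m0) (my _ m1) (my _ m2)
    ((hB b₀ (by simp) b₁ (by simp) h01).1.erase (by rw [hb0, hb1]; grind))
    ((hB b₀ (by simp) b₂ (by simp) h02).1.erase (by rw [hb0, hb2]; grind))
    (hs b₁ q1 b₂ q2 h12).1 (hs b₁ q1 b₂ q2 h12).2 h5
  have hset : ({b₀, b₁, b₂} : Finset (ι → S)) = {b₀, c₁, c₂} := by
    rcases hc with ⟨rfl, rfl⟩ | ⟨rfl, rfl⟩
    · rfl
    · rw [Finset.pair_comm]
  have hc1 : c₁ κ = cp (a κ) := by rcases hc with ⟨rfl, rfl⟩ | ⟨rfl, rfl⟩ <;> assumption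
  have hc2 : c₂ κ = cp (a κ) := by rcases hc with ⟨rfl, rfl⟩ | ⟨rfl, rfl⟩ <;> assumption
  rw [hset] at hBy
  have m1 := hBy c₁ (by simp)
  have m2 := hBy c₂ (by simp)
  have hκ₂' := Finset.mem_erase.1 hκ₂
  have hκ₃' := Finset.mem_erase.1 hκ₃
  refine ⟨c₁, c₂, κ₂, κ₃, hset, hκ, hκ₂'.2, hκ₃'.2, hκ₂'.1.symm, hκ₃'.1.symm, t1, y1.symm, by grind,
    e, hb0, hc1, hc2, ?_, ?_, ag _ hκ₂, t6, t7, t5, ?_, ?_, ag _ hκ₃, t2, t4.symm, ?_, ?_⟩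
  · exact fun h => m1 ⟨κ₂, hκ₂'.2, by rw [t7, cp_cp, h]⟩
  · exact fun h => m0 ⟨κ₂, hκ₂'.2, by rw [h, cp_cp]⟩
  · exact fun h => m2 ⟨κ₃, hκ₃'.2, by rw [t3, cp_cp, ← t4, h]⟩
  · exact fun h => m0 ⟨κ₃, hκ₃'.2, by rw [h, cp_cp]⟩
  · rw [t3, t4]
  · intro k hk n1 n2 n3
    have hk' := Finset.mem_erase.2 ⟨n1, hk⟩
    have g1 := t8 k hk' n3
    have g2 := g1.2 n2
    have g3 := ag k hk'
    exact ⟨by rw [g3, g2.1], g3.symm, by rw [g3, g2.1, g2.2], by rw [g3, g2.1, g1.1]⟩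

theorem TrEq.exists_hForm {K : Finset ι} {A B : Finset (ι → S)} {y : ι → S} (h : TrEq K A B y)
    (hA : IsCode K A) (hB : IsCode K B) (hAy : Meets K A y) (hBy : Meets K B y)
    (hno : NoC K A B) (hA2 : A.card = 2) (hB3 : B.card = 3) :
    ∃ a a' b₀ b₁ b₂ κ₁ κ₂ κ₃, A = {a, a'} ∧ B = {b₀, b₁, b₂} ∧
      (HForm K a a' b₀ b₁ b₂ y κ₁ κ₂ κ₃ ∨ HForm' K a a' b₀ b₁ b₂ y κ₁ κ₂ κ₃) := by
  obtain ⟨a, a', haa, rfl⟩ := Finset.card_eq_two.1 hA2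
  obtain ⟨⟨κ, hκ, e⟩, -⟩ := hA a (by simp) a' (by simp) haa
  have ha := hAy a (by simp)
  have ha' := hAy a' (by simp)
  have my : ∀ v, ¬ Dic K v y → ¬ Dic (K.erase κ) v y := fun v h h' => h h'.of_erase
  obtain ⟨y1, y2, hl, h4, h5⟩ := h.pair' hA hB ha ha' hBy (by omega) hκ e
  obtain ⟨b₀, hb, eb⟩ := exists_y_letter hB ha hBy (hno a (by simp)) (by omega) hκ _ rfl h4
  have hcd : (B.erase b₀).card = 2 := by rw [Finset.card_erase_of_mem hb]; omega
  obtain ⟨b₁, b₂, h12, hb'⟩ := Finset.card_eq_two.1 hcd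
  have h01 : b₀ ≠ b₁ := by
    have : b₁ ∈ B.erase b₀ := by simp [hb']
    exact (Finset.ne_of_mem_erase this).symm
  have h02 : b₀ ≠ b₂ := by
    have : b₂ ∈ B.erase b₀ := by simp [hb']
    exact (Finset.ne_of_mem_erase this).symm
  have hBe : B = {b₀, b₁, b₂} := by rw [← Finset.insert_erase hb, hb']
  subst hBe
  simp only [Finset.mem_insert, Finset.mem_singleton, exists_eq_or_imp, exists_eq_left, eb,
    or_true, true_and] at h4 h5
  have n1 := ne_cp (a κ)
  have n1' := cp_ne (a κ)
  have n2 := y1.symm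
  have n3 := y2.symm
  have m0 := hBy b₀ (by simp)
  have m1 := hBy b₁ (by simp)
  have m2 := hBy b₂ (by simp)
  have e' : a κ = cp (a' κ) := by rw [e, cp_cp]
  have n4 : y κ ≠ a' κ := by rwa [e]
  have n5 : y κ ≠ cp (a' κ) := by rwa [e, cp_cp]
  have hA' : IsCode K {a', a} := by rwa [Finset.pair_comm]
  have twin : ∀ c c' v : ι → S, c ∈ ({b₀, b₁, b₂} : Finset (ι → S)) →
      c' ∈ ({b₀, b₁, b₂} : Finset (ι → S)) → c ≠ c' → c κ = y κ → c' κ = y κ → ¬ Dic K v y →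
      (∀ x, Inn (K.erase κ) x y → (Inn (K.erase κ) x v ↔
        Inn (K.erase κ) x c ∨ Inn (K.erase κ) x c')) → False := by
    intro c c' v hc hc' hne ec ec' hv hx
    have hs := hB.sl κ (y κ) c (mem_sl.2 ⟨hc, ec⟩) c' (mem_sl.2 ⟨hc', ec'⟩) hne
    obtain ⟨k, hk, -, t1, t2⟩ := tile_two (my _ hv) (my _ (hBy c hc)) (my _ (hBy c' hc')) hs.1 hx
    exact hs.2 ⟨k, hk, t1, fun j hj hjk => by rw [(t2 j hj hjk).1, (t2 j hj hjk).2]⟩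
  rcases hl b₁ (by simp) with e1 | e1 | e1 <;> rcases hl b₂ (by simp) with e2 | e2 | e2 <;>
    simp only [e1, e2, n1, n1', n2, n3, y1, y2, or_self, or_true, true_and, false_and,
      or_false, false_or] at h4 h5
  · have hB' : ({b₀, b₁, b₂} : Finset (ι → S)) = {b₀, b₁, b₂} := rfl
    obtain ⟨c₁, c₂, κ₂, κ₃, hc, hH⟩ := hForm'_aux hB h01 h02 h12 ha' ha hBy hκ e' n4 n5 eb
      (by rw [e1, e']) (by rw [e2, e']) h5 h4
    exact ⟨a', a, b₀, c₁, c₂, κ, κ₂, κ₃, Finset.pair_comm _ _, hc, Or.inr hH⟩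
  · obtain ⟨κ₂, κ₃, hH⟩ := hForm_aux hA hB h01 h02 ha ha' hBy hκ e y1 y2 eb e1 e2 h4 h5
    exact ⟨a, a', b₀, b₁, b₂, κ, κ₂, κ₃, rfl, rfl, Or.inl hH⟩
  · exact (twin b₀ b₂ a' (by simp) (by simp) h02 eb e2 ha' h5).elim
  · obtain ⟨κ₂, κ₃, hH⟩ := hForm_aux hA' hB h01 h02 ha' ha hBy hκ e' n4 n5 eb (by rw [e1, e])
      (by rw [e2, e']) h5 h4
    exact ⟨a', a, b₀, b₁, b₂, κ, κ₂, κ₃, Finset.pair_comm _ _, rfl, Or.inl hH⟩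
  · obtain ⟨c₁, c₂, κ₂, κ₃, hc, hH⟩ := hForm'_aux hB h01 h02 h12 ha ha' hBy hκ e y1 y2 eb e1 e2 h4 h5
    exact ⟨a, a', b₀, c₁, c₂, κ, κ₂, κ₃, rfl, hc, Or.inr hH⟩
  · exact (twin b₀ b₂ a (by simp) (by simp) h02 eb e2 ha h4).elim
  · exact (twin b₀ b₁ a' (by simp) (by simp) h01 eb e1 ha' h5).elim
  · exact (twin b₀ b₁ a (by simp) (by simp) h01 eb e1 ha h4).elim
  · refine absurd (agr_of_trace (my _ ha) (my _ ha') fun x hx => ?_)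
      (not_agr_of_code hA (a := a) (a' := a') (by simp) (by simp) hκ e)
    rw [h4 x hx, h5 x hx]

end Forms

section Pinwheel

variable {S : Type} [Cpl S] {ι : Type} [DecidableEq ι]

/-- Five words covering the box of `w` in the shape of a pinwheel. -/
structure PForm (K : Finset ι) (A : Finset (ι → S)) (w : ι → S) (κ₁ κ₂ κ₃ : ι) (z₁ z₂ z₃ : S) :
    Prop where
  mem₁ : κ₁ ∈ K
  mem₂ : κ₂ ∈ K
  mem₃ : κ₃ ∈ K
  ne₁₂ : κ₁ ≠ κ₂
  ne₁₃ : κ₁ ≠ κ₃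
  ne₂₃ : κ₂ ≠ κ₃
  z_1 : z₁ ≠ w κ₁
  z_1' : z₁ ≠ cp (w κ₁)
  z_2 : z₂ ≠ w κ₂
  z_2' : z₂ ≠ cp (w κ₂)
  z_3 : z₃ ≠ w κ₃
  z_3' : z₃ ≠ cp (w κ₃)
  off : ∀ a ∈ A, ∀ k ∈ K, k ≠ κ₁ → k ≠ κ₂ → k ≠ κ₃ → a k = w k
  word₁ : ∃ a ∈ A, a κ₁ = z₁ ∧ a κ₂ = cp z₂ ∧ a κ₃ = w κ₃
  word₂ : ∃ a ∈ A, a κ₁ = z₁ ∧ a κ₂ = z₂ ∧ a κ₃ = z₃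
  word₃ : ∃ a ∈ A, a κ₁ = cp z₁ ∧ a κ₂ = w κ₂ ∧ a κ₃ = z₃
  word₄ : ∃ a ∈ A, a κ₁ = cp z₁ ∧ a κ₂ = cp z₂ ∧ a κ₃ = cp z₃
  word₅ : ∃ a ∈ A, a κ₁ = w κ₁ ∧ a κ₂ = z₂ ∧ a κ₃ = cp z₃

theorem Covers.exists_pForm {K : Finset ι} {A : Finset (ι → S)} {w : ι → S} (hA : IsCode K A)
    (hm : Meets K A w) (hc : Covers K A w) (hno : ∀ a ∈ A, ¬ Agr K a w) (h5 : A.card = 5) :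
    ∃ κ₁ κ₂ κ₃ z₁ z₂ z₃, PForm K A w κ₁ κ₂ κ₃ z₁ z₂ z₃ := by
  have used : ∀ a ∈ A, ∀ k ∈ K, a k ≠ cp (w k) := fun a ha k hk e =>
    hm a ha ⟨k, hk, by rw [e, cp_cp]⟩
  have htr : ∀ a ∈ A, ∀ k ∈ K, a k ≠ w k →
      TrEq (K.erase k) (sl A k (a k)) (sl A k (cp (a k))) w := fun a ha k hk h =>
    hc.trEq hA hk h (used a ha k hk)
  have two : ∀ a ∈ A, ∀ k ∈ K, a k ≠ w k → (sl A k (a k)).card = 2 ∧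
      (sl A k (cp (a k))).card = 2 := by
    intro a ha k hk h
    have h1 := (htr a ha k hk h).card (hA.sl k _) (hA.sl k _) (hm.sl k _) (hm.sl k _)
      (hA.noC_sl hk _) ⟨a, by simp [ha]⟩
    obtain ⟨b, hb, e⟩ := exists_letter_of_five hA hm hc h5.le hk
    have h2 := card_sl_four A k (z := a k) (t := w k) h.symm (by have := used a ha k hk; grind)
    have h3 : 0 < (sl A k (w k)).card := Finset.card_pos.2 ⟨b, by simp [hb, e]⟩
    omega
  obtain ⟨v, hv⟩ := hc.nonempty
  obtain ⟨κ, hκ, hvκ⟩ : ∃ k ∈ K, v k ≠ w k := by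
    have := hno v hv
    simpa [Agr] using this
  obtain ⟨t1, t2⟩ := two v hv κ hκ hvκ
  obtain ⟨a, a', b, b', κ₁, κ₂, ea, eb, hL⟩ := (htr v hv κ hκ hvκ).exists_lForm (hA.sl κ _)
    (hA.sl κ _) (hm.sl κ _) (hm.sl κ _) (hA.noC_sl hκ _) t1 t2
  have ma : a ∈ A ∧ a κ = v κ := mem_sl.1 (ea ▸ by simp)
  have ma' : a' ∈ A ∧ a' κ = v κ := mem_sl.1 (ea ▸ by simp)
  have mb : b ∈ A ∧ b κ = cp (v κ) := mem_sl.1 (eb ▸ by simp)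
  have mb' : b' ∈ A ∧ b' κ = cp (v κ) := mem_sl.1 (eb ▸ by simp)
  obtain ⟨c, mc, ec⟩ := exists_letter_of_five hA hm hc h5.le hκ
  have k1 := Finset.mem_erase.1 hL.mem₁
  have k2 := Finset.mem_erase.1 hL.mem₂
  have naa : a ≠ a' := by rintro rfl; exact ne_cp _ hL.a'₁
  have nbb : b ≠ b' := by rintro rfl; exact ne_cp _ hL.b'₂
  have nab : ∀ x y : ι → S, x κ = v κ → y κ = cp (v κ) → x ≠ y := by
    rintro x y h1 h2 rfl
    exact ne_cp _ (h1.symm.trans h2)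
  have nc : ∀ x : ι → S, x κ = v κ ∨ x κ = cp (v κ) → x ≠ c := by
    rintro x h rfl
    have := used v hv κ hκ
    grind
  have hall : ∀ x ∈ A, x = a ∨ x = a' ∨ x = b ∨ x = b' ∨ x = c := by
    have hs : ({a, a', b, b', c} : Finset (ι → S)) = A := by
      refine Finset.eq_of_subset_of_card_le ?_ ?_
      · intro x
        simp only [Finset.mem_insert, Finset.mem_singleton]
        rintro (rfl | rfl | rfl | rfl | rfl)
        exacts [ma.1, ma'.1, mb.1, mb'.1, mc]
      · rw [h5, Finset.card_insert_of_notMem, Finset.card_insert_of_notMem,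
          Finset.card_insert_of_notMem, Finset.card_insert_of_notMem, Finset.card_singleton]
        · simpa using nc b' (Or.inr mb'.2)
        · simpa using ⟨nbb, nc b (Or.inr mb.2)⟩
        · simpa using ⟨nab _ _ ma'.2 mb.2, nab _ _ ma'.2 mb'.2, nc a' (Or.inl ma'.2)⟩
        · simpa using ⟨naa, nab _ _ ma.2 mb.2, nab _ _ ma.2 mb'.2, nc a (Or.inl ma.2)⟩
    intro x hx
    rw [← hs] at hx
    simpa using hx
  have another : ∀ x ∈ A, ∀ k ∈ K, x k ≠ w k → ∃ y ∈ A, y ≠ x ∧ y k = x k := by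
    intro x hx k hk h
    obtain ⟨y, hy, hne⟩ := Finset.exists_mem_ne (s := sl A k (x k)) (by
      rw [(two x hx k hk h).1]; norm_num) x
    exact ⟨y, (mem_sl.1 hy).1, hne, (mem_sl.1 hy).2⟩
  have la1 := hL.a₁
  have la1' := hL.a₁'
  have la'1 := hL.a'₁
  have lb1 := hL.b₁
  have lb'1 := hL.b'₁
  have lb2 := hL.b₂
  have lb2' := hL.b₂'
  have la2 := hL.a₂
  have la'2 := hL.a'₂
  have lb'2 := hL.b'₂
  have c1 : c κ₁ = cp (a κ₁) := by
    obtain ⟨y, hy, hne, e⟩ := another a' ma'.1 κ₁ k1.2 (by grind)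
    rcases hall y hy with rfl | rfl | rfl | rfl | rfl <;> grind
  have c2 : c κ₂ = cp (b κ₂) := by
    obtain ⟨y, hy, hne, e⟩ := another b' mb'.1 κ₂ k2.2 (by grind)
    rcases hall y hy with rfl | rfl | rfl | rfl | rfl <;> grind
  have off4 : ∀ k ∈ K, k ≠ κ → k ≠ κ₁ → k ≠ κ₂ → a k = w k := by
    intro k hk h h1 h2
    by_contra hne
    obtain ⟨e1, e2, e3⟩ := hL.off k (Finset.mem_erase.2 ⟨h, hk⟩) h1 h2
    have h3 := (two a ma.1 k hk hne).1
    have : ({a, a', b} : Finset (ι → S)) ⊆ sl A k (a k) := by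
      intro x
      simp only [Finset.mem_insert, Finset.mem_singleton, mem_sl]
      rintro (rfl | rfl | rfl)
      exacts [⟨ma.1, rfl⟩, ⟨ma'.1, e1⟩, ⟨mb.1, e2⟩]
    have := Finset.card_le_card this
    rw [Finset.card_eq_three.2 ⟨a, a', b, naa, nab _ _ ma.2 mb.2, nab _ _ ma'.2 mb.2, rfl⟩] at this
    omega
  have offa : ∀ x ∈ A, ∀ k ∈ K, k ≠ κ → k ≠ κ₁ → k ≠ κ₂ → x k = w k := by
    intro x hx k hk h h1 h2
    obtain ⟨e1, e2, e3⟩ := hL.off k (Finset.mem_erase.2 ⟨h, hk⟩) h1 h2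
    have e0 := off4 k hk h h1 h2
    have h4 : ∀ x ∈ A, x ≠ c → x k = w k := by
      intro x hx hne
      rcases hall x hx with rfl | rfl | rfl | rfl | rfl
      · exact e0
      · exact e1.trans e0
      · exact e2.trans e0
      · exact e3.trans e0
      · exact absurd rfl hne
    by_cases hxc : x = c
    · by_contra hne
      obtain ⟨y, hy, hyx, e⟩ := another x hx k hk hne
      exact hne (e ▸ h4 y hy (hxc ▸ hyx))
    · exact h4 x hx hxc
  refine ⟨κ, κ₁, κ₂, v κ, cp (a κ₁), b κ₂, hκ, k1.2, k2.2, k1.1.symm, k2.1.symm, hL.ne, hvκ,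
    used v hv κ hκ, by grind, by grind, lb2, lb2', offa, ⟨a, ma.1, ma.2, by simp, la2⟩,
    ⟨a', ma'.1, ma'.2, la'1, la'2⟩, ⟨b, mb.1, mb.2, lb1, rfl⟩,
    ⟨b', mb'.1, mb'.2, by rw [lb'1, cp_cp], lb'2⟩, ⟨c, mc, ec, c1, c2⟩⟩

/-- A letter shared by all points covered by a pinwheel outside its centre. -/
theorem PForm.const {K : Finset ι} {A : Finset (ι → S)} {w : ι → S} {κ₁ κ₂ κ₃ : ι} {z₁ z₂ z₃ : S}
    (h : PForm K A w κ₁ κ₂ κ₃ z₁ z₂ z₃) {k : ι} (hk : k ∈ K) {ρ : S}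
    (hρ : ∀ x, Cov K A x → ¬ Inn K x w → (x k).val ρ) :
    k ≠ κ₁ ∧ k ≠ κ₂ ∧ k ≠ κ₃ ∧ w k = ρ := by
  have key : ∀ a ∈ A, (∀ κ, κ = κ₁ ∨ κ = κ₂ ∨ κ = κ₃ → a κ ≠ w κ) → ρ = a k := by
    intro a ha hne
    by_contra hcon
    obtain ⟨κ, hκ, hκk⟩ : ∃ κ, (κ = κ₁ ∨ κ = κ₂ ∨ κ = κ₃) ∧ κ ≠ k := by
      by_cases e : κ₁ = k
      · exact ⟨κ₂, by simp, fun e' => h.ne₁₂ (e.trans e'.symm)⟩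
      · exact ⟨κ₁, by simp, e⟩
    have hκK : κ ∈ K := by
      rcases hκ with rfl | rfl | rfl
      exacts [h.mem₁, h.mem₂, h.mem₃]
    obtain ⟨x, hx⟩ := exists_pt K (fun j ω => ω.val (a j) ∧ (j = k → ¬ ω.val ρ) ∧
      (j = κ → ¬ ω.val (w κ))) (fun j hj => by
        by_cases e : j = k
        · subst e
          obtain ⟨ω, w1, w2⟩ := exists_sel_two (a := a j) (b := cp ρ) (fun e => hcon (cp_inj e))
          exact ⟨ω, w1, fun _ => (ω.val_cp _).1 w2, fun e => absurd e.symm hκk⟩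
        · by_cases e' : j = κ
          · subst e'
            obtain ⟨ω, w1, w2⟩ := exists_sel_two (a := a j) (b := cp (w j))
              (fun e => hne j hκ (cp_inj e).symm)
            exact ⟨ω, w1, fun h => absurd h e, fun _ => (ω.val_cp _).1 w2⟩
          · obtain ⟨ω, w1, -⟩ := exists_sel_two (ne_cp (a j))
            exact ⟨ω, w1, fun h => absurd h e, fun h => absurd h e'⟩)
    exact (hx k hk).2.1 rfl (hρ x ⟨a, ha, fun j hj => (hx j hj).1⟩
      fun hw => (hx κ hκK).2.2 rfl (hw κ hκK))
  obtain ⟨a, ha, a1, a2, a3⟩ := h.word₂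
  obtain ⟨b, hb, b1, b2, b3⟩ := h.word₄
  have z1 := h.z_1
  have z1' := h.z_1'
  have z2 := h.z_2
  have z2' := h.z_2'
  have z3 := h.z_3
  have z3' := h.z_3'
  have ra := key a ha (by rintro κ (rfl | rfl | rfl) <;> grind)
  have rb := key b hb (by rintro κ (rfl | rfl | rfl) <;> grind)
  have hab := ra.symm.trans rb
  have n1 : k ≠ κ₁ := by
    rintro rfl
    rw [a1, b1] at hab
    exact ne_cp _ hab
  have n2 : k ≠ κ₂ := by
    rintro rfl
    rw [a2, b2] at hab
    exact ne_cp _ hab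
  have n3 : k ≠ κ₃ := by
    rintro rfl
    rw [a3, b3] at hab
    exact ne_cp _ hab
  exact ⟨n1, n2, n3, by rw [ra, h.off a ha k hk n1 n2 n3]⟩

/-- A code whose words differ at two positions only has at most two words. -/
theorem card_le_two_of_agr {K : Finset ι} {A : Finset (ι → S)} (hA : IsCode K A) (k₁ k₂ : ι)
    (h : ∀ a ∈ A, ∀ b ∈ A, ∀ k ∈ K, k ≠ k₁ → k ≠ k₂ → a k = b k) : A.card ≤ 2 := by
  by_contra hcon
  obtain ⟨a, ha, b, hb, c, hc, hab, hac, hbc⟩ := Finset.two_lt_card.1 (not_le.1 hcon)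
  have key : ∀ v ∈ A, ∀ w ∈ A, v ≠ w → (w k₁ = cp (v k₁) ∧ w k₂ ≠ v k₂) ∨
      (w k₂ = cp (v k₂) ∧ w k₁ ≠ v k₁) := by
    intro v hv w hw hne
    obtain ⟨⟨k, hk, e⟩, ht⟩ := hA v hv w hw hne
    by_cases e1 : k = k₁
    · subst e1
      by_cases e2 : w k₂ = v k₂
      · refine absurd ⟨k, hk, e, fun j hj hjk => ?_⟩ ht
        by_cases e3 : j = k₂
        · rw [e3, e2]
        · exact h w hw v hv j hj hjk e3
      · exact Or.inl ⟨e, e2⟩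
    · by_cases e2 : k = k₂
      · subst e2
        by_cases e3 : w k₁ = v k₁
        · refine absurd ⟨k, hk, e, fun j hj hjk => ?_⟩ ht
          by_cases e4 : j = k₁
          · rw [e4, e3]
          · exact h w hw v hv j hj e4 hjk
        · exact Or.inr ⟨e, e3⟩
      · have := h w hw v hv k hk e1 e2
        rw [this] at e
        exact absurd e (ne_cp _)
  have h1 := key a ha b hb hab
  have h2 := key a ha c hc hac
  have h3 := key b hb c hc hbc
  grind

/-- Three positions do not suffice to cover a box with words all of which deviate from it at one
common position. -/
theorem not_covers_of_three {K : Finset ι} {A : Finset (ι → S)} {w : ι → S} (hA : IsCode K A)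
    (hm : Meets K A w) (hc : Covers K A w) {i k₁ k₂ : ι} (hi : i ∈ K) (hne : ∀ a ∈ A, a i ≠ w i)
    (hoff : ∀ a ∈ A, ∀ k ∈ K, k ≠ i → k ≠ k₁ → k ≠ k₂ → a k = w k) : False := by
  have used : ∀ a ∈ A, ∀ k ∈ K, a k ≠ cp (w k) := fun a ha k hk e =>
    hm a ha ⟨k, hk, by rw [e, cp_cp]⟩
  have htr : ∀ a ∈ A, TrEq (K.erase i) (sl A i (a i)) (sl A i (cp (a i))) w := fun a ha =>
    hc.trEq hA hi (hne a ha) (used a ha i hi)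
  have le2 : ∀ z, (sl A i z).card ≤ 2 := fun z =>
    card_le_two_of_agr (hA.sl i z) k₁ k₂ fun a ha b hb k hk h1 h2 => by
      rw [Finset.mem_erase] at hk
      rw [mem_sl] at ha hb
      rw [hoff a ha.1 k hk.2 hk.1 h1 h2, hoff b hb.1 k hk.2 hk.1 h1 h2]
  have two : ∀ a ∈ A, (sl A i (a i)).card = 2 ∧ (sl A i (cp (a i))).card = 2 := by
    intro a ha
    have h1 := (htr a ha).card (hA.sl i _) (hA.sl i _) (hm.sl i _) (hm.sl i _)
      (hA.noC_sl hi _) ⟨a, by simp [ha]⟩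
    have := le2 (a i)
    have := le2 (cp (a i))
    omega
  obtain ⟨v, hv⟩ := hc.nonempty
  obtain ⟨t1, t2⟩ := two v hv
  by_cases hone : ∀ b ∈ A, b i = v i ∨ b i = cp (v i)
  · have cov : Covers (K.erase i) (sl A i (v i)) w := by
      intro x hx
      obtain ⟨ω, hω, hω'⟩ := exists_sel_two (a := w i) (b := v i) (used v hv i hi)
      obtain ⟨b, hb, hxb⟩ := hc (Function.update x i ω) ((inn_update hi).2 ⟨hω, hx⟩)
      rw [inn_update hi] at hxb
      refine ⟨b, mem_sl.2 ⟨hb, ?_⟩, hxb.2⟩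
      rcases hone b hb with e | e
      · exact e
      · rw [e, Sel.val_cp] at hxb
        exact absurd hω' hxb.1
    rcases cov.card_eq_one_or (hA.sl i _) (hm.sl i _) with ⟨a, h, -⟩ | ⟨-, h⟩
    · rw [h] at t1
      simp at t1
    · omega
  · push Not at hone
    obtain ⟨t, ht, n1, n2⟩ := hone
    obtain ⟨a, a', b, b', κ₁, κ₂, ea, eb, hL⟩ := (htr v hv).exists_lForm (hA.sl i _)
      (hA.sl i _) (hm.sl i _) (hm.sl i _) (hA.noC_sl hi _) t1 t2
    have ma : a ∈ A ∧ a i = v i := mem_sl.1 (ea ▸ by simp)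
    have ma' : a' ∈ A ∧ a' i = v i := mem_sl.1 (ea ▸ by simp)
    have mb : b ∈ A ∧ b i = cp (v i) := mem_sl.1 (eb ▸ by simp)
    have k1 := Finset.mem_erase.1 hL.mem₁
    have k2 := Finset.mem_erase.1 hL.mem₂
    have q1 : κ₁ = k₁ ∨ κ₁ = k₂ := by
      by_contra hcon
      push Not at hcon
      exact hL.a₁ (hoff a ma.1 κ₁ k1.2 k1.1 hcon.1 hcon.2)
    have q2 : κ₂ = k₁ ∨ κ₂ = k₂ := by
      by_contra hcon
      push Not at hcon
      exact hL.b₂ (hoff b mb.1 κ₂ k2.2 k2.1 hcon.1 hcon.2)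
    have hne12 := hL.ne
    have offK : ∀ c ∈ A, ∀ k ∈ K, k ≠ i → k ≠ κ₁ → k ≠ κ₂ → c k = w k := fun c hc k hk h h1 h2 =>
      hoff c hc k hk h (by grind) (by grind)
    have corner : ∀ c ∈ A, c i = t i → c κ₁ = cp (a κ₁) ∧ c κ₂ = cp (b κ₂) := by
      intro c hc hct
      have dic : ∀ d ∈ A, d i = v i → c κ₁ = cp (d κ₁) ∨ c κ₂ = cp (d κ₂) := by
        intro d hd hdv
        obtain ⟨⟨k, hk, e⟩, -⟩ := hA d hd c hc (by rintro rfl; exact n1 (hct.symm.trans hdv))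
        by_cases e0 : k = i
        · subst e0
          exact absurd (by rw [← hct, e, hdv]) n2
        · by_cases e1 : k = κ₁
          · exact Or.inl (e1 ▸ e)
          · by_cases e2 : k = κ₂
            · exact Or.inr (e2 ▸ e)
            · rw [offK c hc k hk e0 e1 e2, offK d hd k hk e0 e1 e2] at e
              exact absurd e (ne_cp _)
      have d1 := dic a ma.1 ma.2
      have d2 := dic a' ma'.1 ma'.2
      rw [hL.a₂] at d1
      have d1' := d1.resolve_right (used c hc κ₂ k2.2)
      rw [hL.a'₁, hL.a'₂, cp_cp, d1'] at d2
      exact ⟨d1', d2.resolve_left (cp_ne _)⟩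
    obtain ⟨c, hc', hct⟩ := Finset.exists_mem_ne (s := sl A i (t i)) (by
      rw [(two t ht).1]; norm_num) t
    have mc := mem_sl.1 hc'
    obtain ⟨⟨k, hk, e⟩, -⟩ := hA c mc.1 t ht hct
    have g1 := corner c mc.1 mc.2
    have g2 := corner t ht rfl
    by_cases e0 : k = i
    · subst e0
      rw [mc.2] at e
      exact ne_cp _ e
    · by_cases e1 : k = κ₁
      · rw [e1, g1.1, g2.1] at e
        exact ne_cp _ e
      · by_cases e2 : k = κ₂
        · rw [e2, g1.2, g2.2] at e
          exact ne_cp _ e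
        · rw [offK c mc.1 k hk e0 e1 e2, offK t ht k hk e0 e1 e2] at e
          exact ne_cp _ e

end Pinwheel

section Volume

variable {S : Type} [Cpl S] {ι : Type} [DecidableEq ι]

instance [Finite S] : Finite (Sel S) :=
  Finite.of_injective (fun ω : Sel S => ω.val) (fun a b h => by cases a; cases b; cases h; rfl)

noncomputable instance [Finite S] : Fintype (Sel S) := Fintype.ofFinite _

theorem Sel.tog_tog (ω : Sel S) (t : S) : (ω.tog t).tog t = ω := by
  have : ∀ s, ((ω.tog t).tog t).val s = ω.val s := fun s => by
    simp only [Sel.tog]; split_ifs <;> simp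
  cases ω with | mk v h => ?_
  simp only [Sel.tog, Sel.mk.injEq] at this ⊢
  funext s
  simpa using this s

/-- Toggling pairs the selections with `t` and those without `t`. -/
theorem card_sel_and [Finite S] (P : Sel S → Prop) (t : S) (hP : ∀ ω, P (ω.tog t) ↔ P ω) :
    2 * (Finset.univ.filter (fun ω : Sel S => P ω ∧ ω.val t)).card =
      (Finset.univ.filter (fun ω : Sel S => P ω)).card := by
  have h1 : (Finset.univ.filter (fun ω : Sel S => P ω ∧ ω.val t)).card =
      (Finset.univ.filter (fun ω : Sel S => P ω ∧ ¬ ω.val t)).card := by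
    refine Finset.card_bij' (fun ω _ => ω.tog t) (fun ω _ => ω.tog t) ?_ ?_ ?_ ?_
    · intro ω hω
      simp only [Finset.mem_filter, Finset.mem_univ, true_and] at hω ⊢
      exact ⟨(hP ω).2 hω.1, by rw [Sel.tog_self]; exact fun h => h hω.2⟩
    · intro ω hω
      simp only [Finset.mem_filter, Finset.mem_univ, true_and] at hω ⊢
      exact ⟨(hP ω).2 hω.1, by rw [Sel.tog_self]; exact hω.2⟩
    · intro ω _; exact ω.tog_tog t
    · intro ω _; exact ω.tog_tog t
  have h2 := Finset.card_filter_add_card_filter_not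
    (s := Finset.univ.filter (fun ω : Sel S => P ω)) (fun ω => ω.val t)
  rw [Finset.filter_filter, Finset.filter_filter] at h2
  omega

/-- Half of the number of selections. -/
noncomputable def halfSel (S : Type) [Cpl S] [Finite S] : ℕ := Fintype.card (Sel S) / 2

theorem card_sel_val [Finite S] (t : S) :
    (Finset.univ.filter (fun ω : Sel S => ω.val t)).card = halfSel S := by
  have := card_sel_and (fun _ : Sel S => True) t (fun _ => Iff.rfl)
  simp only [true_and, Finset.filter_true, Finset.card_univ] at this
  unfold halfSel
  omega

theorem card_sel_val_two [Finite S] {s t : S} (h : s ≠ t) (h' : s ≠ cp t) :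
    2 * (Finset.univ.filter (fun ω : Sel S => ω.val s ∧ ω.val t)).card = halfSel S := by
  rw [← card_sel_val s]
  exact card_sel_and (fun ω : Sel S => ω.val s) t (fun ω => ω.tog_of_ne h h')

theorem halfSel_pos [Finite S] (s : S) : 0 < halfSel S := by
  rw [← card_sel_val s, Finset.card_pos]
  obtain ⟨ω, hω⟩ := exists_sel_two (a := s) (b := s) (ne_cp s)
  exact ⟨ω, by simpa using hω.1⟩

/-- The number of points in a product of sets of selections. -/
theorem card_points [Finite S] [Fintype ι] (K : Finset ι) {j : ι} (hj : j ∈ K)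
    (v : ι → S) (Q : Sel S → Prop) :
    (Finset.univ.filter (fun x : ι → Sel S => Inn K x v ∧ Q (x j))).card =
      (Finset.univ.filter (fun ω : Sel S => ω.val (v j) ∧ Q ω)).card *
        ∏ k ∈ Finset.univ.erase j, if k ∈ K then halfSel S else Fintype.card (Sel S) := by
  have h1 : Finset.univ.filter (fun x : ι → Sel S => Inn K x v ∧ Q (x j)) =
      Fintype.piFinset (fun k => Finset.univ.filter
        (fun ω : Sel S => (k ∈ K → ω.val (v k)) ∧ (k = j → Q ω))) := by
    ext x
    simp only [Finset.mem_filter, Finset.mem_univ, true_and, Fintype.mem_piFinset]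
    constructor
    · rintro ⟨h1, h2⟩ k
      exact ⟨h1 k, by rintro rfl; exact h2⟩
    · intro h
      exact ⟨fun k hk => (h k).1 hk, (h j).2 rfl⟩
  rw [h1, Fintype.card_piFinset, ← Finset.mul_prod_erase _ _ (Finset.mem_univ j)]
  congr 1
  · simp [hj]
  · refine Finset.prod_congr rfl fun k hk => ?_
    have hkj : k ≠ j := Finset.ne_of_mem_erase hk
    by_cases hkK : k ∈ K
    · simp [hkK, hkj, card_sel_val]
    · simp [hkK, hkj]

theorem card_cov [Finite S] [Fintype ι] {K : Finset ι} {V : Finset (ι → S)} (hV : IsCode K V)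
    {j : ι} (hj : j ∈ K) (Q : Sel S → Prop) :
    (Finset.univ.filter (fun x : ι → Sel S => Cov K V x ∧ Q (x j))).card =
      (∑ v ∈ V, (Finset.univ.filter (fun ω : Sel S => ω.val (v j) ∧ Q ω)).card) *
        ∏ k ∈ Finset.univ.erase j, if k ∈ K then halfSel S else Fintype.card (Sel S) := by
  rw [Finset.sum_mul, ← Finset.sum_congr rfl (fun v _ => card_points K hj v Q),
    ← Finset.card_biUnion]
  · congr 1
    ext x
    simp only [Finset.mem_filter, Finset.mem_univ, true_and, Finset.mem_biUnion, Cov]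
    grind
  · intro v hv w hw hvw
    rw [Function.onFun, Finset.disjoint_left]
    intro x hx hy
    simp only [Finset.mem_filter, Finset.mem_univ, true_and] at hx hy
    exact hvw (hV.eq_of_inn hv hw hx.1 hy.1)

/-- Two disjoint codes covering the same points. -/
structure EqPair (K : Finset ι) (V W : Finset (ι → S)) : Prop where
  left : IsCode K V
  right : IsCode K W
  noC : NoC K V W
  cov : ∀ x, Cov K V x ↔ Cov K W x

theorem EqPair.symm {K : Finset ι} {V W : Finset (ι → S)} (h : EqPair K V W) : EqPair K W V :=
  ⟨h.right, h.left, h.noC.symm, fun x => (h.cov x).symm⟩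

theorem EqPair.card_eq [Finite S] [Fintype ι] {K : Finset ι} {V W : Finset (ι → S)}
    (h : EqPair K V W) {j : ι} (hj : j ∈ K) : V.card = W.card := by
  have h1 := card_cov h.left hj (fun _ => True)
  have h2 := card_cov h.right hj (fun _ => True)
  simp only [h.cov, and_true, card_sel_val, Finset.sum_const, smul_eq_mul, mul_assoc] at h1 h2
  rw [h1] at h2
  rcases V.eq_empty_or_nonempty with rfl | ⟨v, hv⟩
  · rcases W.eq_empty_or_nonempty with rfl | ⟨w, hw⟩
    · rfl
    · obtain ⟨x, hx⟩ := exists_inn K w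
      obtain ⟨v, hv, _⟩ := (h.cov x).2 ⟨w, hw, hx⟩
      simp at hv
  refine Nat.eq_of_mul_eq_mul_right (Nat.mul_pos (halfSel_pos (v j)) (Finset.prod_pos ?_)) h2
  intro k _
  split_ifs
  · exact halfSel_pos (v j)
  · exact Fintype.card_pos

theorem two_mul_sum_card [Finite S] (V : Finset (ι → S)) (j : ι) (l : S) :
    2 * ∑ v ∈ V, (Finset.univ.filter (fun ω : Sel S => ω.val (v j) ∧ ω.val l)).card +
        (sl V j (cp l)).card * halfSel S =
      (V.card + (sl V j l).card) * halfSel S := by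
  have h1 : ∀ v ∈ V, 2 * (Finset.univ.filter (fun ω : Sel S => ω.val (v j) ∧ ω.val l)).card +
      (if v j = cp l then halfSel S else 0) = halfSel S + (if v j = l then halfSel S else 0) := by
    intro v _
    by_cases e : v j = l
    · have : l ≠ cp l := ne_cp l
      simp only [e, and_self, card_sel_val, if_neg this, if_true]
      omega
    · by_cases e' : v j = cp l
      · have : cp l ≠ l := cp_ne l
        have h0 : Finset.univ.filter (fun ω : Sel S => ω.val (cp l) ∧ ω.val l) = ∅ := by
          ext ω; simp [Sel.val_cp]
        simp [e', h0]
      · have := card_sel_val_two e e'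
        simp only [if_neg e, if_neg e']
        omega
  have h2 := Finset.sum_congr rfl h1
  rw [Finset.sum_add_distrib, Finset.sum_add_distrib, ← Finset.mul_sum, ← Finset.sum_filter,
    ← Finset.sum_filter] at h2
  simp only [Finset.sum_const, smul_eq_mul] at h2
  rw [add_mul]
  exact h2

theorem EqPair.card_sl [Finite S] [Fintype ι] {K : Finset ι} {V W : Finset (ι → S)}
    (h : EqPair K V W) {j : ι} (hj : j ∈ K) (l : S) :
    (Keller.sl V j l).card + (Keller.sl W j (cp l)).card =
      (Keller.sl V j (cp l)).card + (Keller.sl W j l).card := by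
  have h0 := h.card_eq hj
  have h1 := card_cov h.left hj (fun ω => ω.val l)
  have h2 := card_cov h.right hj (fun ω => ω.val l)
  simp only [h.cov] at h1
  rw [h1] at h2
  have h3 := Nat.eq_of_mul_eq_mul_right (Finset.prod_pos ?_) h2
  · have h4 := two_mul_sum_card V j l
    have h5 := two_mul_sum_card W j l
    rw [h3] at h4
    have h6 : ((Keller.sl V j l).card + (Keller.sl W j (cp l)).card) * halfSel S =
        ((Keller.sl V j (cp l)).card + (Keller.sl W j l).card) * halfSel S := by
      rw [h0] at h4
      simp only [add_mul] at h4 h5 ⊢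
      omega
    exact Nat.eq_of_mul_eq_mul_right (halfSel_pos l) h6
  · intro k _
    split_ifs
    · exact halfSel_pos l
    · exact Fintype.card_pos

end Volume

section Pairs

variable {S : Type} [Cpl S] {ι : Type} [DecidableEq ι]

/-- The words of the code whose boxes meet the box of `y`. -/
noncomputable def mt (K : Finset ι) (A : Finset (ι → S)) (y : ι → S) : Finset (ι → S) :=
  A.filter (fun a => ¬ Dic K a y)

theorem mem_mt {K : Finset ι} {A : Finset (ι → S)} {y a : ι → S} :
    a ∈ mt K A y ↔ a ∈ A ∧ ¬ Dic K a y := by simp [mt]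

theorem mt_subset (K : Finset ι) (A : Finset (ι → S)) (y : ι → S) : mt K A y ⊆ A :=
  Finset.filter_subset _ _

theorem meets_mt (K : Finset ι) (A : Finset (ι → S)) (y : ι → S) : Meets K (mt K A y) y :=
  fun _ ha => (mem_mt.1 ha).2

theorem cov_mt {K : Finset ι} {A : Finset (ι → S)} {y : ι → S} {x : ι → Sel S} (hx : Inn K x y) :
    Cov K (mt K A y) x ↔ Cov K A x :=
  ⟨fun ⟨a, ha, h⟩ => ⟨a, mt_subset _ _ _ ha, h⟩,
    fun ⟨a, ha, h⟩ => ⟨a, mem_mt.2 ⟨ha, not_dic_of_inn h hx⟩, h⟩⟩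

theorem Covers.mt {K : Finset ι} {A : Finset (ι → S)} {w : ι → S} (h : Covers K A w) :
    Covers K (mt K A w) w := fun x hx => (cov_mt hx).2 (h x hx)

theorem TrEq.mt {K : Finset ι} {A B : Finset (ι → S)} {y : ι → S} (h : TrEq K A B y) :
    TrEq K (mt K A y) (mt K B y) y := fun x hx => by rw [cov_mt hx, cov_mt hx]; exact h x hx

theorem NoC.mono {K : Finset ι} {A B A' B' : Finset (ι → S)} (h : NoC K A B) (hA : A' ⊆ A)
    (hB : B' ⊆ B) : NoC K A' B' := fun a ha b hb => h a (hA ha) b (hB hb)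

theorem Covers.five_le {K : Finset ι} {A : Finset (ι → S)} {w : ι → S} (hA : IsCode K A)
    (hc : Covers K A w) (hno : ∀ a ∈ A, ¬ Agr K a w) : 5 ≤ (Keller.mt K A w).card :=
  (five_le_of_covers (hA.mono (mt_subset _ _ _)) (meets_mt _ _ _) hc.mt
    (fun a ha => hno a (mt_subset _ _ _ ha))).1

theorem Covers.five_le' {K : Finset ι} {A : Finset (ι → S)} {w : ι → S} (hA : IsCode K A)
    (hc : Covers K A w) (hno : ∀ a ∈ A, ¬ Agr K a w) : 5 ≤ A.card :=
  (hc.five_le hA hno).trans (Finset.card_le_card (mt_subset _ _ _))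

theorem card_mt_le (K : Finset ι) (A : Finset (ι → S)) (y : ι → S) : (mt K A y).card ≤ A.card :=
  Finset.card_le_card (mt_subset _ _ _)

theorem TrEq.card_mt {K : Finset ι} {A B : Finset (ι → S)} {y : ι → S} (h : TrEq K A B y)
    (hA : IsCode K A) (hB : IsCode K B) (hno : NoC K A B) {x : ι → Sel S} (hx : Inn K x y)
    (hAx : Cov K A x) :
    (2 ≤ (Keller.mt K A y).card ∧ 2 ≤ (Keller.mt K B y).card) ∨
    ((Keller.mt K A y).card = 1 ∧ 5 ≤ (Keller.mt K B y).card) ∨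
    (5 ≤ (Keller.mt K A y).card ∧ (Keller.mt K B y).card = 1) := by
  refine h.mt.card (hA.mono (mt_subset _ _ _)) (hB.mono (mt_subset _ _ _)) (meets_mt _ _ _)
    (meets_mt _ _ _) (hno.mono (mt_subset _ _ _) (mt_subset _ _ _)) ?_
  obtain ⟨a, ha, _⟩ := (cov_mt hx).2 hAx
  exact ⟨a, ha⟩

theorem prop_class {a b c e : Prop} (h1 : a ∧ e ↔ b ∧ c) (h2 : a ∨ e ↔ b ∨ c) :
    (c ∧ ¬ a ∧ e ∧ ¬ b) ∨ ((c → a) ∧ (e → b)) := by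
  by_cases a <;> by_cases b <;> by_cases c <;> by_cases e <;> simp_all

variable {K : Finset ι} {V W : Finset (ι → S)} {j : ι}

theorem EqPair.square (h : EqPair K V W) (hj : j ∈ K) (z : S) (x : ι → Sel S) :
    ((Cov (K.erase j) (sl V j z) x ∧ Cov (K.erase j) (sl W j (cp z)) x) ↔
      (Cov (K.erase j) (sl V j (cp z)) x ∧ Cov (K.erase j) (sl W j z) x)) ∧
    ((Cov (K.erase j) (sl V j z) x ∨ Cov (K.erase j) (sl W j (cp z)) x) ↔
      (Cov (K.erase j) (sl V j (cp z)) x ∨ Cov (K.erase j) (sl W j z) x)) :=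
  Keller.square h.left h.right hj z x (fun _ => True) ⟨Classical.arbitrary _, trivial⟩
    (fun _ _ => trivial) (fun ω _ => h.cov _)

theorem EqPair.noC_sl (h : EqPair K V W) (hj : j ∈ K) (z : S) :
    NoC (K.erase j) (sl V j z) (sl W j z) := by
  intro a ha b hb e
  rw [mem_sl] at ha hb
  refine h.noC a ha.1 b hb.1 fun k hk => ?_
  by_cases hkj : k = j
  · rw [hkj, ha.2, hb.2]
  · exact e k (Finset.mem_erase.2 ⟨hkj, hk⟩)

theorem EqPair.trEq (h : EqPair K V W) (hj : j ∈ K) {z : S} {y : ι → S} (hy : y ∈ W)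
    (hz : y j ≠ z) (hz' : y j ≠ cp z) :
    TrEq (K.erase j) (sl V j z) (sl V j (cp z)) y := by
  intro x hx
  have hyc : Cov (K.erase j) (sl W j (y j)) x := ⟨y, mem_sl.2 ⟨hy, rfl⟩, hx⟩
  have h1 : ¬ Cov (K.erase j) (sl W j z) x := fun h1 =>
    hz (h.right.cov_sl_unique hj hz' hyc h1)
  have h2 : ¬ Cov (K.erase j) (sl W j (cp z)) x := fun h1 =>
    hz' (h.right.cov_sl_unique hj (by simpa using hz) hyc h1)
  have := (h.square hj z x).2
  tauto

/-- A point covered by one slice of `V` but not by that slice of `W` lies in a word of `W` with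
another letter. -/
theorem EqPair.exists_other (h : EqPair K V W) (hj : j ∈ K) {z : S} {x : ι → Sel S}
    (hA : Cov (K.erase j) (sl V j z) x) (hC : ¬ Cov (K.erase j) (sl W j z) x) :
    ∃ y ∈ W, y j ≠ z ∧ y j ≠ cp z ∧ Inn (K.erase j) x y := by
  obtain ⟨ω, hω, _⟩ := exists_sel_two (a := z) (b := z) (ne_cp z)
  have h1 : Cov K V (Function.update x j ω) := (cov_update hj).2 ⟨z, hω, hA⟩
  obtain ⟨s, hs, y, hy, hyx⟩ := (cov_update hj).1 ((h.cov _).1 h1)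
  rw [mem_sl] at hy
  refine ⟨y, hy.1, ?_, ?_, hyx⟩
  · rw [hy.2]
    rintro rfl
    exact hC ⟨y, mem_sl.2 hy, hyx⟩
  · rw [hy.2]
    rintro rfl
    exact (ω.val_cp z).1 hs hω

theorem EqPair.of_slices (h : EqPair K V W) (hj : j ∈ K) {z : S}
    (he : ∀ x, Cov (K.erase j) (sl V j z) x ↔ Cov (K.erase j) (sl W j z) x) :
    EqPair (K.erase j) (sl V j z) (sl W j z) :=
  ⟨h.left.sl j z, h.right.sl j z, h.noC_sl hj z, he⟩

theorem EqPair.of_slices' (h : EqPair K V W) (hj : j ∈ K) {z : S}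
    (he : ∀ x, Cov (K.erase j) (sl V j z) x ↔ Cov (K.erase j) (sl V j (cp z)) x) :
    EqPair (K.erase j) (sl V j z) (sl V j (cp z)) :=
  ⟨h.left.sl j z, h.left.sl j (cp z), h.left.noC_sl hj z, he⟩

theorem EqPair.nonempty (h : EqPair K V W) (hV : V.Nonempty) : W.Nonempty := by
  obtain ⟨v, hv⟩ := hV
  obtain ⟨x, hx⟩ := exists_inn K v
  obtain ⟨w, hw, _⟩ := (h.cov x).1 ⟨v, hv, hx⟩
  exact ⟨w, hw⟩

theorem EqPair.covers (h : EqPair K V W) {v : ι → S} (hv : v ∈ V) : Covers K W v :=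
  fun x hx => (h.cov x).1 ⟨v, hv, hx⟩

theorem Cov.nonempty {A : Finset (ι → S)} {x : ι → Sel S} (h : Cov K A x) : A.Nonempty :=
  h.imp fun _ h => h.1

theorem covers_of_sub {A B : Finset (ι → S)} (h : ∀ x, Cov K A x → Cov K B x) {a : ι → S}
    (ha : a ∈ A) : Covers K B a := fun x hx => h x ⟨a, ha, hx⟩

variable [Finite S] [Fintype ι]

/-- The class of `z` has at least four words, if that holds for pairs in lower dimension. -/
theorem EqPair.four_le_aux (h : EqPair K V W) (hj : j ∈ K) (z : S)
    (ih : ∀ A B : Finset (ι → S), EqPair (K.erase j) A B → A.Nonempty → 8 ≤ A.card)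
    {x : ι → Sel S} (hA : Cov (K.erase j) (sl V j z) x) (hC : ¬ Cov (K.erase j) (sl W j z) x) :
    4 ≤ (sl V j z).card + (sl W j (cp z)).card := by
  have hs := h.card_sl hj z
  obtain ⟨y, hy, hyz, hyz', hyx⟩ := h.exists_other hj hA hC
  have h1 := (h.trEq hj hy hyz hyz').card_mt (h.left.sl j z) (h.left.sl j (cp z))
    (h.left.noC_sl hj z) hyx hA
  have m1 := card_mt_le (K.erase j) (sl V j z) y
  have m2 := card_mt_le (K.erase j) (sl V j (cp z)) y
  by_cases hD : ∃ x, Cov (K.erase j) (sl W j z) x ∧ ¬ Cov (K.erase j) (sl V j z) x ∧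
      Cov (K.erase j) (sl W j (cp z)) x ∧ ¬ Cov (K.erase j) (sl V j (cp z)) x
  · obtain ⟨x', hD1, hD2, hD3, -⟩ := hD
    obtain ⟨y', hy', hyz2, hyz2', hyx'⟩ := h.symm.exists_other hj hD1 hD2
    have h2 := (h.symm.trEq hj hy' hyz2 hyz2').card_mt (h.right.sl j z) (h.right.sl j (cp z))
      (h.right.noC_sl hj z) hyx' hD1
    have m3 := card_mt_le (K.erase j) (sl W j z) y'
    have m4 := card_mt_le (K.erase j) (sl W j (cp z)) y'
    omega
  · have hCE := fun x => (prop_class (h.square hj z x).1 (h.square hj z x).2).resolve_left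
      (fun h => hD ⟨x, h⟩)
    by_cases hW : (sl W j z).Nonempty
    · obtain ⟨c, hc⟩ := hW
      have := (covers_of_sub (B := sl V j z) (fun x => (hCE x).1) hc).five_le'
        (h.left.sl j z) (fun a ha => h.noC_sl hj z a ha c hc)
      omega
    by_cases hW' : (sl W j (cp z)).Nonempty
    · obtain ⟨c, hc⟩ := hW'
      have := (covers_of_sub (B := sl V j (cp z)) (fun x => (hCE x).2) hc).five_le'
        (h.left.sl j (cp z)) (fun a ha => h.noC_sl hj (cp z) a ha c hc)
      omega
    · have h3 : EqPair (K.erase j) (sl V j z) (sl V j (cp z)) := by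
        refine h.of_slices' hj fun x => ?_
        have h4 : ¬ Cov (K.erase j) (sl W j z) x := fun h => hW h.nonempty
        have h5 : ¬ Cov (K.erase j) (sl W j (cp z)) x := fun h => hW' h.nonempty
        have := (h.square hj z x).2
        tauto
      have := ih _ _ h3 hA.nonempty
      omega

theorem EqPair.eight_le (h : EqPair K V W) (hV : V.Nonempty) : 8 ≤ V.card := by
  induction hn : K.card generalizing K V W with
  | zero =>
    rw [Finset.card_eq_zero] at hn
    subst hn
    obtain ⟨w, hw⟩ := h.nonempty hV
    obtain ⟨v, hv⟩ := hV
    exact absurd (fun k hk => absurd hk (Finset.notMem_empty k)) (h.noC v hv w hw)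
  | succ n ih =>
    obtain ⟨v, hv⟩ := hV
    have h5 := (five_le_of_covers (h.right.mono (mt_subset K W v)) (meets_mt _ _ _)
      (h.covers hv).mt (fun a ha e => h.noC v hv a (mt_subset _ _ _ ha) e.symm)).2
    obtain ⟨j, hj⟩ := Finset.card_pos.1 (lt_of_lt_of_le (by norm_num) h5)
    rw [Finset.mem_filter] at hj
    obtain ⟨hj, w, hw, hwv⟩ := hj
    rw [mem_mt] at hw
    have ih' : ∀ A B : Finset (ι → S), EqPair (K.erase j) A B → A.Nonempty → 8 ≤ A.card :=
      fun A B hAB hA => ih hAB hA (by rw [Finset.card_erase_of_mem hj, hn]; rfl)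
    have key : ∀ {V W : Finset (ι → S)}, EqPair K V W → ∀ v ∈ V,
        4 ≤ (sl V j (v j)).card + (sl W j (cp (v j))).card := by
      intro V W h v hv
      by_cases hc : ∃ x, Cov (K.erase j) (sl V j (v j)) x ∧ ¬ Cov (K.erase j) (sl W j (v j)) x
      · obtain ⟨x, hx, hx'⟩ := hc
        exact h.four_le_aux hj _ ih' hx hx'
      by_cases hc2 : ∃ x, Cov (K.erase j) (sl W j (v j)) x ∧ ¬ Cov (K.erase j) (sl V j (v j)) x
      · obtain ⟨x, hx, hx'⟩ := hc2
        have := h.symm.four_le_aux hj _ ih' hx hx'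
        have := h.card_sl hj (v j)
        omega
      · push Not at hc hc2
        have := ih' _ _ (h.of_slices hj fun x => ⟨hc x, hc2 x⟩) ⟨v, mem_sl.2 ⟨hv, rfl⟩⟩
        omega
    have k1 := key h v hv
    have k2 := key h.symm w hw.1
    have c1 := h.card_sl hj (v j)
    have c2 := h.card_sl hj (w j)
    have hne : w j ≠ cp (v j) := fun e => hw.2 (Dic.symm ⟨j, hj, e⟩)
    have f1 := card_sl_four V j hwv hne
    have f2 := card_sl_four W j hwv hne
    have := h.card_eq hj
    omega

end Pairs

section Slices

variable {S : Type} [Cpl S] {ι : Type} [DecidableEq ι]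

variable {K : Finset ι} {V W : Finset (ι → S)} {j : ι}

theorem dic_of_cov_disjoint {A B : Finset (ι → S)} (h : ∀ x, Cov K A x → ¬ Cov K B x)
    {a b : ι → S} (ha : a ∈ A) (hb : b ∈ B) : Dic K a b := by
  by_contra hd
  obtain ⟨x, h1, h2⟩ := exists_inn_two hd
  exact h x ⟨a, ha, h1⟩ ⟨b, hb, h2⟩

theorem Dic.letter_of_not_erase {v w : ι → S} {k : ι} (h : Dic K v w)
    (h' : ¬ Dic (K.erase k) v w) : w k = cp (v k) := by
  by_contra e
  exact h' (h.erase e)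

/-- At most six words of a code cannot cover exactly a partition containing a twin pair. -/
theorem not_tw_of_covers {A P : Finset (ι → S)} (hA : IsCode K A) (hA6 : A.card ≤ 6)
    (hP : ∀ v ∈ P, ∀ w ∈ P, v ≠ w → Dic K v w) (hno : NoC K A P) (hcard : P.card = A.card)
    (hcov : ∀ w ∈ P, Covers K A w) {b c : ι → S} (hb : b ∈ P) (hc : c ∈ P) : ¬ Tw K b c := by
  rintro ⟨k, hk, ek, hoff⟩
  have five : ∀ w ∈ P, 5 ≤ (mt K A w).card := fun w hw =>
    (hcov w hw).five_le hA (fun a ha => hno a ha w hw)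
  have letter : ∀ w ∈ P, (mt K A w).card ≤ 5 → ∀ k ∈ K, ∃ a ∈ mt K A w, a k = w k :=
    fun w hw h5 k hk => exists_letter_of_five (hA.mono (mt_subset _ _ _)) (meets_mt _ _ _)
      (hcov w hw).mt h5 hk
  have fb := five b hb
  have fc := five c hc
  have lb := card_mt_le K A b
  have lc := card_mt_le K A c
  have full : ∀ w, A.card ≤ (mt K A w).card → mt K A w = A := fun w hw =>
    Finset.eq_of_subset_of_card_le (mt_subset _ _ _) hw
  have nb : ∀ a ∈ mt K A b, a k ≠ c k := fun a ha e => (mem_mt.1 ha).2 ⟨k, hk, by rw [e, ek, cp_cp]⟩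
  have nc : ∀ a ∈ mt K A c, a k ≠ b k := fun a ha e => (mem_mt.1 ha).2 ⟨k, hk, by rw [e, ek]⟩
  by_cases hb5 : (mt K A b).card ≤ 5
  · obtain ⟨a, ha, eak⟩ := letter b hb hb5 k hk
    have hac : a ∉ mt K A c := fun h => nc a h eak
    have hlt : (mt K A c).card < A.card := Finset.card_lt_card
      ⟨mt_subset _ _ _, fun h => hac (h (mt_subset _ _ _ ha))⟩
    obtain ⟨a', ha', eak'⟩ := letter c hc (by omega) k hk
    have hab' : a' ∉ mt K A b := fun h => nb a' h eak'
    have eb : mt K A b = A.erase a' := by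
      refine Finset.eq_of_subset_of_card_le (fun x hx => Finset.mem_erase.2
        ⟨by rintro rfl; exact hab' hx, mt_subset _ _ _ hx⟩) ?_
      rw [Finset.card_erase_of_mem (mt_subset _ _ _ ha')]
      omega
    have ec : mt K A c = A.erase a := by
      refine Finset.eq_of_subset_of_card_le (fun x hx => Finset.mem_erase.2
        ⟨by rintro rfl; exact hac hx, mt_subset _ _ _ hx⟩) ?_
      rw [Finset.card_erase_of_mem (mt_subset _ _ _ ha)]
      omega
    have only : ∀ v ∈ A, v k = b k → v = a := by
      intro v hv e
      by_contra hva
      exact nc v (ec ▸ Finset.mem_erase.2 ⟨hva, hv⟩) e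
    have only' : ∀ v ∈ A, v k = c k → v = a' := by
      intro v hv e
      by_contra hva
      exact nb v (eb ▸ Finset.mem_erase.2 ⟨hva, hv⟩) e
    have hbc : ∀ x, Inn (K.erase k) x b → Inn (K.erase k) x c := by
      intro x hx k' hk'
      rw [hoff k' (Finset.mem_of_mem_erase hk') (Finset.ne_of_mem_erase hk')]
      exact hx k' hk'
    have aux : ∀ {b c a a' : ι → S}, c ∈ P → c k = cp (b k) → a ∈ A → a k = b k →
        (∀ v ∈ A, v k = c k → v = a') → ∀ x, Inn (K.erase k) x c →
        Inn (K.erase k) x a → Inn (K.erase k) x a' := by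
      intro b c a a' hc ek ha eak only' x hx hxa
      obtain ⟨ω, hω, _⟩ := exists_sel_two (a := c k) (b := c k) (ne_cp _)
      obtain ⟨s, hs, v, hv, hvx⟩ := (cov_update hk).1
        (hcov c hc (Function.update x k ω) ((inn_update hk).2 ⟨hω, hx⟩))
      rw [mem_sl] at hv
      by_cases hsc : s = c k
      · rw [← only' v hv.1 (hv.2.trans hsc)]
        exact hvx
      · have h1 : a k = s := hA.cov_sl_unique hk (s := a k) (t := s) (by grind)
          ⟨a, mem_sl.2 ⟨ha, rfl⟩, hxa⟩ ⟨v, mem_sl.2 hv, hvx⟩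
        rw [← h1, eak] at hs
        rw [ek] at hω
        exact absurd hs ((ω.val_cp _).1 hω)
    have hagr : Agr (K.erase k) a a' := by
      refine agr_of_trace (y := b) (fun h => (mem_mt.1 ha).2 h.of_erase)
        (fun h => ?_) fun x hx => ⟨fun h => ?_, fun h => ?_⟩
      · obtain ⟨k', hk', e⟩ := h
        refine (mem_mt.1 ha').2 ⟨k', Finset.mem_of_mem_erase hk', ?_⟩
        rw [hoff k' (Finset.mem_of_mem_erase hk') (Finset.ne_of_mem_erase hk'), e]
      · exact aux hc ek (mt_subset _ _ _ ha) eak only' x (hbc x hx) h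
      · exact aux hb (by rw [ek, cp_cp]) (mt_subset _ _ _ ha') eak' only x hx h
    exact not_agr_of_code hA (mt_subset _ _ _ ha) (mt_subset _ _ _ ha') hk
      (by rw [eak, eak', ek]) hagr
  · have eb : mt K A b = A := full b (by omega)
    by_cases hc5 : (mt K A c).card ≤ 5
    · obtain ⟨a, ha, e⟩ := letter c hc hc5 k hk
      exact nb a (by rw [eb]; exact mt_subset _ _ _ ha) e
    have ec : mt K A c = A := full c (by omega)
    have hmb : Meets K A b := eb ▸ meets_mt K A b
    obtain ⟨h6, h7⟩ := six_le_of_covers hA hmb (hcov b hb) hk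
      (fun a ha => nc a (ec.symm ▸ ha))
    obtain ⟨a, ha, hag, -, -, -⟩ := h7 (by omega)
    have hbc : b ≠ c := by rintro rfl; exact ne_cp _ ek
    obtain ⟨w, hw, hwb⟩ : ∃ w ∈ P, w ∉ ({b, c} : Finset (ι → S)) := by
      by_contra hcon
      push Not at hcon
      have := Finset.card_le_card (show P ⊆ {b, c} from hcon)
      rw [Finset.card_pair hbc] at this
      omega
    simp only [Finset.mem_insert, Finset.mem_singleton, not_or] at hwb
    have hd : Dic (K.erase k) b w := by
      by_contra hd
      have e1 := (hP b hb w hw (Ne.symm hwb.1)).letter_of_not_erase hd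
      have hd' : ¬ Dic (K.erase k) c w := by
        rintro ⟨k', hk', e⟩
        refine hd ⟨k', hk', ?_⟩
        rw [e, hoff k' (Finset.mem_of_mem_erase hk') (Finset.ne_of_mem_erase hk')]
      have e2 := (hP c hc w hw (Ne.symm hwb.2)).letter_of_not_erase hd'
      rw [ek, cp_cp] at e2
      exact ne_cp _ (e2.symm.trans e1)
    obtain ⟨k', hk', e⟩ := hd
    have haw : a ∉ mt K A w := fun h => (mem_mt.1 h).2
      ⟨k', Finset.mem_of_mem_erase hk', by rw [e, hag k' hk']⟩
    have hlt : (mt K A w).card < A.card := Finset.card_lt_card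
      ⟨mt_subset _ _ _, fun h => haw (h ha)⟩
    obtain ⟨v, hv, ev⟩ := letter w hw (by omega) k' (Finset.mem_of_mem_erase hk')
    exact hmb v (mt_subset _ _ _ hv) ⟨k', Finset.mem_of_mem_erase hk', by rw [ev, e, cp_cp]⟩

end Slices

section Classes

variable {S : Type} [Cpl S] {ι : Type} [DecidableEq ι]

variable {K : Finset ι} {V W : Finset (ι → S)} {j : ι}

/-- The point is covered by both complementary slices of `V` and by none of those of `W`. -/
def DP (K : Finset ι) (V W : Finset (ι → S)) (j : ι) (z : S) (x : ι → Sel S) : Prop :=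
  Cov (K.erase j) (sl V j z) x ∧ Cov (K.erase j) (sl V j (cp z)) x ∧
    ¬ Cov (K.erase j) (sl W j z) x ∧ ¬ Cov (K.erase j) (sl W j (cp z)) x

theorem DP.cp {z : S} {x : ι → Sel S} (h : DP K V W j z x) : DP K V W j (cp z) x := by
  unfold DP at h ⊢
  rw [cp_cp]
  exact ⟨h.2.1, h.1, h.2.2.2, h.2.2.1⟩

theorem dp_cp {z : S} {x : ι → Sel S} : DP K V W j (cp z) x ↔ DP K V W j z x :=
  ⟨fun h => by simpa using h.cp, fun h => h.cp⟩

theorem prop_class' {a b c e : Prop} (h1 : a ∧ e ↔ b ∧ c) (h2 : a ∨ e ↔ b ∨ c) :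
    (a ∧ b ∧ ¬ c ∧ ¬ e) ∨ (c ∧ e ∧ ¬ a ∧ ¬ b) ∨ ((a ↔ c) ∧ (b ↔ e)) := by
  by_cases a <;> by_cases b <;> by_cases c <;> by_cases e <;> simp_all

theorem EqPair.cases (h : EqPair K V W) (hj : j ∈ K) (z : S) (x : ι → Sel S) :
    DP K V W j z x ∨ DP K W V j z x ∨
      ((Cov (K.erase j) (sl V j z) x ↔ Cov (K.erase j) (sl W j z) x) ∧
       (Cov (K.erase j) (sl V j (cp z)) x ↔ Cov (K.erase j) (sl W j (cp z)) x)) :=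
  prop_class' (h.square hj z x).1 (h.square hj z x).2

variable [Finite S] [Fintype ι]

theorem EqPair.exists_dp (h : EqPair K V W) (hj : j ∈ K) {z : S}
    (hp : (sl V j z).card + (sl W j (cp z)).card ≤ 7)
    (hne : 1 ≤ (sl V j z).card + (sl W j (cp z)).card) :
    (∃ x, DP K V W j z x) ∨ ∃ x, DP K W V j z x := by
  by_contra hcon
  push Not at hcon
  have hc := fun x => ((h.cases hj z x).resolve_left (hcon.1 x)).resolve_left (hcon.2 x)
  have h1 := h.of_slices hj fun x => (hc x).1
  have h2 := h.of_slices hj (z := cp z) fun x => (hc x).2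
  have hs := h.card_sl hj z
  rcases (sl V j z).eq_empty_or_nonempty with e | e
  · rcases (sl W j (cp z)).eq_empty_or_nonempty with e' | e'
    · simp [e, e'] at hne
    · have := h2.symm.eight_le e'
      omega
  · have := h1.eight_le e
    omega

/-- If `W` has no word of the class beyond the letter `z` and `D` is inhabited, the class of `z`
has more than six words. -/
theorem EqPair.not_union (h : EqPair K V W) (hj : j ∈ K) {z : S}
    (hp : (sl V j z).card + (sl W j (cp z)).card ≤ 6)
    (hD : ∃ x, DP K V W j z x) (hE : sl W j (cp z) = ∅) : False := by
  have hs := h.card_sl hj z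
  rw [hE, Finset.card_empty] at hs hp
  have hE' : ∀ x, ¬ Cov (K.erase j) (sl W j (cp z)) x := fun x hx => by
    obtain ⟨a, ha⟩ := hx.nonempty
    simp [hE] at ha
  have hdis : ∀ x, Cov (K.erase j) (sl V j (cp z)) x → ¬ Cov (K.erase j) (sl W j z) x :=
    fun x hb hc => hE' x ((h.square hj z x).1.2 ⟨hb, hc⟩).2
  have hun : ∀ x, Cov (K.erase j) (sl V j z) x ↔
      Cov (K.erase j) (sl V j (cp z)) x ∨ Cov (K.erase j) (sl W j z) x := fun x => by
    rw [← (h.square hj z x).2]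
    simp [hE' x]
  set A := sl V j z with hA
  set P := sl V j (cp z) ∪ sl W j z with hPdef
  have hcovP : ∀ x, Cov (K.erase j) A x ↔ Cov (K.erase j) P x := by
    intro x
    rw [hun, hPdef]
    simp only [Cov, Finset.mem_union]
    grind
  have hdisj : Disjoint (sl V j (cp z)) (sl W j z) := by
    rw [Finset.disjoint_left]
    intro v hv hv'
    rw [mem_sl] at hv hv'
    exact cp_ne z (hv.2.symm.trans hv'.2)
  have hcard : P.card = A.card := by
    rw [hPdef, Finset.card_union_of_disjoint hdisj]
    omega
  have hno : NoC (K.erase j) A P := by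
    intro a ha b hb
    rcases Finset.mem_union.1 hb with hb | hb
    · exact h.left.noC_sl hj z a ha b hb
    · exact h.noC_sl hj z a ha b hb
  have hPd : ∀ v ∈ P, ∀ w ∈ P, v ≠ w → Dic (K.erase j) v w := by
    intro v hv w hw hvw
    rcases Finset.mem_union.1 hv with hv | hv <;> rcases Finset.mem_union.1 hw with hw | hw
    · exact (h.left.sl j _ v hv w hw hvw).1
    · exact dic_of_cov_disjoint hdis hv hw
    · exact (dic_of_cov_disjoint hdis hw hv).symm
    · exact (h.right.sl j _ v hv w hw hvw).1
  have hAc : IsCode (K.erase j) A := h.left.sl j z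
  have hPc : IsCode (K.erase j) P := fun v hv w hw hvw => ⟨hPd v hv w hw hvw,
    not_tw_of_covers hAc (by omega) hPd hno hcard
      (fun u hu x hx => (hcovP x).2 ⟨u, hu, hx⟩) hv hw⟩
  obtain ⟨x, hx⟩ := hD
  have := (EqPair.mk hAc hPc hno hcovP).eight_le hx.1.nonempty
  omega

/-- A class with `D` inhabited and `D'` empty has sizes five and one. -/
theorem EqPair.rigid_sizes (h : EqPair K V W) (hj : j ∈ K) {z : S}
    (hp : (sl V j z).card + (sl W j (cp z)).card ≤ 6)
    (hD : ∃ x, DP K V W j z x) (hD' : ∀ x, ¬ DP K W V j z x) :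
    (sl V j z).card = 5 ∧ (sl V j (cp z)).card = 5 ∧ (sl W j z).card = 1 ∧
      (sl W j (cp z)).card = 1 := by
  have hs := h.card_sl hj z
  have hCA : ∀ x, Cov (K.erase j) (sl W j z) x → Cov (K.erase j) (sl V j z) x := by
    intro x hx
    rcases h.cases hj z x with h1 | h1 | h1
    · exact h1.1
    · exact absurd h1 (hD' x)
    · exact h1.1.2 hx
  have hEB : ∀ x, Cov (K.erase j) (sl W j (cp z)) x → Cov (K.erase j) (sl V j (cp z)) x := by
    intro x hx
    rcases h.cases hj z x with h1 | h1 | h1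
    · exact h1.2.1
    · exact absurd h1 (hD' x)
    · exact h1.2.2 hx
  rcases (sl W j (cp z)).eq_empty_or_nonempty with e | ⟨w, hw⟩
  · exact (h.not_union hj hp hD e).elim
  rcases (sl W j z).eq_empty_or_nonempty with e' | ⟨w', hw'⟩
  · refine (h.not_union hj (z := cp z) ?_ ?_ (by rwa [cp_cp])).elim
    · rw [cp_cp]; omega
    · obtain ⟨x, hx⟩ := hD
      exact ⟨x, hx.cp⟩
  · have h1 := (covers_of_sub hCA hw').five_le' (h.left.sl j z)
      (fun a ha => h.noC_sl hj z a ha w' hw')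
    have h2 := (covers_of_sub hEB hw).five_le' (h.left.sl j (cp z))
      (fun a ha => h.noC_sl hj (cp z) a ha w hw)
    have h3 := Finset.card_pos.2 ⟨w, hw⟩
    have h4 := Finset.card_pos.2 ⟨w', hw'⟩
    omega

/-- The letters of the pinwheel's centre at its three special positions. -/
theorem PForm.letter {A : Finset (ι → S)} {w y : ι → S} {κ₁ κ₂ κ₃ : ι} {z₁ z₂ z₃ : S}
    (h : PForm K A w κ₁ κ₂ κ₃ z₁ z₂ z₃) (hy : ∀ b ∈ A, ∀ k ∈ K, w k ≠ y k → b k = w k) :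
    y κ₁ = w κ₁ ∧ y κ₂ = w κ₂ ∧ y κ₃ = w κ₃ := by
  obtain ⟨b, hb, b1, b2, b3⟩ := h.word₂
  have n1 := h.z_1
  have n2 := h.z_2
  have n3 := h.z_3
  refine ⟨?_, ?_, ?_⟩
  · by_contra e
    exact n1 (b1.symm.trans (hy b hb _ h.mem₁ (Ne.symm e)))
  · by_contra e
    exact n2 (b2.symm.trans (hy b hb _ h.mem₂ (Ne.symm e)))
  · by_contra e
    exact n3 (b3.symm.trans (hy b hb _ h.mem₃ (Ne.symm e)))

/-- The words of `W` in other classes through a point of `D`, when one slice is a single word. -/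
theorem EqPair.single_slice (h : EqPair K V W) (hj : j ∈ K) {z : S} {a : ι → S}
    (hA : sl V j z = {a}) {x : ι → Sel S} {y : ι → S} (hy : y ∈ W)
    (hyz : y j ≠ z) (hyz' : y j ≠ cp z) (hax : Inn (K.erase j) x a) (hx : Inn (K.erase j) x y) :
    (∀ b ∈ mt (K.erase j) (sl V j (cp z)) y, ∀ k ∈ K.erase j, a k ≠ y k → b k = a k) ∧
    Meets (K.erase j) (mt (K.erase j) (sl V j (cp z)) y) a ∧
    Covers (K.erase j) (mt (K.erase j) (sl V j (cp z)) y) a ∧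
    5 ≤ (mt (K.erase j) (sl V j (cp z)) y).card := by
  have h1 := (h.trEq hj hy hyz hyz').mt
  have hay := not_dic_of_inn hax hx
  have h2 : mt (K.erase j) (sl V j z) y = {a} := by
    rw [hA]
    ext v
    simp only [mem_mt, Finset.mem_singleton]
    constructor
    · exact fun h => h.1
    · rintro rfl
      exact ⟨rfl, hay⟩
  rw [h2] at h1
  obtain ⟨h3, h4, h5⟩ := h1.covers_of_singleton hay (meets_mt _ _ _)
  refine ⟨h4, h3, h5, ?_⟩
  refine (five_le_of_covers ((h.left.sl j (cp z)).mono (mt_subset _ _ _)) h3 h5 ?_).1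
  intro b hb e
  exact h.left.noC_sl hj z a (by simp [hA]) b (mt_subset _ _ _ hb) e.symm

end Classes

section Classes

variable {S : Type} [Cpl S] {ι : Type} [DecidableEq ι]

variable [Finite S] [Fintype ι] {K : Finset ι} {V W : Finset (ι → S)} {j : ι}

/-- A single word and five words with the same trace form a pinwheel. -/
theorem EqPair.single_pForm (h : EqPair K V W) (hj : j ∈ K) {z : S} {a : ι → S}
    (hA : sl V j z = {a}) (hB : (sl V j (cp z)).card = 5) {x : ι → Sel S} (hx : DP K V W j z x) :
    (Meets (K.erase j) (sl V j (cp z)) a ∧ Covers (K.erase j) (sl V j (cp z)) a) ∧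
    (∃ κ₁ κ₂ κ₃ z₁ z₂ z₃, PForm (K.erase j) (sl V j (cp z)) a κ₁ κ₂ κ₃ z₁ z₂ z₃) ∧
    ∀ y ∈ W, y j ≠ z → y j ≠ cp z → ∀ x, Inn (K.erase j) x a → Inn (K.erase j) x y →
      ∀ b ∈ sl V j (cp z), ∀ k ∈ K.erase j, a k ≠ y k → b k = a k := by
  have key : ∀ y ∈ W, y j ≠ z → y j ≠ cp z → ∀ x, Inn (K.erase j) x a → Inn (K.erase j) x y →
      (∀ b ∈ sl V j (cp z), ∀ k ∈ K.erase j, a k ≠ y k → b k = a k) ∧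
      Meets (K.erase j) (sl V j (cp z)) a ∧ Covers (K.erase j) (sl V j (cp z)) a := by
    intro y hy h1 h2 x hx hxy
    obtain ⟨g1, g2, g3, g4⟩ := h.single_slice hj hA hy h1 h2 hx hxy
    have e : mt (K.erase j) (sl V j (cp z)) y = sl V j (cp z) :=
      Finset.eq_of_subset_of_card_le (mt_subset _ _ _) (by omega)
    rw [e] at g1 g2 g3
    exact ⟨g1, g2, g3⟩
  obtain ⟨y, hy, hyz, hyz', hyx⟩ := h.exists_other hj hx.1 hx.2.2.1
  have hax : Inn (K.erase j) x a := by
    obtain ⟨a', ha', hxa⟩ := hx.1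
    rw [hA, Finset.mem_singleton] at ha'
    exact ha' ▸ hxa
  obtain ⟨-, g2, g3⟩ := key y hy hyz hyz' x hax hyx
  refine ⟨⟨g2, g3⟩, ?_, fun y hy h1 h2 x h3 h4 => (key y hy h1 h2 x h3 h4).1⟩
  exact Covers.exists_pForm (h.left.sl j _) g2 g3
    (fun b hb e => h.left.noC_sl hj z a (by simp [hA]) b hb e.symm) hB

theorem cov_singleton_iff {a : ι → S} {x : ι → Sel S} : Cov K {a} x ↔ Inn K x a := by
  simp [Cov]

theorem exists_two_of_card {K : Finset ι} (hK : K.card ≤ 6) {j a b c : ι} (hj : j ∈ K) (ha : a ∈ K)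
    (hb : b ∈ K) (hc : c ∈ K) (h1 : a ≠ b) (h2 : a ≠ c) (h3 : b ≠ c) (h4 : a ≠ j) (h5 : b ≠ j)
    (h6 : c ≠ j) : ∃ k₁ k₂, ∀ k ∈ K, k ≠ j → k ≠ k₁ → k ≠ k₂ → k = a ∨ k = b ∨ k = c := by
  set R := K \ {j, a, b, c} with hR
  have h7 : ({j, a, b, c} : Finset ι).card = 4 := by
    rw [Finset.card_insert_of_notMem, Finset.card_insert_of_notMem, Finset.card_pair h3]
    · simp [h1, h2]
    · simp [h4.symm, h5.symm, h6.symm]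
  have h8 : R.card ≤ 2 := by
    rw [hR, Finset.card_sdiff_of_subset (by intro k; simp; rintro (rfl | rfl | rfl | rfl) <;> assumption)]
    omega
  have h9 : ∃ k₁ k₂, R ⊆ {k₁, k₂} := by
    rcases Nat.lt_or_ge R.card 2 with h | h
    · refine ⟨R.toList.headD j, j, fun k hk => ?_⟩
      obtain ⟨k', hk'⟩ := Finset.card_eq_one.1 (le_antisymm (by omega) (Finset.card_pos.2 ⟨k, hk⟩))
      rw [hk', Finset.mem_singleton] at hk
      simp [hk', hk]
    · obtain ⟨k₁, k₂, -, e⟩ := Finset.card_eq_two.1 (le_antisymm h8 h)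
      exact ⟨k₁, k₂, e.subset⟩
  obtain ⟨k₁, k₂, hs⟩ := h9
  refine ⟨k₁, k₂, fun k hk n1 n2 n3 => ?_⟩
  by_contra hcon
  have := hs (show k ∈ R by rw [hR]; simp; tauto)
  simp at this
  tauto

/-- Sizes one, five, one, five cannot occur. -/
theorem EqPair.not_one_five (h : EqPair K V W) (hj : j ∈ K) (hK : K.card ≤ 6) {z : S}
    (hA : (sl V j z).card = 1) (hB : (sl V j (cp z)).card = 5)
    (hC : (sl W j z).card = 1) (hE : (sl W j (cp z)).card = 5)
    (hD : ∃ x, DP K V W j z x) (hD' : ∃ x, DP K W V j z x) : False := by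
  obtain ⟨a, hA⟩ := Finset.card_eq_one.1 hA
  obtain ⟨c, hC⟩ := Finset.card_eq_one.1 hC
  obtain ⟨x, hx⟩ := hD
  obtain ⟨x', hx'⟩ := hD'
  obtain ⟨-, ⟨κ₁, κ₂, κ₃, z₁, z₂, z₃, pf⟩, key⟩ := h.single_pForm hj hA hB hx
  obtain ⟨-, ⟨κ₁', κ₂', κ₃', z₁', z₂', z₃', pf'⟩, -⟩ := h.symm.single_pForm hj hC hE hx'
  have haV : a ∈ V ∧ a j = z := mem_sl.1 (by simp [hA])
  have hcW : c ∈ W ∧ c j = z := mem_sl.1 (by simp [hC])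
  have sq := fun x => h.square hj z x
  simp only [hA, hC, cov_singleton_iff] at sq
  have hout : ∀ x, Cov (K.erase j) (sl W j (cp z)) x → ¬ Inn (K.erase j) x c →
      Cov (K.erase j) (sl V j (cp z)) x := by
    intro x h1 h2
    have := (sq x).2.1 (Or.inr h1)
    tauto
  have hconst : ∀ k ∈ K.erase j, k ≠ κ₁ → k ≠ κ₂ → k ≠ κ₃ → c k = a k := by
    intro k hk n1 n2 n3
    refine (pf'.const hk (ρ := a k) fun x h1 h2 => ?_).2.2.2
    obtain ⟨b, hb, hbx⟩ := hout x h1 h2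
    rw [← pf.off b hb k hk n1 n2 n3]
    exact hbx k hk
  have hyX : ∀ y ∈ W, y j ≠ z → y j ≠ cp z → ¬ Dic (K.erase j) y a →
      y κ₁ = a κ₁ ∧ y κ₂ = a κ₂ ∧ y κ₃ = a κ₃ := by
    intro y hy h1 h2 hd
    obtain ⟨x, hx1, hx2⟩ := exists_inn_two hd
    exact pf.letter (key y hy h1 h2 x hx2 hx1)
  obtain ⟨y, hy, hyz, hyz', hyx⟩ := h.exists_other hj hx.1 hx.2.2.1
  have hax : Inn (K.erase j) x a := by simpa [hA, cov_singleton_iff] using hx.1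
  have hya : ¬ Dic (K.erase j) y a := not_dic_of_inn hyx hax
  have hac : Dic (K.erase j) a c := by
    have h1 : Dic K y c := (h.right y hy c hcW.1 (by rintro rfl; exact hyz hcW.2)).1
    obtain ⟨k, hk, e⟩ := h1.erase (k := j) (by rw [hcW.2]; intro e; exact hyz' (by rw [e, cp_cp]))
    obtain ⟨e1, e2, e3⟩ := hyX y hy hyz hyz' hya
    refine ⟨k, hk, ?_⟩
    by_cases n1 : k = κ₁
    · rw [e, n1, e1]
    by_cases n2 : k = κ₂
    · rw [e, n2, e2]
    by_cases n3 : k = κ₃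
    · rw [e, n3, e3]
    · exact absurd ⟨k, hk, by rw [← hconst k hk n1 n2 n3, e]⟩ hya
  have hcov : Covers K W a := h.covers haV.1
  have hyes : ∀ y ∈ mt K W a, y j ≠ z ∧ y j ≠ cp z := by
    intro y hy
    rw [mem_mt] at hy
    constructor
    · intro e
      have : y ∈ sl W j z := mem_sl.2 ⟨hy.1, e⟩
      rw [hC, Finset.mem_singleton] at this
      exact hy.2 (this ▸ hac.symm.of_erase)
    · intro e
      exact hy.2 ⟨j, hj, by rw [haV.2, e, cp_cp]⟩
  obtain ⟨k₁, k₂, hk⟩ := exists_two_of_card hK hj (Finset.mem_of_mem_erase pf.mem₁)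
    (Finset.mem_of_mem_erase pf.mem₂) (Finset.mem_of_mem_erase pf.mem₃) pf.ne₁₂ pf.ne₁₃ pf.ne₂₃
    (Finset.ne_of_mem_erase pf.mem₁) (Finset.ne_of_mem_erase pf.mem₂)
    (Finset.ne_of_mem_erase pf.mem₃)
  refine not_covers_of_three (h.right.mono (mt_subset K W a)) (meets_mt _ _ _) hcov.mt hj
    (fun y hy => by rw [haV.2]; exact (hyes y hy).1) (k₁ := k₁) (k₂ := k₂) ?_
  intro y hy k hkK n1 n2 n3
  obtain ⟨g1, g2⟩ := hyes y hy
  rw [mem_mt] at hy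
  obtain ⟨e1, e2, e3⟩ := hyX y hy.1 g1 g2 fun hd => hy.2 hd.of_erase
  rcases hk k hkK n1 n2 n3 with rfl | rfl | rfl
  · exact e1
  · exact e2
  · exact e3


/-- The sizes of the slices when both differences are inhabited. -/
theorem EqPair.two_le_sizes (h : EqPair K V W) (hj : j ∈ K) (hK : K.card ≤ 6) {z : S}
    (hp : (sl V j z).card + (sl W j (cp z)).card ≤ 6)
    (hD : ∃ x, DP K V W j z x) (hD' : ∃ x, DP K W V j z x) :
    2 ≤ (sl V j z).card ∧ 2 ≤ (sl V j (cp z)).card ∧ 2 ≤ (sl W j z).card ∧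
      2 ≤ (sl W j (cp z)).card := by
  have hs := h.card_sl hj z
  obtain ⟨x, hx⟩ := id hD
  obtain ⟨x', hx'⟩ := id hD'
  obtain ⟨y, hy, hyz, hyz', hyx⟩ := h.exists_other hj hx.1 hx.2.2.1
  have h1 := (h.trEq hj hy hyz hyz').card_mt (h.left.sl j z) (h.left.sl j (cp z))
    (h.left.noC_sl hj z) hyx hx.1
  obtain ⟨y', hy', hyz2, hyz2', hyx'⟩ := h.symm.exists_other hj hx'.1 hx'.2.2.1
  have h2 := (h.symm.trEq hj hy' hyz2 hyz2').card_mt (h.right.sl j z) (h.right.sl j (cp z))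
    (h.right.noC_sl hj z) hyx' hx'.1
  have m1 := card_mt_le (K.erase j) (sl V j z) y
  have m2 := card_mt_le (K.erase j) (sl V j (cp z)) y
  have m3 := card_mt_le (K.erase j) (sl W j z) y'
  have m4 := card_mt_le (K.erase j) (sl W j (cp z)) y'
  have n1 : ¬ ((sl V j z).card = 1 ∧ (sl V j (cp z)).card = 5 ∧ (sl W j z).card = 1 ∧
      (sl W j (cp z)).card = 5) := fun ⟨a1, a2, a3, a4⟩ => h.not_one_five hj hK a1 a2 a3 a4 hD hD'
  have n2 : ¬ ((sl V j z).card = 5 ∧ (sl V j (cp z)).card = 1 ∧ (sl W j z).card = 5 ∧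
      (sl W j (cp z)).card = 1) := fun ⟨a1, a2, a3, a4⟩ =>
    h.not_one_five hj hK (z := cp z) a2 (by rwa [cp_cp]) a4 (by rwa [cp_cp]) ⟨x, hx.cp⟩ ⟨x', hx'.cp⟩
  omega

end Classes

section Rigid

variable {S : Type} [Cpl S] [Finite S] {ι : Type} [DecidableEq ι] [Fintype ι]

variable {K : Finset ι} {V W : Finset (ι → S)} {j : ι} {z : S} {c e : ι → S}

/-- A class whose slices have sizes five, five, one, one. -/
structure Rig (K : Finset ι) (V W : Finset (ι → S)) (j : ι) (z : S) (c e : ι → S) : Prop where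
  pair : EqPair K V W
  mem : j ∈ K
  left : (sl V j z).card = 5
  left' : (sl V j (cp z)).card = 5
  right : sl W j z = {c}
  right' : sl W j (cp z) = {e}
  not_dp : ∀ x, ¬ DP K W V j z x

theorem Rig.flip (h : Rig K V W j z c e) : Rig K V W j (cp z) e c where
  pair := h.pair
  mem := h.mem
  left := h.left'
  left' := by rw [cp_cp]; exact h.left
  right := h.right'
  right' := by rw [cp_cp]; exact h.right
  not_dp := fun x hx => h.not_dp x (dp_cp.1 hx)

theorem Rig.cov_iff (h : Rig K V W j z c e) (x : ι → Sel S) :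
    Cov (K.erase j) (sl V j z) x ↔ Inn (K.erase j) x c ∨ DP K V W j z x := by
  have h1 := h.pair.cases h.mem z x
  have h2 := h.not_dp x
  have h3 : Cov (K.erase j) (sl W j z) x ↔ Inn (K.erase j) x c := by
    rw [h.right, cov_singleton_iff]
  rw [h3] at h1
  constructor
  · intro hx
    rcases h1 with h1 | h1 | h1
    · exact Or.inr h1
    · exact absurd h1 h2
    · exact Or.inl (h1.1.1 hx)
  · rintro (hx | hx)
    · rcases h1 with h1 | h1 | h1
      · exact h1.1
      · exact absurd h1 h2
      · exact h1.1.2 hx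
    · exact hx.1

theorem Rig.not_inn (h : Rig K V W j z c e) {x : ι → Sel S} (hx : DP K V W j z x) :
    ¬ Inn (K.erase j) x c := fun hc => hx.2.2.1 (by rw [h.right, cov_singleton_iff]; exact hc)

theorem Rig.exists_pForm (h : Rig K V W j z c e) :
    ∃ κ₁ κ₂ κ₃ z₁ z₂ z₃, PForm (K.erase j) (sl V j z) c κ₁ κ₂ κ₃ z₁ z₂ z₃ := by
  have hc : Covers (K.erase j) (sl V j z) c := fun x hx => (h.cov_iff x).2 (Or.inl hx)
  have hno : ∀ a ∈ sl V j z, ¬ Agr (K.erase j) a c := fun a ha =>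
    h.pair.noC_sl h.mem z a ha c (by simp [h.right])
  have hA := h.pair.left.sl j z
  have e : mt (K.erase j) (sl V j z) c = sl V j z :=
    Finset.eq_of_subset_of_card_le (mt_subset _ _ _) (by rw [h.left]; exact hc.five_le hA hno)
  exact hc.exists_pForm hA (e ▸ meets_mt _ _ _) hno h.left

/-- Another rigid class with the same difference has the same constant positions. -/
theorem Rig.const (h : Rig K V W j z c e) {κ₁ κ₂ κ₃ : ι}
    {Q : (ι → Sel S) → Prop} {w : ι → S}
    (hQ : ∀ x, DP K V W j z x → Q x)
    (hw : ∀ x, Q x → ∀ k ∈ K.erase j, k ≠ κ₁ → k ≠ κ₂ → k ≠ κ₃ → (x k).val (w k)) :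
    ∀ k ∈ K.erase j, k ≠ κ₁ → k ≠ κ₂ → k ≠ κ₃ → c k = w k ∧ ∀ a ∈ sl V j z, a k = w k := by
  intro k hk n1 n2 n3
  obtain ⟨μ₁, μ₂, μ₃, y₁, y₂, y₃, pf⟩ := h.exists_pForm
  have h1 := pf.const hk (ρ := w k) fun x h1 h2 =>
    hw x (hQ x (((h.cov_iff x).1 h1).resolve_left h2)) k hk n1 n2 n3
  exact ⟨h1.2.2.2, fun a ha => by rw [pf.off a ha k hk h1.1 h1.2.1 h1.2.2.1, h1.2.2.2]⟩

/-- The four words complementary to a pinwheel minus its centre. -/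
def pinComp (c : ι → S) (κ₁ κ₂ κ₃ : ι) (z₁ z₂ z₃ : S) : Fin 4 → ι → S :=
  ![c, Function.update (Function.update (Function.update c κ₁ z₁) κ₂ (cp z₂)) κ₃ (cp (c κ₃)),
    Function.update (Function.update (Function.update c κ₁ (cp z₁)) κ₂ (cp (c κ₂))) κ₃ z₃,
    Function.update (Function.update (Function.update c κ₁ (cp (c κ₁))) κ₂ z₂) κ₃ (cp z₃)]

variable {A : Finset (ι → S)} {κ₁ κ₂ κ₃ : ι} {z₁ z₂ z₃ : S}

theorem pinComp_val (n1 : κ₁ ≠ κ₂) (n2 : κ₁ ≠ κ₃) (n3 : κ₂ ≠ κ₃) (p : Fin 4) :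
    pinComp c κ₁ κ₂ κ₃ z₁ z₂ z₃ p κ₁ = (![c κ₁, z₁, cp z₁, cp (c κ₁)] : Fin 4 → S) p ∧
    pinComp c κ₁ κ₂ κ₃ z₁ z₂ z₃ p κ₂ = (![c κ₂, cp z₂, cp (c κ₂), z₂] : Fin 4 → S) p ∧
    pinComp c κ₁ κ₂ κ₃ z₁ z₂ z₃ p κ₃ = (![c κ₃, cp (c κ₃), z₃, cp z₃] : Fin 4 → S) p ∧
    ∀ k, k ≠ κ₁ → k ≠ κ₂ → k ≠ κ₃ → pinComp c κ₁ κ₂ κ₃ z₁ z₂ z₃ p k = c k := by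
  refine ⟨?_, ?_, ?_, fun k e1 e2 e3 => ?_⟩ <;> fin_cases p <;>
    simp [pinComp, n1, n2, n3, Function.update_of_ne, *]

theorem PForm.pinComp_dic (h : PForm K A c κ₁ κ₂ κ₃ z₁ z₂ z₃) (p q : Fin 4) (hpq : p ≠ q) :
    Dic K (pinComp c κ₁ κ₂ κ₃ z₁ z₂ z₃ p) (pinComp c κ₁ κ₂ κ₃ z₁ z₂ z₃ q) ∧
      ∀ k, k = κ₁ ∨ k = κ₂ ∨ k = κ₃ →
        pinComp c κ₁ κ₂ κ₃ z₁ z₂ z₃ p k ≠ pinComp c κ₁ κ₂ κ₃ z₁ z₂ z₃ q k := by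
  have a1 := h.z_1
  have a1' := h.z_1'
  have a2 := h.z_2
  have a2' := h.z_2'
  have a3 := h.z_3
  have a3' := h.z_3'
  have vp := pinComp_val (c := c) (z₁ := z₁) (z₂ := z₂) (z₃ := z₃) h.ne₁₂ h.ne₁₃ h.ne₂₃ p
  have vq := pinComp_val (c := c) (z₁ := z₁) (z₂ := z₂) (z₃ := z₃) h.ne₁₂ h.ne₁₃ h.ne₂₃ q
  constructor
  · suffices pinComp c κ₁ κ₂ κ₃ z₁ z₂ z₃ q κ₁ = cp (pinComp c κ₁ κ₂ κ₃ z₁ z₂ z₃ p κ₁) ∨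
        pinComp c κ₁ κ₂ κ₃ z₁ z₂ z₃ q κ₂ = cp (pinComp c κ₁ κ₂ κ₃ z₁ z₂ z₃ p κ₂) ∨
        pinComp c κ₁ κ₂ κ₃ z₁ z₂ z₃ q κ₃ = cp (pinComp c κ₁ κ₂ κ₃ z₁ z₂ z₃ p κ₃) by
      rcases this with g | g | g
      · exact ⟨κ₁, h.mem₁, g⟩
      · exact ⟨κ₂, h.mem₂, g⟩
      · exact ⟨κ₃, h.mem₃, g⟩
    rw [vp.1, vp.2.1, vp.2.2.1, vq.1, vq.2.1, vq.2.2.1]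
    clear vp vq h
    fin_cases p <;> fin_cases q <;> simp at hpq ⊢
  · rintro k (rfl | rfl | rfl)
    · rw [vp.1, vq.1]
      clear vp vq h
      fin_cases p <;> fin_cases q <;> simp at hpq ⊢ <;> grind
    · rw [vp.2.1, vq.2.1]
      clear vp vq h
      fin_cases p <;> fin_cases q <;> simp at hpq ⊢ <;> grind
    · rw [vp.2.2.1, vq.2.2.1]
      clear vp vq h
      fin_cases p <;> fin_cases q <;> simp at hpq ⊢ <;> grind

/-- In the slab of the pinwheel, the points outside its words lie in the complementary words. -/
theorem PForm.pinComp_cov (h : PForm K A c κ₁ κ₂ κ₃ z₁ z₂ z₃) {x : ι → Sel S}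
    (hx : ∀ k ∈ K, k ≠ κ₁ → k ≠ κ₂ → k ≠ κ₃ → (x k).val (c k)) (hA : ¬ Cov K A x) :
    ∃ p, Inn K x (pinComp c κ₁ κ₂ κ₃ z₁ z₂ z₃ p) := by
  have n1 := h.ne₁₂
  have n2 := h.ne₁₃
  have n3 := h.ne₂₃
  have cov : ∀ s₁ s₂ s₃, (∃ a ∈ A, a κ₁ = s₁ ∧ a κ₂ = s₂ ∧ a κ₃ = s₃) →
      ¬ ((x κ₁).val s₁ ∧ (x κ₂).val s₂ ∧ (x κ₃).val s₃) := by
    rintro s₁ s₂ s₃ ⟨a, ha, rfl, rfl, rfl⟩ ⟨g1, g2, g3⟩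
    refine hA ⟨a, ha, fun k hk => ?_⟩
    by_cases e1 : k = κ₁
    · rwa [e1]
    by_cases e2 : k = κ₂
    · rwa [e2]
    by_cases e3 : k = κ₃
    · rwa [e3]
    rw [h.off a ha k hk e1 e2 e3]
    exact hx k hk e1 e2 e3
  have inn : ∀ w : ι → S, (∀ k, k ≠ κ₁ → k ≠ κ₂ → k ≠ κ₃ → w k = c k) →
      (x κ₁).val (w κ₁) → (x κ₂).val (w κ₂) → (x κ₃).val (w κ₃) → Inn K x w := by
    intro w hw g1 g2 g3 k hk
    by_cases e1 : k = κ₁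
    · rwa [e1]
    by_cases e2 : k = κ₂
    · rwa [e2]
    by_cases e3 : k = κ₃
    · rwa [e3]
    rw [hw k e1 e2 e3]
    exact hx k hk e1 e2 e3
  have c1 := cov _ _ _ h.word₁
  have c2 := cov _ _ _ h.word₂
  have c3 := cov _ _ _ h.word₃
  have c4 := cov _ _ _ h.word₄
  have c5 := cov _ _ _ h.word₅
  simp only [Sel.val_cp] at c1 c2 c3 c4 c5
  by_cases b1 : (x κ₁).val z₁
  · by_cases b2 : (x κ₂).val z₂
    · refine ⟨3, inn _ ?_ ?_ ?_ ?_⟩ <;> simp [pinComp, n1, n2, n3, Sel.val_cp] <;> grind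
    · refine ⟨1, inn _ ?_ ?_ ?_ ?_⟩ <;> simp [pinComp, n1, n2, n3, Sel.val_cp] <;> grind
  · by_cases b3 : (x κ₃).val z₃
    · refine ⟨2, inn _ ?_ ?_ ?_ ?_⟩ <;> simp [pinComp, n1, n2, n3, Sel.val_cp] <;> grind
    · refine ⟨3, inn _ ?_ ?_ ?_ ?_⟩ <;> simp [pinComp, n1, n2, n3, Sel.val_cp] <;> grind

end Rigid

section ClassSums

variable {S : Type} [Cpl S] [Finite S] {ι : Type} [DecidableEq ι] [Fintype ι]

variable {K : Finset ι} {V W : Finset (ι → S)} {j : ι}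

theorem EqPair.four_le (h : EqPair K V W) (hj : j ∈ K) {v : ι → S} (hv : v ∈ V) :
    4 ≤ (sl V j (v j)).card + (sl W j (cp (v j))).card := by
  have ih : ∀ A B : Finset (ι → S), EqPair (K.erase j) A B → A.Nonempty → 8 ≤ A.card :=
    fun A B hAB hA => hAB.eight_le hA
  by_cases hc : ∃ x, Cov (K.erase j) (sl V j (v j)) x ∧ ¬ Cov (K.erase j) (sl W j (v j)) x
  · obtain ⟨x, hx, hx'⟩ := hc
    exact h.four_le_aux hj _ ih hx hx'
  by_cases hc2 : ∃ x, Cov (K.erase j) (sl W j (v j)) x ∧ ¬ Cov (K.erase j) (sl V j (v j)) x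
  · obtain ⟨x, hx, hx'⟩ := hc2
    have := h.symm.four_le_aux hj _ ih hx hx'
    have := h.card_sl hj (v j)
    omega
  · push Not at hc hc2
    have := ih _ _ (h.of_slices hj fun x => ⟨hc x, hc2 x⟩) ⟨v, mem_sl.2 ⟨hv, rfl⟩⟩
    omega

theorem EqPair.four_le_right (h : EqPair K V W) (hj : j ∈ K) {w : ι → S} (hw : w ∈ W) :
    4 ≤ (sl V j (w j)).card + (sl W j (cp (w j))).card := by
  have h1 := h.symm.four_le hj hw
  have h2 := h.card_sl hj (w j)
  omega

theorem EqPair.sum_two (h : EqPair K V W) (hj : j ∈ K) {z m : S} (h1 : m ≠ z) (h2 : m ≠ cp z) :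
    (sl V j z).card + (sl W j (cp z)).card + ((sl V j m).card + (sl W j (cp m)).card) ≤ V.card := by
  have e1 := card_sl_four V j h1 h2
  have e2 := card_sl_four W j h1 h2
  have e3 := h.card_sl hj z
  have e4 := h.card_sl hj m
  have e5 := h.card_eq hj
  omega

theorem card_sl_six (A : Finset (ι → S)) (k : ι) {z t u : S} (h1 : t ≠ z) (h2 : t ≠ cp z)
    (h3 : u ≠ z) (h4 : u ≠ cp z) (h5 : u ≠ t) (h6 : u ≠ cp t) :
    (sl A k z).card + (sl A k (cp z)).card + (sl A k t).card + (sl A k (cp t)).card +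
      (sl A k u).card + (sl A k (cp u)).card ≤ A.card := by
  have := sl_sum_le A k [z, cp z, t, cp t, u, cp u] (by
    simp only [List.nodup_cons, List.mem_cons, List.not_mem_nil, or_false, not_or, not_false_eq_true,
      List.nodup_nil, and_true]
    grind)
  simpa [add_assoc] using this

theorem EqPair.sum_three (h : EqPair K V W) (hj : j ∈ K) {z t u : S} (h1 : t ≠ z) (h2 : t ≠ cp z)
    (h3 : u ≠ z) (h4 : u ≠ cp z) (h5 : u ≠ t) (h6 : u ≠ cp t) :
    (sl V j z).card + (sl W j (cp z)).card + ((sl V j t).card + (sl W j (cp t)).card) +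
      ((sl V j u).card + (sl W j (cp u)).card) ≤ V.card := by
  have e1 := card_sl_six V j h1 h2 h3 h4 h5 h6
  have e2 := card_sl_six W j h1 h2 h3 h4 h5 h6
  have e3 := h.card_sl hj z
  have e4 := h.card_sl hj t
  have e6 := h.card_sl hj u
  have e5 := h.card_eq hj
  omega

theorem EqPair.letters_left (h : EqPair K V W) (hj : j ∈ K) {z m : S} (h1 : m ≠ z) (h2 : m ≠ cp z)
    (hs : V.card < (sl V j z).card + (sl W j (cp z)).card +
      ((sl V j m).card + (sl W j (cp m)).card) + 4) {v : ι → S} (hv : v ∈ V) :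
    v j = z ∨ v j = cp z ∨ v j = m ∨ v j = cp m := by
  by_contra! hc
  have := h.sum_three hj h1 h2 hc.1 hc.2.1 hc.2.2.1 hc.2.2.2
  have := h.four_le hj hv
  omega

theorem EqPair.letters_right (h : EqPair K V W) (hj : j ∈ K) {z m : S} (h1 : m ≠ z) (h2 : m ≠ cp z)
    (hs : V.card < (sl V j z).card + (sl W j (cp z)).card +
      ((sl V j m).card + (sl W j (cp m)).card) + 4) {w : ι → S} (hw : w ∈ W) :
    w j = z ∨ w j = cp z ∨ w j = m ∨ w j = cp m := by
  by_contra! hc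
  have := h.sum_three hj h1 h2 hc.1 hc.2.1 hc.2.2.1 hc.2.2.2
  have := h.four_le_right hj hw
  omega

/-- With two classes only, the differences of the two classes are exchanged. -/
theorem EqPair.dp_swap (h : EqPair K V W) (hj : j ∈ K) {z m : S} (h1 : m ≠ z) (h2 : m ≠ cp z)
    (hl : ∀ w ∈ W, w j = z ∨ w j = cp z ∨ w j = m ∨ w j = cp m) {x : ι → Sel S}
    (hx : DP K V W j z x) : DP K W V j m x := by
  obtain ⟨y, hy, hyz, hyz', hyx⟩ := h.exists_other hj hx.1 hx.2.2.1
  have hm : Cov (K.erase j) (sl W j m) x ∨ Cov (K.erase j) (sl W j (cp m)) x := by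
    rcases hl y hy with e | e | e | e
    · exact absurd e hyz
    · exact absurd e hyz'
    · exact Or.inl ⟨y, mem_sl.2 ⟨hy, e⟩, hyx⟩
    · exact Or.inr ⟨y, mem_sl.2 ⟨hy, e⟩, hyx⟩
  have n1 : ¬ Cov (K.erase j) (sl V j m) x := fun hc =>
    h1 (h.left.cov_sl_unique hj h2 hc hx.1)
  have n2 : ¬ Cov (K.erase j) (sl V j (cp m)) x := fun hc =>
    h2 (by have := h.left.cov_sl_unique hj (by grind) hc hx.1; grind)
  rcases h.cases hj m x with g | g | g
  · exact absurd g.1 n1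
  · exact g
  · rcases hm with hm | hm
    · exact absurd (g.1.2 hm) n1
    · exact absurd (g.2.2 hm) n2

/-- Complementary slices of an exact cover cover the same points. -/
theorem IsCode.eqPair {I : Finset ι} {U : Finset (ι → S)} {i : ι} (hU : IsCode I U) (hi : i ∈ I)
    (hc : ∀ x, Cov I U x) (s : S) :
    EqPair (I.erase i) (Keller.sl U i s) (Keller.sl U i (cp s)) := by
  have key : ∀ s x, Cov (I.erase i) (Keller.sl U i s) x →
      Cov (I.erase i) (Keller.sl U i (cp s)) x := by
    intro s x hx
    obtain ⟨ω, hω, -⟩ := exists_sel_two (a := cp s) (b := cp s) (by grind)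
    obtain ⟨t, ht, hc⟩ := (cov_update hi).1 (hc (Function.update x i ω))
    by_cases e : s = cp t
    · rw [e, cp_cp]; exact hc
    · have := hU.cov_sl_unique hi e hx hc
      subst this
      exact absurd ht ((Sel.val_cp _ _).1 hω)
  exact ⟨hU.sl i s, hU.sl i _, hU.noC_sl hi s,
    fun x => ⟨key s x, fun hx => by have := key _ x hx; rwa [cp_cp] at this⟩⟩

/-- The pair of complementary slices of an exact cover. -/
structure Full (I : Finset ι) (U : Finset (ι → S)) (i : ι) (s : S) : Prop where
  code : IsCode I U
  mem : i ∈ I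
  card : I.card ≤ 7
  cov : ∀ x, Cov I U x
  le : (sl U i s).card ≤ 12
  le' : (sl U i (cp s)).card ≤ 12
  ne : (sl U i s).Nonempty

variable {I : Finset ι} {U : Finset (ι → S)} {i : ι} {s : S}

theorem Full.eqPair (h : Full I U i s) : EqPair (I.erase i) (sl U i s) (sl U i (cp s)) :=
  h.code.eqPair h.mem h.cov s

theorem Full.symm (h : Full I U i s) : Full I U i (cp s) where
  code := h.code
  mem := h.mem
  card := h.card
  cov := h.cov
  le := h.le'
  le' := by rw [cp_cp]; exact h.le
  ne := h.eqPair.nonempty h.ne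

theorem Full.dic (h : Full I U i s) {u v : ι → S} (hu : u ∈ U) (h1 : u i ≠ s) (h2 : u i ≠ cp s)
    (hv : v ∈ sl U i s ∨ v ∈ sl U i (cp s)) : Dic (I.erase i) u v := by
  simp only [mem_sl] at hv
  have hne : u ≠ v := by
    rintro rfl
    rcases hv with hv | hv
    · exact h1 hv.2
    · exact h2 hv.2
  have hvU : v ∈ U := by
    rcases hv with hv | hv
    · exact hv.1
    · exact hv.1
  refine (h.code u hu v hvU hne).1.erase ?_
  rcases hv with hv | hv
  · rw [hv.2]; grind
  · rw [hv.2]; grind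

/-- A point outside the two slices lies in a word which is dichotomous to both slices. -/
theorem Full.exists_env (h : Full I U i s) {x : ι → Sel S} (hx : ¬ Cov (I.erase i) (sl U i s) x) :
    ∃ u, Inn (I.erase i) x u ∧ ∀ v, v ∈ sl U i s ∨ v ∈ sl U i (cp s) → Dic (I.erase i) u v := by
  obtain ⟨u, hu, hxu⟩ := h.cov x
  have hxu' := (inn_iff_erase h.mem).1 hxu
  refine ⟨u, hxu'.2, fun v hv => h.dic hu (fun e => ?_) (fun e => ?_) hv⟩
  · exact hx ⟨u, mem_sl.2 ⟨hu, e⟩, hxu'.2⟩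
  · exact hx ((h.eqPair.cov x).2 ⟨u, mem_sl.2 ⟨hu, e⟩, hxu'.2⟩)

end ClassSums

section RigidKill

variable {S : Type} [Cpl S] [Finite S] {ι : Type} [DecidableEq ι] [Fintype ι]

variable {K : Finset ι} {V W : Finset (ι → S)} {j : ι} {z m : S} {c e f g : ι → S}

theorem Rig.cov_right (h : Rig K V W j z c e) {x : ι → Sel S} (hx : Inn (K.erase j) x c) :
    Cov (K.erase j) (sl V j z) x ∧ Cov (K.erase j) (sl W j z) x :=
  ⟨(h.cov_iff x).2 (Or.inl hx), by rw [h.right]; exact cov_singleton_iff.2 hx⟩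

/-- The single words of two different rigid classes do not agree. -/
theorem Rig.not_agr (h : Rig K V W j z c e) (h' : Rig K W V j m f g) (h1 : m ≠ z) (h2 : m ≠ cp z) :
    ¬ Agr (K.erase j) c f := by
  intro ha
  obtain ⟨x, hx⟩ := exists_inn (K.erase j) c
  have c1 := h.cov_right hx
  have c2 := h'.cov_right (x := x) (fun k hk => ha k hk ▸ hx k hk)
  exact h1 (h.pair.left.cov_sl_unique h.mem h2 c2.2 c1.1)

theorem PForm.pinComp_agr {K : Finset ι} {A : Finset (ι → S)} {κ₁ κ₂ κ₃ : ι} {z₁ z₂ z₃ : S}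
    (h : PForm K A c κ₁ κ₂ κ₃ z₁ z₂ z₃) {t : ι → S}
    (ht : ∀ k ∈ K, k ≠ κ₁ → k ≠ κ₂ → k ≠ κ₃ → t k = c k)
    (hc : ∀ x, Inn K x t → Inn K x c ∨ ¬ Cov K A x) :
    ∃ p, Agr K t (pinComp c κ₁ κ₂ κ₃ z₁ z₂ z₃ p) := by
  by_contra! hno
  have hcov : Covers K (Finset.univ.image (pinComp c κ₁ κ₂ κ₃ z₁ z₂ z₃)) t := by
    intro x hx
    have : ∃ p, Inn K x (pinComp c κ₁ κ₂ κ₃ z₁ z₂ z₃ p) := by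
      rcases hc x hx with g | g
      · exact ⟨0, g⟩
      · exact h.pinComp_cov (fun k hk n1 n2 n3 => ht k hk n1 n2 n3 ▸ hx k hk) g
    obtain ⟨p, hp⟩ := this
    exact ⟨_, Finset.mem_image_of_mem _ (Finset.mem_univ p), hp⟩
  have hcode : IsCode K (Finset.univ.image (pinComp c κ₁ κ₂ κ₃ z₁ z₂ z₃)) := by
    intro v hv w hw hvw
    obtain ⟨p, -, rfl⟩ := Finset.mem_image.1 hv
    obtain ⟨q, -, rfl⟩ := Finset.mem_image.1 hw
    obtain ⟨d1, d2⟩ := h.pinComp_dic p q (fun e => hvw (e ▸ rfl))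
    refine ⟨d1, ?_⟩
    rintro ⟨k, -, -, hk⟩
    by_cases e : κ₁ = k
    · exact d2 κ₂ (Or.inr (Or.inl rfl)) (hk κ₂ h.mem₂ (e ▸ h.ne₁₂.symm)).symm
    · exact d2 κ₁ (Or.inl rfl) (hk κ₁ h.mem₁ e).symm
  have h5 := hcov.five_le' hcode (fun a ha hag => by
    obtain ⟨p, -, rfl⟩ := Finset.mem_image.1 ha
    exact hno p hag.symm)
  have h6 : (Finset.univ.image (pinComp c κ₁ κ₂ κ₃ z₁ z₂ z₃)).card ≤ 4 :=
    Finset.card_image_le.trans (by simp)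
  omega

/-- The data shared by the two classes of a rigid coordinate. -/
structure RigData (K : Finset ι) (V W : Finset (ι → S)) (j : ι) (c : ι → S) (T : Fin 4 → ι → S)
    (X : Finset ι) (l : Fin 4 → S) : Prop where
  zero : T 0 = c
  card : ∃ k₁ k₂, ∀ k ∈ K, k ≠ j → k ≠ k₁ → k ≠ k₂ → k ∈ X
  off : ∀ v, v ∈ V ∨ v ∈ W → ∀ k ∈ K.erase j, k ∉ X → v k = c k
  off_T : ∀ p, ∀ k ∈ K.erase j, k ∉ X → T p k = c k
  dic : ∀ p q, p ≠ q → Dic (K.erase j) (T p) (T q)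
  not_tw : ∀ p q l l', p ≠ q → ¬ Tw K (Function.update (T p) j l) (Function.update (T q) j l')
  cov : ∀ x, Cov K V x ∨ (∃ k ∈ K.erase j, k ∉ X ∧ ¬ (x k).val (c k)) ∨
    ∃ p, Inn (K.erase j) x (T p) ∧ (x j).val (l p)
  not_cov : ∀ x, Inn (K.erase j) x c → (x j).val (l 0) → ¬ Cov K V x

theorem Rig.exists_partner (h : Rig K V W j z c e) (hV : V.card ≤ 12) :
    ∃ m f g, m ≠ z ∧ m ≠ cp z ∧ Rig K W V j m f g ∧
      (∀ v ∈ V, v j = z ∨ v j = cp z ∨ v j = m ∨ v j = cp m) ∧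
      (∀ v ∈ W, v j = z ∨ v j = cp z ∨ v j = m ∨ v j = cp m) ∧
      ∀ x, DP K W V j m x → DP K V W j z x := by
  have p1 : (sl V j z).card = 5 := h.left
  have p2 : (sl W j (cp z)).card = 1 := by rw [h.right']; simp
  obtain ⟨x, hx⟩ : ∃ x, DP K V W j z x := (h.pair.exists_dp h.mem (by omega) (by omega)).resolve_right
    fun ⟨x, hx⟩ => h.not_dp x hx
  obtain ⟨y, hy, n1, n2, -⟩ := h.pair.exists_other h.mem hx.1 hx.2.2.1
  have q1 := h.pair.four_le_right h.mem hy
  have q2 := h.pair.sum_two h.mem n1 n2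
  have q3 := h.pair.card_sl h.mem (y j)
  have lV := fun v hv => h.pair.letters_left h.mem n1 n2 (by omega) (v := v) hv
  have lW := fun v hv => h.pair.letters_right h.mem n1 n2 (by omega) (w := v) hv
  have s1 : ∀ x, DP K V W j z x → DP K W V j (y j) x := fun x =>
    h.pair.dp_swap h.mem n1 n2 lW
  have s2 : ∀ x, DP K W V j (y j) x → DP K V W j z x := fun x =>
    h.pair.symm.dp_swap h.mem n1.symm (by grind) (fun w hw => by have := lV w hw; grind)
  have s3 : ∀ x, ¬ DP K V W j (y j) x := fun x hx => h.not_dp x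
    (h.pair.dp_swap h.mem n1.symm (by grind) (fun w hw => by have := lW w hw; grind) hx)
  obtain ⟨r1, r2, r3, r4⟩ := h.pair.symm.rigid_sizes h.mem (z := y j) (by omega) ⟨x, s1 x hx⟩ s3
  obtain ⟨f, hf⟩ := Finset.card_eq_one.1 r3
  obtain ⟨g, hg⟩ := Finset.card_eq_one.1 r4
  exact ⟨y j, f, g, n1, n2, ⟨h.pair.symm, h.mem, r1, r2, hf, hg, s3⟩, lV, lW, s2⟩

theorem Rig.exists_data (h : Rig K V W j z c e) (hV : V.card ≤ 12) (hK : K.card ≤ 6) :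
    ∃ T X l, RigData K V W j c T X l := by
  obtain ⟨m, f, g, n1, n2, h', lV, lW, sw⟩ := h.exists_partner hV
  obtain ⟨κ₁, κ₂, κ₃, z₁, z₂, z₃, pf⟩ := h.exists_pForm
  have hQ : ∀ x, DP K V W j z x → ∀ k ∈ K.erase j, k ≠ κ₁ → k ≠ κ₂ → k ≠ κ₃ → (x k).val (c k) := by
    intro x hx k hk e1 e2 e3
    obtain ⟨a, ha, hxa⟩ := hx.1
    rw [← pf.off a ha k hk e1 e2 e3]
    exact hxa k hk
  have ce := h.flip.const (κ₁ := κ₁) (κ₂ := κ₂) (κ₃ := κ₃) (Q := fun x => DP K V W j z x)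
    (fun x hx => dp_cp.1 hx) hQ
  have cf := h'.const (κ₁ := κ₁) (κ₂ := κ₂) (κ₃ := κ₃) (Q := fun x => DP K V W j z x) sw hQ
  have cg := h'.flip.const (κ₁ := κ₁) (κ₂ := κ₂) (κ₃ := κ₃) (Q := fun x => DP K V W j z x)
    (fun x hx => sw x (dp_cp.1 hx)) hQ
  set X : Finset ι := {κ₁, κ₂, κ₃} with hX
  have mX : ∀ k, k ∉ X → k ≠ κ₁ ∧ k ≠ κ₂ ∧ k ≠ κ₃ := by
    intro k hk
    simpa [hX, not_or] using hk
  set T : Fin 4 → ι → S := ![c, e, f, g] with hT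
  set l : Fin 4 → S := ![cp z, z, cp m, m] with hl
  have offT : ∀ p, ∀ k ∈ K.erase j, k ∉ X → T p k = c k := by
    intro p k hk hkX
    obtain ⟨e1, e2, e3⟩ := mX k hkX
    fin_cases p
    · rfl
    · exact (ce k hk e1 e2 e3).1
    · exact (cf k hk e1 e2 e3).1
    · exact (cg k hk e1 e2 e3).1
  have flipNe : cp m ≠ z ∧ cp m ≠ cp z ∧ m ≠ cp (cp z) ∧ cp m ≠ cp (cp z) := by grind
  have na : ∀ p q, p < q → ¬ Agr (K.erase j) (T p) (T q) := by
    have h1 : ¬ Agr (K.erase j) c e :=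
      h.pair.right.noC_sl h.mem z c (by simp [h.right]) e (by simp [h.right'])
    have h2 : ¬ Agr (K.erase j) f g :=
      h.pair.left.noC_sl h.mem m f (by simp [h'.right]) g (by simp [h'.right'])
    have h3 := h.not_agr h' n1 n2
    have h4 := h.not_agr h'.flip flipNe.1 flipNe.2.1
    have h5 := h.flip.not_agr h' n2 flipNe.2.2.1
    have h6 := h.flip.not_agr h'.flip flipNe.2.1 flipNe.2.2.2
    intro p q hpq
    fin_cases p <;> fin_cases q <;> first | exact absurd hpq (by decide) | assumption
  have na' : ∀ p q, p ≠ q → ¬ Agr (K.erase j) (T p) (T q) := by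
    intro p q hpq ha
    rcases lt_or_gt_of_ne hpq with g | g
    · exact na p q g ha
    · exact na q p g ha.symm
  have agr : ∀ p, ∃ q, Agr (K.erase j) (T p) (pinComp c κ₁ κ₂ κ₃ z₁ z₂ z₃ q) := by
    intro p
    refine pf.pinComp_agr (fun k hk e1 e2 e3 => offT p k hk (by simp [hX, e1, e2, e3])) ?_
    intro x hx
    by_contra! hc
    have hD := ((h.cov_iff x).1 hc.2).resolve_left hc.1
    have hDm := h.pair.dp_swap h.mem n1 n2 lW hD
    fin_cases p
    · exact hc.1 hx
    · exact h.flip.not_inn hD.cp hx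
    · exact h'.not_inn hDm hx
    · exact h'.flip.not_inn hDm.cp hx
  choose φ hφ using agr
  have inj : Function.Injective φ := by
    intro p q hpq
    by_contra hne
    exact na' p q hne fun k hk => by rw [hφ p k hk, hφ q k hk, hpq]
  have sur : Function.Surjective φ := Finite.injective_iff_surjective.1 inj
  have dic : ∀ p q, p ≠ q → Dic (K.erase j) (T p) (T q) := by
    intro p q hpq
    obtain ⟨k, hk, e⟩ := (pf.pinComp_dic (φ p) (φ q) (fun e => hpq (inj e))).1
    exact ⟨k, hk, by rw [hφ p k hk, hφ q k hk, e]⟩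
  have ne : ∀ p q, p ≠ q → ∀ k ∈ K.erase j, k = κ₁ ∨ k = κ₂ ∨ k = κ₃ → T p k ≠ T q k := by
    intro p q hpq k hk hkk
    rw [hφ p k hk, hφ q k hk]
    exact (pf.pinComp_dic (φ p) (φ q) (fun e => hpq (inj e))).2 k hkk
  have mem₁ := Finset.mem_erase.1 pf.mem₁
  have mem₂ := Finset.mem_erase.1 pf.mem₂
  have mem₃ := Finset.mem_erase.1 pf.mem₃
  obtain ⟨k₁, k₂, hk⟩ := exists_two_of_card hK h.mem mem₁.2 mem₂.2 mem₃.2 pf.ne₁₂ pf.ne₁₃ pf.ne₂₃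
    mem₁.1 mem₂.1 mem₃.1
  refine ⟨T, X, l, rfl, ⟨k₁, k₂, fun k a b d f => by simpa [hX] using hk k a b d f⟩, ?_, offT, dic, ?_,
    ?_, ?_⟩
  · intro v hv k hk hkX
    obtain ⟨e1, e2, e3⟩ := mX k hkX
    have r1 : v ∈ sl V j z → v k = c k := fun hm => pf.off v hm k hk e1 e2 e3
    have r2 : v ∈ sl V j (cp z) → v k = c k := fun hm => (ce k hk e1 e2 e3).2 v hm
    have r3 : v ∈ sl V j m → v k = c k := fun hm => by
      rw [h'.right, Finset.mem_singleton] at hm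
      exact hm ▸ offT 2 k hk hkX
    have r4 : v ∈ sl V j (cp m) → v k = c k := fun hm => by
      rw [h'.right', Finset.mem_singleton] at hm
      exact hm ▸ offT 3 k hk hkX
    have r5 : v ∈ sl W j z → v k = c k := fun hm => by
      rw [h.right, Finset.mem_singleton] at hm
      exact hm ▸ rfl
    have r6 : v ∈ sl W j (cp z) → v k = c k := fun hm => by
      rw [h.right', Finset.mem_singleton] at hm
      exact hm ▸ offT 1 k hk hkX
    have r7 : v ∈ sl W j m → v k = c k := fun hm => (cf k hk e1 e2 e3).2 v hm
    have r8 : v ∈ sl W j (cp m) → v k = c k := fun hm => (cg k hk e1 e2 e3).2 v hm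
    rcases hv with hv | hv
    · rcases lV v hv with e | e | e | e
      · exact r1 (mem_sl.2 ⟨hv, e⟩)
      · exact r2 (mem_sl.2 ⟨hv, e⟩)
      · exact r3 (mem_sl.2 ⟨hv, e⟩)
      · exact r4 (mem_sl.2 ⟨hv, e⟩)
    · rcases lW v hv with e | e | e | e
      · exact r5 (mem_sl.2 ⟨hv, e⟩)
      · exact r6 (mem_sl.2 ⟨hv, e⟩)
      · exact r7 (mem_sl.2 ⟨hv, e⟩)
      · exact r8 (mem_sl.2 ⟨hv, e⟩)
  · rintro p q l l' hpq ⟨k, -, -, hk⟩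
    have u1 : ∀ κ ∈ K.erase j, (κ = κ₁ ∨ κ = κ₂ ∨ κ = κ₃) → κ ≠ k → False := by
      intro κ hκ hκκ hne
      have e := hk κ (Finset.mem_of_mem_erase hκ) hne
      rw [Function.update_of_ne (Finset.ne_of_mem_erase hκ),
        Function.update_of_ne (Finset.ne_of_mem_erase hκ)] at e
      exact ne p q hpq κ hκ hκκ e.symm
    by_cases e : κ₁ = k
    · exact u1 κ₂ pf.mem₂ (Or.inr (Or.inl rfl)) (e ▸ pf.ne₁₂.symm)
    · exact u1 κ₁ pf.mem₁ (Or.inl rfl) e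
  · intro x
    by_contra! hc
    obtain ⟨hcV, hslab, hT'⟩ := hc
    have cV : ∀ s, (x j).val s → Cov (K.erase j) (sl V j s) x → False := fun s hs hcs => hcV (by
      rw [← Function.update_eq_self j x]
      exact (cov_update h.mem).2 ⟨s, hs, hcs⟩)
    have cW : ∀ s, (x j).val s → Cov (K.erase j) (sl W j s) x → False := fun s hs hcs =>
      hcV ((h.pair.cov x).2 (by
      rw [← Function.update_eq_self j x]
      exact (cov_update h.mem).2 ⟨s, hs, hcs⟩))
    have v0 : ∀ s, (x j).val s ∨ (x j).val (cp s) := fun s => by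
      rw [Sel.val_cp]; exact em _
    have t0 : ¬ Inn (K.erase j) x c := fun hx => (v0 z).elim
      (fun hz => cV z hz (h.cov_right hx).1) (fun hz => hT' 0 hx hz)
    have t1 : ¬ Inn (K.erase j) x e := fun hx => (v0 z).elim
      (fun hz => hT' 1 hx hz) (fun hz => cV _ hz (h.flip.cov_right hx).1)
    have t2 : ¬ Inn (K.erase j) x f := fun hx => (v0 m).elim
      (fun hz => cW m hz (h'.cov_right hx).1) (fun hz => hT' 2 hx hz)
    have t3 : ¬ Inn (K.erase j) x g := fun hx => (v0 m).elim
      (fun hz => hT' 3 hx hz) (fun hz => cW _ hz (h'.flip.cov_right hx).1)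
    have hA : ¬ Cov (K.erase j) (sl V j z) x := by
      intro hA
      have hD := ((h.cov_iff x).1 hA).resolve_left t0
      exact (v0 z).elim (fun hz => cV z hz hA) (fun hz => cV _ hz hD.2.1)
    obtain ⟨p, hp⟩ := pf.pinComp_cov
      (fun k hk e1 e2 e3 => hslab k hk (by simp [hX, e1, e2, e3])) hA
    obtain ⟨q, rfl⟩ := sur p
    have hq : Inn (K.erase j) x (T q) := fun k hk => by rw [hφ q k hk]; exact hp k hk
    fin_cases q
    · exact t0 hq
    · exact t1 hq
    · exact t2 hq
    · exact t3 hq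
  · intro x hx hz hcov
    have hz' : ¬ (x j).val z := (Sel.val_cp _ _).1 hz
    rw [← Function.update_eq_self j x, cov_update h.mem] at hcov
    obtain ⟨t, ht, hc⟩ := hcov
    by_cases et : z = cp t
    · have et' : t = cp z := by rw [et, cp_cp]
      rw [et'] at hc
      rcases (h.flip.cov_iff x).1 hc with g | g
      · exact (dic 0 1 (by decide)).not_inn hx g
      · exact h.not_inn (dp_cp.1 g) hx
    · have := h.pair.left.cov_sl_unique h.mem et (h.cov_right hx).1 hc
      exact hz' (this ▸ ht)

theorem Full.not_rig {I : Finset ι} {U : Finset (ι → S)} {i : ι} {s : S} (h : Full I U i s) :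
    ¬ Rig (I.erase i) (sl U i s) (sl U i (cp s)) j z c e := by
  intro r
  have hj := Finset.mem_erase.1 r.mem
  obtain ⟨T, X, l, d⟩ := r.exists_data h.le (by
    have := h.card
    rw [Finset.card_erase_of_mem h.mem]; omega)
  set K := I.erase i with hK
  set w : ι → S := Function.update (Function.update c j (l 0)) i s with hw
  have wi : w i = s := by simp [hw]
  have wj : w j = l 0 := by simp [hw, Function.update_of_ne hj.1]
  have wk : ∀ k ∈ K.erase j, w k = c k := by
    intro k hk
    have h1 := Finset.mem_erase.1 hk
    have h2 := Finset.mem_erase.1 h1.2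
    simp [hw, Function.update_of_ne h1.1, Function.update_of_ne h2.1]
  have ui : ∀ u ∈ mt I U w, u i ≠ s := by
    intro u hu hus
    obtain ⟨huU, hd⟩ := mem_mt.1 hu
    obtain ⟨x, hxu, hxw⟩ := exists_inn_two hd
    refine d.not_cov x (fun k hk => ?_) (wj ▸ hxw j hj.2)
      ⟨u, mem_sl.2 ⟨huU, hus⟩, hxu.erase i⟩
    rw [← wk k hk]
    exact hxw k (Finset.mem_of_mem_erase (Finset.mem_of_mem_erase hk))
  have main : ∀ u ∈ mt I U w, u j = w j ∧ ∀ k ∈ K.erase j, k ∈ X → u k = w k := by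
    intro u hu
    obtain ⟨huU, hd⟩ := mem_mt.1 hu
    have ui' : u i ≠ cp s := fun e => hd ⟨i, h.mem, by rw [wi, e, cp_cp]⟩
    have dV := fun v hv => h.dic huU (ui u hu) ui' (v := v) hv
    set û : ι → S := fun k => if k = j ∨ k ∈ X then u k else c k with hû
    have û1 : ∀ k, k = j ∨ k ∈ X → û k = u k := fun k hk => if_pos hk
    have û2 : ∀ k, k ≠ j → k ∉ X → û k = c k := fun k h1 h2 => if_neg (by simp [h1, h2])
    have dû : ∀ v, v ∈ sl U i s ∨ v ∈ sl U i (cp s) → Dic K û v := by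
      intro v hv
      obtain ⟨k, hk, e⟩ := dV v hv
      refine ⟨k, hk, ?_⟩
      by_cases hkX : k = j ∨ k ∈ X
      · rw [û1 k hkX, e]
      · exfalso
        rw [not_or] at hkX
        have hk' : k ∈ K.erase j := Finset.mem_erase.2 ⟨hkX.1, hk⟩
        exact hd ⟨k, Finset.mem_of_mem_erase hk, by rw [wk k hk', ← d.off v hv k hk' hkX.2, e]⟩
    obtain ⟨n, hn⟩ : ∃ n, Agr K û (Function.update (T n) j (l n)) := by
      by_contra! hno
      have hcode : IsCode K (Finset.univ.image fun n => Function.update (T n) j (l n)) := by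
        intro v hv v' hv' hvv
        obtain ⟨p, -, rfl⟩ := Finset.mem_image.1 hv
        obtain ⟨q, -, rfl⟩ := Finset.mem_image.1 hv'
        have hpq : p ≠ q := fun e => hvv (by rw [e])
        refine ⟨?_, d.not_tw p q _ _ hpq⟩
        obtain ⟨k, hk, e⟩ := d.dic p q hpq
        have hk' := Finset.mem_erase.1 hk
        exact ⟨k, hk'.2, by rw [Function.update_of_ne hk'.1, Function.update_of_ne hk'.1, e]⟩
      have hcov : Covers K (Finset.univ.image fun n => Function.update (T n) j (l n)) û := by
        intro x hx
        rcases d.cov x with g | ⟨k, hk, hkX, g⟩ | ⟨p, hp, hpl⟩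
        · obtain ⟨v, hv, hxv⟩ := g
          exact ((dû v (Or.inl hv)).not_inn hx hxv).elim
        · have hk' := Finset.mem_erase.1 hk
          exact absurd (û2 k hk'.1 hkX ▸ hx k hk'.2) g
        · refine ⟨_, Finset.mem_image_of_mem _ (Finset.mem_univ p), fun k hk => ?_⟩
          by_cases e : k = j
          · subst e
            simpa using hpl
          · simpa [Function.update_of_ne e] using hp k (Finset.mem_erase.2 ⟨e, hk⟩)
      have h5 := hcov.five_le' hcode (fun a ha hag => by
        obtain ⟨p, -, rfl⟩ := Finset.mem_image.1 ha
        exact hno p hag.symm)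
      have h6 : (Finset.univ.image fun n => Function.update (T n) j (l n)).card ≤ 4 :=
        Finset.card_image_le.trans (by simp)
      omega
    have hn0 : n = 0 := by
      by_contra hne
      obtain ⟨k, hk, e⟩ := d.dic n 0 hne
      have hk' := Finset.mem_erase.1 hk
      rw [d.zero] at e
      by_cases hkX : k ∈ X
      · refine hd ⟨k, Finset.mem_of_mem_erase hk'.2, ?_⟩
        rw [wk k hk, e, ← û1 k (Or.inr hkX), hn k hk'.2, Function.update_of_ne hk'.1]
      · rw [d.off_T n k hk hkX] at e
        exact cp_ne _ e.symm
    subst hn0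
    refine ⟨?_, fun k hk hkX => ?_⟩
    · rw [wj, ← û1 j (Or.inl rfl), hn j r.mem, Function.update_self]
    · have hk' := Finset.mem_erase.1 hk
      rw [wk k hk, ← û1 k (Or.inr hkX), hn k hk'.2, Function.update_of_ne hk'.1, d.zero]
  obtain ⟨k₁, k₂, hk⟩ := d.card
  have hcov : Covers I U w := fun x _ => h.cov x
  refine not_covers_of_three (k₁ := k₁) (k₂ := k₂) (h.code.mono (mt_subset I U w)) (meets_mt _ _ _)
    hcov.mt h.mem (fun a ha => wi ▸ ui a ha) ?_
  intro a ha k hkI n1 n2 n3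
  by_cases e : k = j
  · rw [e]; exact (main a ha).1
  · have hkK : k ∈ K := Finset.mem_erase.2 ⟨n1, hkI⟩
    exact (main a ha).2 k (Finset.mem_erase.2 ⟨e, hkK⟩) (hk k hkK e n2 n3)

end RigidKill

section SmallClasses

variable {S : Type} [Cpl S] [Finite S] {ι : Type} [DecidableEq ι] [Fintype ι]

variable {K : Finset ι} {V W : Finset (ι → S)} {j : ι} {z : S}

theorem six_of_box (hW : IsCode K W) {κ₁ κ₂ : ι} (hj : j ∈ K) (n1 : j ≠ κ₁) (n2 : j ≠ κ₂) {s t : S} {r : ι → S}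
    (hcov : ∀ x : ι → Sel S, (∀ k ∈ K, k ≠ κ₁ → k ≠ κ₂ → (x k).val (r k)) →
      ∃ y ∈ W, y κ₁ = s ∧ y κ₂ = t ∧ y j ≠ r j ∧ ∀ k ∈ K, k ≠ κ₁ → k ≠ κ₂ → (x k).val (y k)) :
    6 ≤ (W.filter fun y => y κ₁ = s ∧ y κ₂ = t ∧ y j ≠ r j).card := by
  set Y := W.filter fun y => y κ₁ = s ∧ y κ₂ = t ∧ y j ≠ r j with hY
  have mY : ∀ {y}, y ∈ Y ↔ y ∈ W ∧ y κ₁ = s ∧ y κ₂ = t ∧ y j ≠ r j := by simp [hY]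
  have mK : ∀ {k}, k ∈ (K.erase κ₁).erase κ₂ ↔ k ≠ κ₂ ∧ k ≠ κ₁ ∧ k ∈ K := by simp
  have hcode : IsCode ((K.erase κ₁).erase κ₂) Y := ((hW.sl κ₁ s).sl κ₂ t).mono fun y hy => by
    have := mY.1 hy
    simp [mem_sl, this]
  have hc : Covers ((K.erase κ₁).erase κ₂) Y r := by
    intro x hx
    obtain ⟨y, hy, e1, e2, e3, hxy⟩ := hcov x fun k hk k1 k2 => hx k (mK.2 ⟨k2, k1, hk⟩)
    exact ⟨y, mY.2 ⟨hy, e1, e2, e3⟩, fun k hk => by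
      have := mK.1 hk
      exact hxy k this.2.2 this.2.1 this.1⟩
  exact (six_le_of_covers (hcode.mono (mt_subset _ _ r)) (meets_mt _ _ _) hc.mt (mK.2 ⟨n2, n1, hj⟩)
    (fun a ha => (mY.1 (mem_mt.1 ha).1).2.2.2)).1.trans (card_mt_le _ _ _)

theorem exists_upd_two (x : ι → Sel S) {κ₁ κ₂ : ι} (h12 : κ₁ ≠ κ₂) {s₁ t₁ s₂ t₂ : S}
    (h1 : t₁ ≠ cp s₁) (h2 : t₂ ≠ cp s₂) : ∃ x' : ι → Sel S, (∀ k, k ≠ κ₁ → k ≠ κ₂ → x' k = x k) ∧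
      (x' κ₁).val s₁ ∧ (x' κ₁).val t₁ ∧ (x' κ₂).val s₂ ∧ (x' κ₂).val t₂ := by
  obtain ⟨ω₁, a1, b1⟩ := exists_sel_two h1
  obtain ⟨ω₂, a2, b2⟩ := exists_sel_two h2
  refine ⟨Function.update (Function.update x κ₁ ω₁) κ₂ ω₂, fun k k1 k2 => ?_, ?_, ?_, ?_, ?_⟩ <;>
    simp [*]

theorem IsCode.dic_of_ne (hW : IsCode K W) {y c : ι → S} (hy : y ∈ W) (hc : c ∈ Keller.sl W j z)
    (h1 : y j ≠ z) (h2 : y j ≠ cp z) : Dic (K.erase j) y c := by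
  obtain ⟨hc, e⟩ := mem_sl.1 hc
  exact (hW y hy c hc fun h => h1 (h ▸ e)).1.erase (by rw [e]; grind)

theorem IsCode.dic_two (hW : IsCode K W) {y c : ι → S} (hy : y ∈ W) (hc : c ∈ Keller.sl W j z)
    (h1 : y j ≠ z) (h2 : y j ≠ cp z) {x : ι → Sel S} (hx : Inn K x y) {κ₁ κ₂ : ι}
    (ho : ∀ k ∈ K.erase j, k ≠ κ₁ → k ≠ κ₂ → (x k).val (c k)) :
    c κ₁ = cp (y κ₁) ∨ c κ₂ = cp (y κ₂) := by
  obtain ⟨k, hk, e⟩ := hW.dic_of_ne hy hc h1 h2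
  by_cases e1 : k = κ₁
  · exact Or.inl (e1 ▸ e)
  by_cases e2 : k = κ₂
  · exact Or.inr (e2 ▸ e)
  have := ho k hk e1 e2
  rw [e, Sel.val_cp] at this
  exact absurd (hx k (Finset.mem_of_mem_erase hk)) this

/-- A point covered by `V`, but not by the slices of `W` at `z`. -/
theorem EqPair.exists_word (h : EqPair K V W) {x : ι → Sel S} (hx : Cov K V x)
    (h1 : ¬ Cov (K.erase j) (sl W j z) x) (h2 : ¬ Cov (K.erase j) (sl W j (cp z)) x) :
    ∃ y ∈ W, y j ≠ z ∧ y j ≠ cp z ∧ Inn K x y := by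
  obtain ⟨y, hy, hxy⟩ := (h.cov x).1 hx
  exact ⟨y, hy, fun e => h1 ⟨y, mem_sl.2 ⟨hy, e⟩, hxy.erase j⟩,
    fun e => h2 ⟨y, mem_sl.2 ⟨hy, e⟩, hxy.erase j⟩, hxy⟩

theorem cov_of_slices (hj : j ∈ K) {x : ι → Sel S} (h1 : Cov (K.erase j) (sl V j z) x)
    (h2 : Cov (K.erase j) (sl V j (cp z)) x) : Cov K V x := by
  rw [← Function.update_eq_self j x, cov_update hj]
  by_cases e : (x j).val z
  · exact ⟨z, e, h1⟩
  · exact ⟨cp z, (Sel.val_cp _ _).2 e, h2⟩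

variable {I : Finset ι} {U : Finset (ι → S)} {i : ι} {s : S}

theorem Full.exists_env_both (h : Full I U i s) (hj : j ∈ I.erase i)
    (hA : (sl (sl U i s) j z).Nonempty) (hB : (sl (sl U i s) j (cp z)).card ≤ 4) :
    ∃ o x, o j = cp z ∧ Inn ((I.erase i).erase j) x o ∧ Cov ((I.erase i).erase j) (sl (sl U i s) j z) x ∧
      ∀ v, v ∈ sl U i s ∨ v ∈ sl U i (cp s) → Dic (I.erase i) o v := by
  have hp := h.eqPair
  set K := I.erase i
  set V := sl U i s
  set W := sl U i (cp s)
  obtain ⟨x, hx, hxB⟩ : ∃ x, Cov (K.erase j) (sl V j z) x ∧ ¬ Cov (K.erase j) (sl V j (cp z)) x := by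
    by_contra! hc
    obtain ⟨a, ha⟩ := hA
    have := (covers_of_sub hc ha).five_le' (hp.left.sl j _)
      (fun b hb e => hp.left.noC_sl hj z a ha b hb e.symm)
    omega
  obtain ⟨ω, hω, -⟩ := exists_sel_two (a := cp z) (b := cp z) (by grind)
  obtain ⟨o, hxo, ho⟩ := h.exists_env (x := Function.update x j ω) (by
    rw [cov_update hj]
    rintro ⟨t, ht, hc⟩
    by_cases e : z = cp t
    · exact hxB (by rw [e, cp_cp]; exact hc)
    · have := hp.left.cov_sl_unique hj e hx hc
      exact (Sel.val_cp _ _).1 hω (this ▸ ht))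
  have hxo' := ((inn_update hj).1 hxo).2
  refine ⟨o, x, ?_, hxo', hx, ho⟩
  obtain ⟨a, ha, hxa⟩ := hx
  obtain ⟨haV, e⟩ := mem_sl.1 ha
  by_contra hne
  exact ((ho a (Or.inl haV)).erase (by rw [e]; grind)).not_inn hxo' hxa

theorem dic_env {o b : ι → S} (ho : o j = cp z) (hb : b j = cp z) (h : Dic K o b) :
    Dic (K.erase j) o b := h.erase (by rw [ho, hb]; exact (cp_ne _).symm)

theorem EqPair.trEq_env (h : EqPair K V W) (hj : j ∈ K) {o : ι → S} (ho : o j = cp z)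
    (hd : ∀ v, v ∈ V ∨ v ∈ W → Dic K o v) : TrEq (K.erase j) (sl V j z) (sl W j z) o := by
  intro x hx
  rcases h.cases hj z x with g | g | g
  · obtain ⟨b, hb, hxb⟩ := g.2.1
    obtain ⟨hb, e⟩ := mem_sl.1 hb
    exact ((dic_env ho e (hd b (Or.inl hb))).not_inn hx hxb).elim
  · obtain ⟨b, hb, hxb⟩ := g.2.1
    obtain ⟨hb, e⟩ := mem_sl.1 hb
    exact ((dic_env ho e (hd b (Or.inr hb))).not_inn hx hxb).elim
  · exact g.1

theorem mt_eq_of_card {A : Finset (ι → S)} {y : ι → S} (h : A.card ≤ (mt K A y).card) :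
    mt K A y = A := Finset.eq_of_subset_of_card_le (mt_subset _ _ _) h

theorem Full.vertical_false (h : Full I U i s) (hj : j ∈ I.erase i)
    (hA : (sl (sl U i s) j z).card = 2) (hC : (sl (sl U i (cp s)) j z).card = 2)
    (hB : (sl (sl U i s) j (cp z)).card ≤ 4) : False := by
  obtain ⟨o, x, oj, hxo, hxA, od⟩ := h.exists_env_both hj (Finset.card_pos.1 (by omega)) hB
  have hp := h.eqPair
  have hle := h.le
  set K := I.erase i
  set V := sl U i s
  set W := sl U i (cp s)
  have tr := hp.trEq_env hj oj od
  have cm := tr.card_mt (hp.left.sl j z) (hp.right.sl j z) (hp.noC_sl hj z) hxo hxA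
  have l1 := card_mt_le (K.erase j) (sl V j z) o
  have l2 := card_mt_le (K.erase j) (sl W j z) o
  have e1 : mt (K.erase j) (sl V j z) o = sl V j z := mt_eq_of_card (by omega)
  have e2 : mt (K.erase j) (sl W j z) o = sl W j z := mt_eq_of_card (by omega)
  obtain ⟨a, a', c, c', κ₁, κ₂, eA, eC, L⟩ := tr.exists_lForm (hp.left.sl j z) (hp.right.sl j z)
    (e1 ▸ meets_mt _ _ _) (e2 ▸ meets_mt _ _ _) (hp.noC_sl hj z) hA hC
  have ma : a ∈ sl V j z := by simp [eA]
  have ma' : a' ∈ sl V j z := by simp [eA]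
  have mc : c ∈ sl W j z := by simp [eC]
  have mc' : c' ∈ sl W j z := by simp [eC]
  obtain ⟨j1, h1⟩ := Finset.mem_erase.1 L.mem₁
  obtain ⟨j2, h2⟩ := Finset.mem_erase.1 L.mem₂
  have aj := (mem_sl.1 ma).2
  have covA : ∀ {x : ι → Sel S}, Cov (K.erase j) (sl V j z) x ↔
      Inn (K.erase j) x a ∨ Inn (K.erase j) x a' := by intro x; rw [eA]; simp [Cov]
  have covC : ∀ {x : ι → Sel S}, Cov (K.erase j) (sl W j z) x ↔
      Inn (K.erase j) x c ∨ Inn (K.erase j) x c' := by intro x; rw [eC]; simp [Cov]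
  have offI : ∀ {x : ι → Sel S} {w : ι → S}, (∀ k ∈ K, k ≠ κ₁ → k ≠ κ₂ → (x k).val (a k)) →
      (∀ k ∈ K.erase j, k ≠ κ₁ → k ≠ κ₂ → w k = a k) → (x κ₁).val (w κ₁) → (x κ₂).val (w κ₂) →
      Inn (K.erase j) x w := by
    intro x w hx hw g1 g2 k hk
    by_cases e1 : k = κ₁
    · exact e1 ▸ g1
    by_cases e2 : k = κ₂
    · exact e2 ▸ g2
    rw [hw k hk e1 e2]
    exact hx k (Finset.mem_of_mem_erase hk) e1 e2
  have s1 := six_of_box hp.right hj j1.symm j2.symm (s := cp (o κ₁)) (t := c κ₂) (r := a)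
    (by
      intro x hx
      obtain ⟨x', hx', p1, p2, p3, -⟩ := exists_upd_two x L.ne (s₁ := cp (o κ₁)) (t₁ := cp (a κ₁))
        (s₂ := c κ₂) (t₂ := c κ₂) (by have := L.a₁'; grind) (by grind)
      have hx2 : ∀ k ∈ K, k ≠ κ₁ → k ≠ κ₂ → (x' k).val (a k) := fun k hk n1 n2 => by
        rw [hx' k n1 n2]; exact hx k hk n1 n2
      have cA : Cov (K.erase j) (sl V j z) x' := covA.2 (Or.inr (offI hx2
        (fun k hk n1 n2 => (L.off k hk n1 n2).1) (by rw [L.a'₁]; exact p2) (by rw [L.a'₂]; exact p3)))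
      have nC : ¬ Cov (K.erase j) (sl W j z) x' := by
        rw [covC]
        rintro (g | g)
        · have := g κ₁ L.mem₁
          rw [L.b₁] at this
          exact (Sel.val_cp _ _).1 p1 this
        · have := g κ₂ L.mem₂
          rw [L.b'₂, Sel.val_cp] at this
          exact this p3
      have hD : DP K V W j z x' := by
        rcases hp.cases hj z x' with g | g | g
        · exact g
        · exact absurd g.1 nC
        · exact absurd (g.1.1 cA) nC
      obtain ⟨y, hy, y1, y2, hxy⟩ := hp.exists_word (cov_of_slices hj hD.1 hD.2.1) hD.2.2.1 hD.2.2.2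
      have d1 := hp.right.dic_two hy mc y1 y2 hxy (κ₁ := κ₁) (κ₂ := κ₂) (fun k hk n1 n2 => by
        rw [(L.off k hk n1 n2).2.1]; exact hx2 k (Finset.mem_of_mem_erase hk) n1 n2)
      have d2 := hp.right.dic_two hy mc' y1 y2 hxy (κ₁ := κ₁) (κ₂ := κ₂) (fun k hk n1 n2 => by
        rw [(L.off k hk n1 n2).2.2]; exact hx2 k (Finset.mem_of_mem_erase hk) n1 n2)
      have v1 := hxy κ₁ h1
      have v2 := hxy κ₂ h2
      have y1' : y κ₁ = cp (o κ₁) := by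
        have := L.b₁
        rcases d1 with d1 | d1
        · grind
        · rw [d1, Sel.val_cp] at p3
          exact absurd v2 p3
      refine ⟨y, hy, y1', ?_, aj ▸ y1, fun k hk n1 n2 => hx' k n1 n2 ▸ hxy k hk⟩
      have := L.b'₁
      have := L.b'₂
      have := L.a₁
      rcases d2 with d2 | d2 <;> grind)
  have s2 := six_of_box hp.left hj j1.symm j2.symm (s := a κ₁) (t := cp (o κ₂)) (r := a)
    (by
      intro x hx
      obtain ⟨x', hx', p1, -, p2, p3⟩ := exists_upd_two x L.ne (s₁ := a κ₁) (t₁ := a κ₁)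
        (s₂ := cp (o κ₂)) (t₂ := cp (c κ₂)) (by grind) (by have := L.b₂'; grind)
      have hx2 : ∀ k ∈ K, k ≠ κ₁ → k ≠ κ₂ → (x' k).val (a k) := fun k hk n1 n2 => by
        rw [hx' k n1 n2]; exact hx k hk n1 n2
      have cC : Cov (K.erase j) (sl W j z) x' := covC.2 (Or.inr (offI hx2
        (fun k hk n1 n2 => (L.off k hk n1 n2).2.2) (by rw [L.b'₁]; exact p1) (by rw [L.b'₂]; exact p3)))
      have nA : ¬ Cov (K.erase j) (sl V j z) x' := by
        rw [covA]
        rintro (g | g)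
        · have := g κ₂ L.mem₂
          rw [L.a₂] at this
          exact (Sel.val_cp _ _).1 p2 this
        · have := g κ₁ L.mem₁
          rw [L.a'₁, Sel.val_cp] at this
          exact this p1
      have hD : DP K W V j z x' := by
        rcases hp.cases hj z x' with g | g | g
        · exact absurd g.1 nA
        · exact g
        · exact absurd (g.1.2 cC) nA
      obtain ⟨y, hy, y1, y2, hxy⟩ := hp.symm.exists_word (cov_of_slices hj hD.1 hD.2.1) hD.2.2.1 hD.2.2.2
      have d1 := hp.left.dic_two hy ma y1 y2 hxy (κ₁ := κ₁) (κ₂ := κ₂) (fun k hk n1 n2 =>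
        hx2 k (Finset.mem_of_mem_erase hk) n1 n2)
      have d2 := hp.left.dic_two hy ma' y1 y2 hxy (κ₁ := κ₁) (κ₂ := κ₂) (fun k hk n1 n2 => by
        rw [(L.off k hk n1 n2).1]; exact hx2 k (Finset.mem_of_mem_erase hk) n1 n2)
      have v1 := hxy κ₁ h1
      have v2 := hxy κ₂ h2
      have y2' : y κ₂ = cp (o κ₂) := by
        have := L.a₂
        rcases d1 with d1 | d1
        · rw [d1, Sel.val_cp] at p1
          exact absurd v1 p1
        · grind
      refine ⟨y, hy, ?_, y2', aj ▸ y1, fun k hk n1 n2 => hx' k n1 n2 ▸ hxy k hk⟩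
      have := L.a'₁
      have := L.a'₂
      have := L.b₂
      rcases d2 with d2 | d2 <;> grind)
  have c1 : 6 ≤ (sl W κ₁ (cp (o κ₁))).card := s1.trans (Finset.card_le_card fun y hy => by
    rw [Finset.mem_filter] at hy
    exact mem_sl.2 ⟨hy.1, hy.2.1⟩)
  have c2 : 7 ≤ (sl V κ₁ (a κ₁)).card := by
    have hlt : (V.filter fun y => y κ₁ = a κ₁ ∧ y κ₂ = cp (o κ₂) ∧ y j ≠ a j) ⊂ sl V κ₁ (a κ₁) := by
      refine Finset.ssubset_iff_subset_ne.2 ⟨fun y hy => ?_, fun e => ?_⟩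
      · rw [Finset.mem_filter] at hy
        exact mem_sl.2 ⟨hy.1, hy.2.1⟩
      · have : a ∈ sl V κ₁ (a κ₁) := mem_sl.2 ⟨(mem_sl.1 ma).1, rfl⟩
        rw [← e, Finset.mem_filter] at this
        exact this.2.2.2 rfl
    have := Finset.card_lt_card hlt
    omega
  have := hp.sum_two h1 L.a₁.symm (z := a κ₁) (m := o κ₁) (by have := L.a₁'; grind)
  omega

end SmallClasses

section Horizontal

variable {S : Type} [Cpl S] [Finite S] {ι : Type} [DecidableEq ι] [Fintype ι]

variable {K : Finset ι} {V W : Finset (ι → S)} {j : ι} {z : S}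

theorem inn_of_off {x : ι → Sel S} {r w : ι → S} {κ₁ κ₂ : ι}
    (hx : ∀ k ∈ K, k ≠ κ₁ → k ≠ κ₂ → (x k).val (r k)) (hw : ∀ k ∈ K, k ≠ κ₁ → k ≠ κ₂ → w k = r k)
    (g1 : (x κ₁).val (w κ₁)) (g2 : (x κ₂).val (w κ₂)) : Inn K x w := by
  intro k hk
  by_cases e1 : k = κ₁
  · exact e1 ▸ g1
  by_cases e2 : k = κ₂
  · exact e2 ▸ g2
  rw [hw k hk e1 e2]
  exact hx k hk e1 e2

/-- Words with the letters of an L-form and a third word in the same position. -/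
theorem LForm.meets_eq {a a' b b' y o : ι → S} {κ₁ κ₂ : ι} (L : LForm K a a' b b' y κ₁ κ₂)
    (m : ¬ Dic K a o) (m' : ¬ Dic K a' o) (d : Dic K o b) (d' : Dic K o b') :
    o κ₁ = cp (y κ₁) ∧ o κ₂ = b κ₂ := by
  have key : ∀ k ∈ K, o k ≠ cp (a k) ∧ o k ≠ cp (a' k) := fun k hk =>
    ⟨fun e => m ⟨k, hk, e⟩, fun e => m' ⟨k, hk, e⟩⟩
  constructor
  · obtain ⟨k, hk, e⟩ := d
    have hk' := key k hk
    by_cases e1 : k = κ₁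
    · subst e1
      rw [L.b₁] at e
      grind
    by_cases e2 : k = κ₂
    · subst e2
      have := L.a'₂
      grind
    · have := (L.off k hk e1 e2).2.1
      grind
  · obtain ⟨k, hk, e⟩ := d'
    have hk' := key k hk
    by_cases e1 : k = κ₁
    · subst e1
      have := L.b'₁
      grind
    by_cases e2 : k = κ₂
    · subst e2
      have := L.b'₂
      grind
    · have := (L.off k hk e1 e2).2.2
      grind

theorem LForm.exists_swap {a a' b b' y o : ι → S} {κ₁ κ₂ : ι} {A C : Finset (ι → S)}
    (L : LForm K a a' b b' y κ₁ κ₂) (hm : ∀ w, w ∈ A ↔ w = a ∨ w = a') (h2A : A.card = 2)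
    (t : TrEq K A C o) (hA : IsCode K A)
    (hC : IsCode K C) (hno : NoC K A C) (m : Meets K A o) (mC : Meets K C o)
    (hc : 2 ≤ C.card) (hc' : C.card ≤ 3) (h1 : o κ₁ = cp (y κ₁)) (h2 : o κ₂ = b κ₂) :
    ∃ c c', (c ∈ C ∧ c' ∈ C) ∧ c κ₁ = cp (y κ₁) ∧ c κ₂ = y κ₂ ∧ c' κ₁ = cp (a κ₁) ∧
      c' κ₂ = cp (y κ₂) ∧ ∀ k ∈ K, k ≠ κ₁ → k ≠ κ₂ → c k = a k ∧ c' k = a k := by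
  have eq2 : ∀ {g g' : ι → S}, g ∈ A → g' ∈ A → ∀ k ∈ K, g k ≠ g' k → k = κ₁ ∨ k = κ₂ := by
    intro g g' hg hg' k hk hn
    rw [hm] at hg hg'
    by_contra! hh
    have := (L.off k hk hh.1 hh.2).1
    rcases hg with rfl | rfl <;> rcases hg' with rfl | rfl <;> grind
  rcases (by omega : C.card = 2 ∨ C.card = 3) with h | h
  · obtain ⟨g, g', c, c', μ₁, μ₂, eA, eC, M⟩ := t.exists_lForm hA hC m mC hno h2A h
    have mg : g ∈ A := by simp [eA]
    have mg' : g' ∈ A := by simp [eA]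
    have hd := eq2 mg mg'
    have hgg : g ≠ g' := fun e => by
      have := M.a'₁
      rw [← e] at this
      exact ne_cp _ this
    have d1 := hd μ₁ M.mem₁ (by rw [M.a'₁]; exact ne_cp _)
    have d2 := hd μ₂ M.mem₂ (by rw [M.a₂, M.a'₂]; exact M.b₂.symm)
    have hg := (hm _).1 mg
    have hg' := (hm _).1 mg'
    have hh : (g = a ∧ g' = a') ∨ (g = a' ∧ g' = a) := by grind
    have l1 := L.a₂
    have l2 := L.a'₂
    have l3 := L.b₂
    have l4 := L.b₂'
    have l5 := L.a'₁
    have m1 := M.a'₁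
    have e1 : μ₁ = κ₁ := by
      rcases d1 with d1 | d1
      · exact d1
      · rw [d1] at m1
        rcases hh with ⟨rfl, rfl⟩ | ⟨rfl, rfl⟩ <;> grind
    have e2 : μ₂ = κ₂ := by
      rcases d2 with d2 | d2
      · exact absurd (e1.trans d2.symm) M.ne
      · exact d2
    subst e1 e2
    have m2 := M.a₂
    have hh' : g = a' ∧ g' = a := by
      rcases hh with ⟨rfl, rfl⟩ | hh
      · grind
      · exact hh
    obtain ⟨rfl, rfl⟩ := hh'
    have m3 := M.a'₂
    have m4 := M.b₁
    have m5 := M.b'₁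
    have m6 := M.b'₂
    refine ⟨c, c', by simp [eC], by grind, by grind, by grind, by grind, fun k hk n1 n2 => ?_⟩
    have o1 := L.off k hk n1 n2
    have o2 := M.off k hk n1 n2
    exact ⟨by rw [o2.2.1, o1.1], by rw [o2.2.2, o1.1]⟩
  · obtain ⟨g, g', b₀, b₁, b₂, μ₁, μ₂, μ₃, eA, -, M | M⟩ := t.exists_hForm hA hC m mC hno h2A h
    all_goals
      have hd := eq2 (g := g) (g' := g') (by simp [eA]) (by simp [eA])
      have d1 := hd μ₁ M.mem₁ (by rw [M.a'_1]; exact ne_cp _)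
      have d2 := hd μ₂ M.mem₂ (by have := M.b₀_2; have := M.a_2; have := M.a'_2; grind)
      have d3 := hd μ₃ M.mem₃ (by have := M.b₀_3; have := M.a_3; have := M.a'_3; grind)
      have := M.ne₁₂
      have := M.ne₁₃
      have := M.ne₂₃
      grind

theorem LForm.cov_iff {a a' b b' y : ι → S} {κ₁ κ₂ : ι} (L : LForm K a a' b b' y κ₁ κ₂)
    {x : ι → Sel S} (hx : ∀ k ∈ K, k ≠ κ₁ → k ≠ κ₂ → (x k).val (a k)) (g1 : (x κ₁).val (y κ₁))
    (g2 : (x κ₂).val (y κ₂)) :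
    (Inn K x a ∨ Inn K x a' ↔ (x κ₁).val (a κ₁) ∨ (x κ₂).val (b κ₂)) ∧
    (Inn K x b ∨ Inn K x b' ↔ (x κ₁).val (a κ₁) ∨ (x κ₂).val (b κ₂)) := by
  have i1 := fun g => inn_of_off (w := a) hx (fun _ _ _ _ => rfl) g (L.a₂.symm ▸ g2)
  have i2 := fun g g' => inn_of_off (w := a') hx (fun k hk n1 n2 => (L.off k hk n1 n2).1)
    (L.a'₁.symm ▸ g) (L.a'₂.symm ▸ g')
  have i3 := fun g => inn_of_off (w := b) hx (fun k hk n1 n2 => (L.off k hk n1 n2).2.1)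
    (L.b₁.symm ▸ g1) g
  have i4 := fun g g' => inn_of_off (w := b') hx (fun k hk n1 n2 => (L.off k hk n1 n2).2.2)
    (L.b'₁.symm ▸ g) (L.b'₂.symm ▸ g')
  have j1 := fun h : Inn K x a => h κ₁ L.mem₁
  have j2 := fun h : Inn K x a' => h κ₂ L.mem₂
  have j3 := fun h : Inn K x b => h κ₂ L.mem₂
  have j4 := fun h : Inn K x b' => h κ₁ L.mem₁
  rw [L.a'₂] at j2
  rw [L.b'₁] at j4
  simp only [Sel.val_cp] at i2 i4
  by_cases v1 : (x κ₁).val (a κ₁) <;> by_cases v2 : (x κ₂).val (b κ₂) <;> simp_all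

theorem EqPair.not_cov_of_lForm (h : EqPair K V W) (hj : j ∈ K) {a a' b b' y c c' : ι → S} {κ₁ κ₂ : ι}
    (mA : ∀ w, w ∈ Keller.sl V j z ↔ w = a ∨ w = a') (mB : ∀ w, w ∈ Keller.sl V j (cp z) ↔ w = b ∨ w = b')
    (L : LForm (K.erase j) a a' b b' y κ₁ κ₂) (mc : c ∈ Keller.sl W j z) (mc' : c' ∈ Keller.sl W j z)
    (c1 : c κ₁ = cp (y κ₁)) (c2 : c κ₂ = y κ₂) (c'1 : c' κ₁ = cp (a κ₁)) (c'2 : c' κ₂ = cp (y κ₂))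
    (coff : ∀ k ∈ K.erase j, k ≠ κ₁ → k ≠ κ₂ → c k = a k ∧ c' k = a k)
    (hC : (Keller.sl W j z).card = 3) (hE : (Keller.sl W j (cp z)).card ≤ 4)
    {x : ι → Sel S} (hx : ∀ k ∈ K.erase j, k ≠ κ₁ → k ≠ κ₂ → (x k).val (a k))
    (g1 : (x κ₁).val (y κ₁)) (g2 : (x κ₂).val (y κ₂)) :
    ¬ Cov (K.erase j) (Keller.sl W j z) x := by
  have cC := h.right.sl j z
  have cE := h.right.sl j (cp z)
  obtain ⟨c₃, hc₃, n1, n2⟩ : ∃ c₃ ∈ sl W j z, c₃ ≠ c ∧ c₃ ≠ c' := by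
    by_contra! hcon
    have : sl W j z ⊆ {c, c'} := fun w hw => by
      by_cases e : w = c
      · simp [e]
      · simp [hcon w hw e]
    have := (Finset.card_le_card this).trans Finset.card_le_two
    omega
  have eC3 : sl W j z = {c, c', c₃} := by
    refine (Finset.eq_of_subset_of_card_le (fun w hw => ?_) ?_).symm
    · simp only [Finset.mem_insert, Finset.mem_singleton] at hw
      rcases hw with rfl | rfl | rfl <;> assumption
    · rw [hC, Finset.card_eq_three.2 ⟨c, c', c₃, ?_, n1.symm, n2.symm, rfl⟩]
      intro e
      have := L.a₁'
      grind
  have covA : ∀ {x : ι → Sel S}, Cov (K.erase j) (sl V j z) x ↔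
      Inn (K.erase j) x a ∨ Inn (K.erase j) x a' := by simp [Cov, mA]
  have covB : ∀ {x : ι → Sel S}, Cov (K.erase j) (sl V j (cp z)) x ↔
      Inn (K.erase j) x b ∨ Inn (K.erase j) x b' := by simp [Cov, mB]
  have la₁ := L.a₁
  have la₁' := L.a₁'
  rw [eC3]
  rintro ⟨w, hw, hxw⟩
  simp only [Finset.mem_insert, Finset.mem_singleton] at hw
  rcases hw with rfl | rfl | rfl
  · have := hxw κ₁ L.mem₁
    rw [c1, Sel.val_cp] at this
    exact this g1
  · have := hxw κ₂ L.mem₂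
    rw [c'2, Sel.val_cp] at this
    exact this g2
  · have k1 : w κ₁ = y κ₁ := by
      obtain ⟨k, hk, e⟩ := (cC w hc₃ c mc n1).1
      have hv := hxw k hk
      by_cases e1 : k = κ₁
      · subst e1; grind
      by_cases e2 : k = κ₂
      · subst e2
        rw [show w k = cp (c k) by grind, Sel.val_cp, c2] at hv
        exact absurd g2 hv
      · rw [show w k = cp (c k) by grind, Sel.val_cp, (coff k hk e1 e2).1] at hv
        exact absurd (hx k hk e1 e2) hv
    have k2 : w κ₂ = y κ₂ := by
      obtain ⟨k, hk, e⟩ := (cC w hc₃ c' mc' n2).1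
      have hv := hxw k hk
      by_cases e1 : k = κ₁
      · subst e1; grind
      by_cases e2 : k = κ₂
      · subst e2; grind
      · rw [show w k = cp (c' k) by grind, Sel.val_cp, (coff k hk e1 e2).2] at hv
        exact absurd (hx k hk e1 e2) hv
    have hcv : Covers (K.erase j) (sl W j (cp z)) w := by
      intro x' hx'
      have e0 : Cov (K.erase j) (sl W j z) x' := ⟨w, hc₃, hx'⟩
      have v1 := hx' κ₁ L.mem₁
      have v2 := hx' κ₂ L.mem₂
      rw [k1] at v1
      rw [k2] at v2
      rcases h.cases hj z x' with q | q | q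
      · exact absurd e0 q.2.2.1
      · exact q.2.1
      · have p := (covA).1 (q.1.2 e0)
        have hx2 : ∀ k ∈ K.erase j, k ≠ κ₁ → k ≠ κ₂ → (x' k).val (a k) := by
          rcases p with p | p
          · exact fun k hk _ _ => p k hk
          · exact fun k hk n1 n2 => (L.off k hk n1 n2).1 ▸ p k hk
        have := L.cov_iff hx2 v1 v2
        exact q.2.1 (covB.2 (this.2.2 (this.1.1 p)))
    have := hcv.five_le' cE (fun e he q => h.right.noC_sl hj z w hc₃ e he q.symm)
    omega

theorem EqPair.lForm_false (h : EqPair K V W) (hj : j ∈ K) {a a' b b' y c c' : ι → S} {κ₁ κ₂ : ι}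
    (mA : ∀ w, w ∈ Keller.sl V j z ↔ w = a ∨ w = a') (mB : ∀ w, w ∈ Keller.sl V j (cp z) ↔ w = b ∨ w = b')
    (L : LForm (K.erase j) a a' b b' y κ₁ κ₂) (mc : c ∈ Keller.sl W j z) (mc' : c' ∈ Keller.sl W j z)
    (c1 : c κ₁ = cp (y κ₁)) (c2 : c κ₂ = y κ₂) (c'1 : c' κ₁ = cp (a κ₁)) (c'2 : c' κ₂ = cp (y κ₂))
    (coff : ∀ k ∈ K.erase j, k ≠ κ₁ → k ≠ κ₂ → c k = a k ∧ c' k = a k)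
    (hC : (Keller.sl W j z).card = 3) (hE : (Keller.sl W j (cp z)).card ≤ 4)
    (hle : V.card ≤ 12) : False := by
  obtain ⟨j1, h1⟩ := Finset.mem_erase.1 L.mem₁
  obtain ⟨j2, h2⟩ := Finset.mem_erase.1 L.mem₂
  have ma : a ∈ sl V j z := (mA _).2 (Or.inl rfl)
  have ma' : a' ∈ sl V j z := (mA _).2 (Or.inr rfl)
  have mb' : b' ∈ sl V j (cp z) := (mB _).2 (Or.inr rfl)
  have aj := (mem_sl.1 ma).2
  have la'₁ := L.a'₁
  have lb₁ := L.b₁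
  have lb'₁ := L.b'₁
  have la₂ := L.a₂
  have la'₂ := L.a'₂
  have lb'₂ := L.b'₂
  have la₁ := L.a₁
  have la₁' := L.a₁'
  have lb₂ := L.b₂
  have lb₂' := L.b₂'
  have covA : ∀ {x : ι → Sel S}, Cov (K.erase j) (sl V j z) x ↔
      Inn (K.erase j) x a ∨ Inn (K.erase j) x a' := by simp [Cov, mA]
  have covB : ∀ {x : ι → Sel S}, Cov (K.erase j) (sl V j (cp z)) x ↔
      Inn (K.erase j) x b ∨ Inn (K.erase j) x b' := by simp [Cov, mB]
  have words : ∀ x : ι → Sel S, (∀ k ∈ K, k ≠ κ₁ → k ≠ κ₂ → (x k).val (a k)) →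
      ∃ y' ∈ W, y' κ₁ = y κ₁ ∧ y' κ₂ = y κ₂ ∧ y' j ≠ a j ∧
        ∀ k ∈ K, k ≠ κ₁ → k ≠ κ₂ → (x k).val (y' k) := by
    intro x hx
    obtain ⟨x', hx', p1, p2, p3, -⟩ := exists_upd_two x L.ne (s₁ := y κ₁) (t₁ := a κ₁)
      (s₂ := y κ₂) (t₂ := y κ₂) la₁' (by grind)
    have hx1 : ∀ k ∈ K, k ≠ κ₁ → k ≠ κ₂ → (x' k).val (a k) := fun k hk n1 n2 => by
      rw [hx' k n1 n2]; exact hx k hk n1 n2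
    have hx2 : ∀ k ∈ K.erase j, k ≠ κ₁ → k ≠ κ₂ → (x' k).val (a k) := fun k hk =>
      hx1 k (Finset.mem_of_mem_erase hk)
    have bx : Cov (K.erase j) (sl V j z) x' ∧ Cov (K.erase j) (sl V j (cp z)) x' :=
      ⟨covA.2 ((L.cov_iff hx2 p1 p3).1.2 (Or.inl p2)), covB.2 ((L.cov_iff hx2 p1 p3).2.2 (Or.inl p2))⟩
    have nC := h.not_cov_of_lForm hj mA mB L mc mc' c1 c2 c'1 c'2 coff hC hE hx2 p1 p3
    have hD : DP K V W j z x' := by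
      rcases h.cases hj z x' with g | g | g
      · exact g
      · exact absurd bx.1 g.2.2.1
      · exact absurd (g.1.1 bx.1) nC
    obtain ⟨y', hy', y1, y2, hxy⟩ := h.exists_word (cov_of_slices hj hD.1 hD.2.1) hD.2.2.1 hD.2.2.2
    have d1 := h.right.dic_two hy' mc y1 y2 hxy (κ₁ := κ₁) (κ₂ := κ₂) (fun k hk n1 n2 => by
      rw [(coff k hk n1 n2).1]; exact hx2 k hk n1 n2)
    have d2 := h.right.dic_two hy' mc' y1 y2 hxy (κ₁ := κ₁) (κ₂ := κ₂) (fun k hk n1 n2 => by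
      rw [(coff k hk n1 n2).2]; exact hx2 k hk n1 n2)
    have v2 := hxy κ₂ h2
    have q1 : y' κ₁ = y κ₁ := by
      rcases d1 with d1 | d1
      · grind
      · rw [show y' κ₂ = cp (c κ₂) by grind, c2, Sel.val_cp] at v2
        exact absurd p3 v2
    refine ⟨y', hy', q1, ?_, aj ▸ y1, fun k hk n1 n2 => hx' k n1 n2 ▸ hxy k hk⟩
    rcases d2 with d2 | d2 <;> grind
  have s1 := six_of_box h.right hj j1.symm j2.symm words
  have s2 := six_of_box h.left hj j1.symm j2.symm (s := cp (a κ₁)) (t := cp (b κ₂)) (r := a)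
    (by
      intro x hx
      obtain ⟨y', hy', y1, y2, y3, hxy⟩ := words x hx
      obtain ⟨x', hx', p1, p2, p3, p4⟩ := exists_upd_two x L.ne (s₁ := y κ₁) (t₁ := cp (a κ₁))
        (s₂ := y κ₂) (t₂ := cp (b κ₂)) (by grind) (by grind)
      have hx1 : ∀ k ∈ K, k ≠ κ₁ → k ≠ κ₂ → (x' k).val (a k) := fun k hk n1 n2 => by
        rw [hx' k n1 n2]; exact hx k hk n1 n2
      have hx2 : ∀ k ∈ K.erase j, k ≠ κ₁ → k ≠ κ₂ → (x' k).val (a k) := fun k hk =>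
        hx1 k (Finset.mem_of_mem_erase hk)
      rw [Sel.val_cp] at p2 p4
      have nA : ¬ Cov (K.erase j) (sl V j z) x' := by
        rw [covA]
        rintro (g | g)
        · exact p2 (g κ₁ L.mem₁)
        · exact p4 (la'₂ ▸ g κ₂ L.mem₂)
      have nB : ¬ Cov (K.erase j) (sl V j (cp z)) x' := by
        rw [covB]
        rintro (g | g)
        · exact p4 (g κ₂ L.mem₂)
        · exact p2 (lb'₁ ▸ g κ₁ L.mem₁)
      have hcW : Cov K W x' := ⟨y', hy', inn_of_off (κ₁ := κ₁) (κ₂ := κ₂) (r := y')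
        (fun k hk n1 n2 => hx' k n1 n2 ▸ hxy k hk n1 n2) (fun _ _ _ _ => rfl) (y1 ▸ p1) (y2 ▸ p3)⟩
      obtain ⟨f, hf, f1, f2, hxf⟩ := h.symm.exists_word hcW nA nB
      have d1 := h.left.dic_two hf ma' f1 f2 hxf (κ₁ := κ₁) (κ₂ := κ₂) (fun k hk n1 n2 => by
        rw [(L.off k hk n1 n2).1]; exact hx2 k hk n1 n2)
      have d2 := h.left.dic_two hf mb' (by rwa [ne_eq]) (by rwa [cp_cp]) hxf (κ₁ := κ₁) (κ₂ := κ₂)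
        (fun k hk n1 n2 => by rw [(L.off k hk n1 n2).2.2]; exact hx2 k hk n1 n2)
      have v1 := hxf κ₁ h1
      have v2 := hxf κ₂ h2
      have q2 : f κ₂ = cp (b κ₂) := by
        rcases d1 with d1 | d1
        · have : f κ₁ = a κ₁ := by grind
          rw [this] at v1
          exact absurd v1 p2
        · grind
      refine ⟨f, hf, ?_, q2, aj ▸ f1, fun k hk n1 n2 => hx' k n1 n2 ▸ hxf k hk⟩
      rcases d2 with d2 | d2 <;> grind)
  have c1 : 6 ≤ (sl W κ₁ (y κ₁)).card := s1.trans (Finset.card_le_card fun y hy => by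
    rw [Finset.mem_filter] at hy
    exact mem_sl.2 ⟨hy.1, hy.2.1⟩)
  have c2 : 7 ≤ (sl V κ₁ (cp (a κ₁))).card := by
    have hlt : (V.filter fun y => y κ₁ = cp (a κ₁) ∧ y κ₂ = cp (b κ₂) ∧ y j ≠ a j) ⊂
        sl V κ₁ (cp (a κ₁)) := by
      refine Finset.ssubset_iff_subset_ne.2 ⟨fun y hy => ?_, fun e => ?_⟩
      · rw [Finset.mem_filter] at hy
        exact mem_sl.2 ⟨hy.1, hy.2.1⟩
      · have : a' ∈ sl V κ₁ (cp (a κ₁)) := mem_sl.2 ⟨(mem_sl.1 ma').1, la'₁⟩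
        rw [← e, Finset.mem_filter] at this
        exact this.2.2.2 ((mem_sl.1 ma').2.trans aj.symm)
    have := Finset.card_lt_card hlt
    omega
  have := h.sum_two h1 (z := cp (a κ₁)) (m := cp (y κ₁)) (by grind) (by grind)
  rw [cp_cp (y κ₁)] at this
  omega

variable {I : Finset ι} {U : Finset (ι → S)} {i : ι} {s : S}

theorem Full.horizontal_false (h : Full I U i s) (hj : j ∈ I.erase i)
    (hA : (sl (sl U i s) j z).card = 2) (hB : (sl (sl U i s) j (cp z)).card = 2)
    (hC : (sl (sl U i (cp s)) j z).card = 3) (hE : (sl (sl U i (cp s)) j (cp z)).card ≤ 4)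
    {x₀ : ι → Sel S} (hD : DP (I.erase i) (sl U i s) (sl U i (cp s)) j z x₀) : False := by
  obtain ⟨o, x, oj, hxo, hxA, od⟩ := h.exists_env_both (z := z) hj (Finset.card_pos.1 (by omega)) (by rw [hB]; omega)
  have hp := h.eqPair
  have hle := h.le
  set K := I.erase i
  set V := sl U i s
  set W := sl U i (cp s)
  have cA := hp.left.sl j z
  have cB := hp.left.sl j (cp z)
  have cC := hp.right.sl j z
  have cE := hp.right.sl j (cp z)
  obtain ⟨y, hy, hyz, hyz', hyx⟩ := hp.exists_other hj hD.1 hD.2.2.1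
  have ty := hp.trEq hj hy hyz hyz'
  have ny := hp.left.noC_sl hj z
  have cy := ty.card_mt cA cB ny hyx hD.1
  have ly1 := card_mt_le (K.erase j) (sl V j z) y
  have ly2 := card_mt_le (K.erase j) (sl V j (cp z)) y
  have ey1 : mt (K.erase j) (sl V j z) y = sl V j z := mt_eq_of_card (by omega)
  have ey2 : mt (K.erase j) (sl V j (cp z)) y = sl V j (cp z) := mt_eq_of_card (by omega)
  obtain ⟨a, a', b, b', κ₁, κ₂, eA, eB, L⟩ := ty.exists_lForm cA cB
    (ey1 ▸ meets_mt _ _ _) (ey2 ▸ meets_mt _ _ _) ny hA hB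
  have ma : a ∈ sl V j z := by simp [eA]
  have ma' : a' ∈ sl V j z := by simp [eA]
  have mb : b ∈ sl V j (cp z) := by simp [eB]
  have mb' : b' ∈ sl V j (cp z) := by simp [eB]
  have aj := (mem_sl.1 ma).2
  have tr := hp.trEq_env hj oj od
  have no := hp.noC_sl hj z
  have co := tr.card_mt cA cC no hxo hxA
  have lo1 := card_mt_le (K.erase j) (sl V j z) o
  have lo2 := card_mt_le (K.erase j) (sl W j z) o
  have eo1 : mt (K.erase j) (sl V j z) o = sl V j z := mt_eq_of_card (by omega)
  have mo : Meets (K.erase j) (sl V j z) o := eo1 ▸ meets_mt _ _ _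
  obtain ⟨o1, o2⟩ := L.meets_eq (mo a ma) (mo a' ma')
    (dic_env oj (mem_sl.1 mb).2 (od b (Or.inl (mem_sl.1 mb).1)))
    (dic_env oj (mem_sl.1 mb').2 (od b' (Or.inl (mem_sl.1 mb').1)))
  have tr' := tr.mt
  rw [eo1] at tr'
  obtain ⟨c, c', ⟨mc, mc'⟩, c1, c2, c'1, c'2, coff⟩ := L.exists_swap (fun w => by simp [eA]) hA tr' cA
    (cC.mono (mt_subset _ _ o)) (no.mono (Finset.Subset.refl _) (mt_subset _ _ _)) mo
    (meets_mt _ _ _) (by omega) (by omega) o1 o2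
  replace mc := mt_subset (K.erase j) _ o mc
  replace mc' := mt_subset (K.erase j) _ o mc'
  exact hp.lForm_false hj (fun w => by simp [eA]) (fun w => by simp [eB]) L mc mc' c1 c2 c'1 c'2 coff hC
    hE hle

end Horizontal

section ClassSizes

variable {S : Type} [Cpl S] [Finite S] {ι : Type} [DecidableEq ι] [Fintype ι]

variable {I : Finset ι} {U : Finset (ι → S)} {i j : ι} {s z : S}

theorem Full.card_erase (h : Full I U i s) : (I.erase i).card ≤ 6 := by
  have := h.card
  rw [Finset.card_erase_of_mem h.mem]
  omega

theorem Full.exists_dp (h : Full I U i s) (hj : j ∈ I.erase i)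
    (hp : (sl (sl U i s) j z).card + (sl (sl U i (cp s)) j (cp z)).card ≤ 6)
    (hne : 1 ≤ (sl (sl U i s) j z).card + (sl (sl U i (cp s)) j (cp z)).card) :
    (∃ x, DP (I.erase i) (sl U i s) (sl U i (cp s)) j z x) ∧
      ∃ x, DP (I.erase i) (sl U i (cp s)) (sl U i s) j z x := by
  have e := h.eqPair
  have hs := e.card_sl hj z
  have hor := e.exists_dp hj (by omega) hne
  by_contra hcon
  by_cases hD : ∃ x, DP (I.erase i) (sl U i s) (sl U i (cp s)) j z x
  · have hD' : ∀ x, ¬ DP (I.erase i) (sl U i (cp s)) (sl U i s) j z x := fun x hx => hcon ⟨hD, x, hx⟩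
    obtain ⟨h1, h2, h3, h4⟩ := e.rigid_sizes hj hp hD hD'
    obtain ⟨c, hc⟩ := Finset.card_eq_one.1 h3
    obtain ⟨d, hd⟩ := Finset.card_eq_one.1 h4
    exact h.not_rig ⟨e, hj, h1, h2, hc, hd, hD'⟩
  · have hD' := hor.resolve_left hD
    push Not at hD
    obtain ⟨h1, h2, h3, h4⟩ := e.symm.rigid_sizes hj (by omega) hD' hD
    obtain ⟨c, hc⟩ := Finset.card_eq_one.1 h3
    obtain ⟨d, hd⟩ := Finset.card_eq_one.1 h4
    have := h.symm.not_rig (z := z) (j := j) (c := c) (e := d)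
    rw [cp_cp] at this
    exact this ⟨e.symm, hj, h1, h2, hc, hd, hD⟩

theorem Full.two_le (h : Full I U i s) (hj : j ∈ I.erase i)
    (hp : (sl (sl U i s) j z).card + (sl (sl U i (cp s)) j (cp z)).card ≤ 6)
    (hne : 1 ≤ (sl (sl U i s) j z).card + (sl (sl U i (cp s)) j (cp z)).card) :
    2 ≤ (sl (sl U i s) j z).card ∧ 2 ≤ (sl (sl U i s) j (cp z)).card ∧
      2 ≤ (sl (sl U i (cp s)) j z).card ∧ 2 ≤ (sl (sl U i (cp s)) j (cp z)).card :=
  h.eqPair.two_le_sizes hj h.card_erase hp (h.exists_dp hj hp hne).1 (h.exists_dp hj hp hne).2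

theorem Full.six_le (h : Full I U i s) (hj : j ∈ I.erase i)
    (hne : 1 ≤ (sl (sl U i s) j z).card + (sl (sl U i (cp s)) j (cp z)).card) :
    6 ≤ (sl (sl U i s) j z).card + (sl (sl U i (cp s)) j (cp z)).card := by
  by_contra! hlt
  obtain ⟨h1, h2, h3, h4⟩ := h.two_le hj (z := z) (by omega) hne
  obtain ⟨⟨x, hx⟩, x', hx'⟩ := h.exists_dp hj (z := z) (by omega) hne
  have hs := h.eqPair.card_sl hj z
  have n1 := h.vertical_false hj (z := z)
  have n2 := h.vertical_false hj (z := cp z)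
  have n3 := h.horizontal_false hj (z := z)
  have n4 := h.symm.horizontal_false hj (z := z)
  rw [cp_cp] at n2 n4
  by_cases a : (sl (sl U i s) j z).card = 2
  · by_cases c : (sl (sl U i (cp s)) j z).card = 2
    · exact n1 a c (by omega)
    · exact n3 a (by omega) (by omega) (by omega) hx
  · by_cases b : (sl (sl U i s) j (cp z)).card = 2
    · exact n2 b (by omega) (by omega)
    · exact n4 (by omega) (by omega) (by omega) (by omega) hx'

theorem Full.six_le_left (h : Full I U i s) (hj : j ∈ I.erase i) {v : ι → S} (hv : v ∈ sl U i s) :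
    6 ≤ (sl (sl U i s) j (v j)).card + (sl (sl U i (cp s)) j (cp (v j))).card :=
  h.six_le hj (by have := h.eqPair.four_le hj hv; omega)

theorem Full.six_le_right (h : Full I U i s) (hj : j ∈ I.erase i) {w : ι → S}
    (hw : w ∈ sl U i (cp s)) :
    6 ≤ (sl (sl U i s) j (w j)).card + (sl (sl U i (cp s)) j (cp (w j))).card :=
  h.six_le hj (by have := h.eqPair.four_le_right hj hw; omega)

end ClassSizes

section ActiveCoordinates

variable {S : Type} [Cpl S] [Finite S] {ι : Type} [DecidableEq ι] [Fintype ι]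

variable {I : Finset ι} {U : Finset (ι → S)} {i j : ι} {s z m : S}

/-- A coordinate at which two classes of letters occur. -/
structure Act (I : Finset ι) (U : Finset (ι → S)) (i : ι) (s : S) (j : ι) (z m : S) : Prop where
  full : Full I U i s
  mem : j ∈ I.erase i
  ne : m ≠ z
  ne' : m ≠ cp z
  card_z : (sl (sl U i s) j z).card + (sl (sl U i (cp s)) j (cp z)).card = 6
  card_m : (sl (sl U i s) j m).card + (sl (sl U i (cp s)) j (cp m)).card = 6

theorem Full.act_of_pos (h : Full I U i s) (hj : j ∈ I.erase i) (h1 : m ≠ z) (h2 : m ≠ cp z)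
    (hz : 1 ≤ (sl (sl U i s) j z).card + (sl (sl U i (cp s)) j (cp z)).card)
    (hm : 1 ≤ (sl (sl U i s) j m).card + (sl (sl U i (cp s)) j (cp m)).card) :
    Act I U i s j z m := by
  have e1 := h.six_le hj hz
  have e2 := h.six_le hj hm
  have e3 := h.eqPair.sum_two hj h1 h2
  have := h.le
  exact ⟨h, hj, h1, h2, by omega, by omega⟩

theorem Full.pos (h : Full I U i s) (hj : j ∈ I.erase i) {v : ι → S}
    (hv : v ∈ sl U i s ∨ v ∈ sl U i (cp s)) :
    1 ≤ (sl (sl U i s) j (v j)).card + (sl (sl U i (cp s)) j (cp (v j))).card := by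
  rcases hv with hv | hv
  · have := h.six_le_left hj hv
    omega
  · have := h.six_le_right hj hv
    omega

theorem Full.act (h : Full I U i s) (hj : j ∈ I.erase i) {v w : ι → S}
    (hv : v ∈ sl U i s ∨ v ∈ sl U i (cp s)) (hw : w ∈ sl U i s ∨ w ∈ sl U i (cp s))
    (h1 : w j ≠ v j) (h2 : w j ≠ cp (v j)) : Act I U i s j (v j) (w j) :=
  h.act_of_pos hj h1 h2 (h.pos hj hv) (h.pos hj hw)

theorem Act.swap (h : Act I U i s j z m) : Act I U i s j m z :=
  ⟨h.full, h.mem, h.ne.symm, fun e => h.ne' (by rw [e, cp_cp]), h.card_m, h.card_z⟩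

theorem Act.flip (h : Act I U i s j z m) : Act I U i s j (cp z) m :=
  ⟨h.full, h.mem, h.ne', by rw [cp_cp]; exact h.ne,
    by have := h.full.eqPair.card_sl h.mem z; have := h.card_z; rw [cp_cp]; omega, h.card_m⟩

theorem Act.symm (h : Act I U i s j z m) : Act I U i (cp s) j z m :=
  ⟨h.full.symm, h.mem, h.ne, h.ne',
    by have := h.full.eqPair.card_sl h.mem z; have := h.card_z; rw [cp_cp]; omega,
    by have := h.full.eqPair.card_sl h.mem m; have := h.card_m; rw [cp_cp]; omega⟩

theorem Act.letters (h : Act I U i s j z m) {v : ι → S} (hv : v ∈ sl U i s ∨ v ∈ sl U i (cp s)) :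
    v j = z ∨ v j = cp z ∨ v j = m ∨ v j = cp m := by
  have h1 := h.card_z
  have h2 := h.card_m
  have h3 := h.full.le
  rcases hv with hv | hv
  · exact h.full.eqPair.letters_left h.mem h.ne h.ne' (by omega) hv
  · exact h.full.eqPair.letters_right h.mem h.ne h.ne' (by omega) hv

theorem Act.two_le (h : Act I U i s j z m) :
    2 ≤ (sl (sl U i s) j z).card ∧ 2 ≤ (sl (sl U i s) j (cp z)).card ∧
      2 ≤ (sl (sl U i (cp s)) j z).card ∧ 2 ≤ (sl (sl U i (cp s)) j (cp z)).card :=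
  h.full.two_le h.mem h.card_z.le (by rw [h.card_z]; norm_num)

theorem Act.le_four (h : Act I U i s j z m) :
    (sl (sl U i s) j z).card ≤ 4 ∧ (sl (sl U i s) j (cp z)).card ≤ 4 ∧
      (sl (sl U i (cp s)) j z).card ≤ 4 ∧ (sl (sl U i (cp s)) j (cp z)).card ≤ 4 := by
  have := h.two_le
  have := h.full.eqPair.card_sl h.mem z
  have := h.card_z
  omega

theorem Act.exists_dp (h : Act I U i s j z m) :
    (∃ x, DP (I.erase i) (sl U i s) (sl U i (cp s)) j z x) ∧
      ∃ x, DP (I.erase i) (sl U i (cp s)) (sl U i s) j z x :=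
  h.full.exists_dp h.mem h.card_z.le (by rw [h.card_z]; norm_num)

/-- A letter occurring often occurs always. -/
theorem Full.const_of_not_act (h : Full I U i s) (hj : j ∈ I.erase i)
    (hn : ∀ m, ¬ Act I U i s j z m) {v : ι → S} (hv : v ∈ sl U i s ∨ v ∈ sl U i (cp s))
    (hz : v j = z) {w : ι → S} (hw : w ∈ sl U i s ∨ w ∈ sl U i (cp s)) : w j = z := by
  have e := h.eqPair
  have hle := h.le
  have key : ∀ w, w ∈ sl U i s ∨ w ∈ sl U i (cp s) → w j = z ∨ w j = cp z := fun w hw => by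
    by_contra! hc
    exact hn (w j) (hz ▸ h.act hj hv hw (hz ▸ hc.1) (hz ▸ hc.2))
  have n1 : ∀ x, ¬ DP (I.erase i) (sl U i s) (sl U i (cp s)) j z x := fun x hx => by
    obtain ⟨y, hy, h1, h2, -⟩ := e.exists_other hj hx.1 hx.2.2.1
    exact (key y (Or.inr hy)).elim h1 h2
  have n2 : ∀ x, ¬ DP (I.erase i) (sl U i (cp s)) (sl U i s) j z x := fun x hx => by
    obtain ⟨y, hy, h1, h2, -⟩ := e.symm.exists_other hj hx.1 hx.2.2.1
    exact (key y (Or.inl hy)).elim h1 h2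
  have hc := fun x => ((e.cases hj z x).resolve_left (n1 x)).resolve_left (n2 x)
  have p1 := e.of_slices hj fun x => (hc x).1
  have p2 := e.of_slices (z := cp z) hj fun x => (hc x).2
  have hs : (sl (sl U i s) j z).card + (sl (sl U i s) j (cp z)).card ≤ (sl U i s).card :=
    card_sl_two _ _ (ne_cp z)
  have m1 : (sl (sl U i s) j z).Nonempty := by
    rcases hv with hv | hv
    · exact ⟨v, mem_sl.2 ⟨hv, hz⟩⟩
    · exact p1.symm.nonempty ⟨v, mem_sl.2 ⟨hv, hz⟩⟩
  have c1 := p1.eight_le m1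
  refine (key w hw).resolve_right fun hwz => ?_
  have m2 : (sl (sl U i s) j (cp z)).Nonempty := by
    rcases hw with hw | hw
    · exact ⟨w, mem_sl.2 ⟨hw, hwz⟩⟩
    · exact p2.symm.nonempty ⟨w, mem_sl.2 ⟨hw, hwz⟩⟩
  have c2 := p2.eight_le m2
  omega

theorem Full.const_of_five (h : Full I U i s) (hj : j ∈ I.erase i)
    (h5 : 5 ≤ (sl (sl U i s) j z).card) {w : ι → S} (hw : w ∈ sl U i s ∨ w ∈ sl U i (cp s)) :
    w j = z := by
  obtain ⟨v, hv⟩ := Finset.card_pos.1 (by omega : 0 < (sl (sl U i s) j z).card)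
  refine h.const_of_not_act hj (fun m hm => ?_) (Or.inl (mem_sl.1 hv).1) (mem_sl.1 hv).2 hw
  have := hm.le_four
  omega

end ActiveCoordinates

section PairKill

variable {S : Type} [Cpl S] [Finite S] {ι : Type} [DecidableEq ι] [Fintype ι]

variable {I : Finset ι} {U : Finset (ι → S)} {i j : ι} {s z m : S}

/-- A word crossing two complementary slices. -/
theorem Act.exists_cross (h : Act I U i s j z m) :
    ∃ a ∈ sl (sl U i s) j z, ∃ y ∈ sl U i (cp s), y j ≠ z ∧ y j ≠ cp z ∧
      ¬ Dic ((I.erase i).erase j) a y := by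
  obtain ⟨⟨x, hx⟩, -⟩ := h.exists_dp
  obtain ⟨y, hy, h1, h2, hxy⟩ := h.full.eqPair.exists_other h.mem hx.1 hx.2.2.1
  obtain ⟨a, ha, hxa⟩ := hx.1
  exact ⟨a, ha, y, hy, h1, h2, not_dic_of_inn hxa hxy⟩

/-- The letters of a crossing word make the coordinate active. -/
theorem Act.of_cross (h : Act I U i s j z m) {y : ι → S} (hy : y ∈ sl U i (cp s)) (h1 : y j ≠ z)
    (h2 : y j ≠ cp z) : Act I U i s j z (y j) :=
  h.full.act_of_pos h.mem h1 h2 (by rw [h.card_z]; norm_num) (h.full.pos h.mem (Or.inr hy))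

theorem Act.card_traces (h : Act I U i s j z m) {a y : ι → S} (ha : a ∈ sl (sl U i s) j z)
    (hy : y ∈ sl U i (cp s)) (h1 : y j ≠ z) (h2 : y j ≠ cp z)
    (hd : ¬ Dic ((I.erase i).erase j) a y) :
    2 ≤ (mt ((I.erase i).erase j) (sl (sl U i s) j z) y).card ∧
    2 ≤ (mt ((I.erase i).erase j) (sl (sl U i s) j (cp z)) y).card := by
  have hp := h.full.eqPair
  obtain ⟨x, hxa, hxy⟩ := exists_inn_two hd
  have c := (hp.trEq h.mem hy h1 h2).card_mt (hp.left.sl j z) (hp.left.sl j (cp z))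
    (hp.left.noC_sl h.mem z) hxy ⟨a, ha, hxa⟩
  have l1 := card_mt_le ((I.erase i).erase j) (sl (sl U i s) j z) y
  have l2 := card_mt_le ((I.erase i).erase j) (sl (sl U i s) j (cp z)) y
  have := h.le_four
  omega

theorem Act.card_traces' (h : Act I U i s j z m) {a y : ι → S} (ha : a ∈ sl (sl U i s) j z)
    (hy : y ∈ sl U i (cp s)) (h1 : y j ≠ z) (h2 : y j ≠ cp z)
    (hd : ¬ Dic ((I.erase i).erase j) a y) :
    2 ≤ (mt ((I.erase i).erase j) (sl (sl U i (cp s)) j (y j)) a).card ∧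
    2 ≤ (mt ((I.erase i).erase j) (sl (sl U i (cp s)) j (cp (y j))) a).card := by
  have g := (h.of_cross hy h1 h2).swap.symm
  obtain ⟨ha, e⟩ := mem_sl.1 ha
  exact g.card_traces (a := y) (y := a) (mem_sl.2 ⟨hy, rfl⟩) (by rwa [cp_cp])
    (by rw [e]; exact h1.symm) (by rw [e]; exact fun e => h2 (by rw [e, cp_cp]))
    fun e => hd e.symm

/-- An L-form is determined by its two pairs of words. -/
theorem LForm.unique {K : Finset ι} {A B : Finset (ι → S)} {a a' b b' y w : ι → S} {κ₁ κ₂ : ι}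
    (L : LForm K a a' b b' y κ₁ κ₂) (mA : ∀ v, v ∈ A ↔ v = a ∨ v = a') (hA2 : A.card = 2)
    (mb : b ∈ B) (mb' : b' ∈ B) (hB3 : B.card ≤ 3) (hA : IsCode K A) (hB : IsCode K B)
    (hno : NoC K A B) (t : TrEq K A B w) (hm : Meets K A w) (h2 : 2 ≤ (Keller.mt K B w).card) :
    w κ₁ = y κ₁ ∧ w κ₂ = y κ₂ := by
  have eq2 : ∀ {g g' : ι → S}, g ∈ A → g' ∈ A → ∀ k ∈ K, g k ≠ g' k → k = κ₁ ∨ k = κ₂ := by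
    intro g g' hg hg' k hk hn
    rw [mA] at hg hg'
    by_contra! hh
    have := (L.off k hk hh.1 hh.2).1
    rcases hg with rfl | rfl <;> rcases hg' with rfl | rfl <;> grind
  have tm := t.mt
  rw [mt_eq_of_card (A := A) (Finset.card_le_card fun v hv => mem_mt.2 ⟨hv, hm v hv⟩)] at tm
  have sB := mt_subset K B w
  have lB := card_mt_le K B w
  have cB := hB.mono sB
  have nB := hno.mono (Finset.Subset.refl _) sB
  rcases (by omega : (mt K B w).card = 2 ∨ (mt K B w).card = 3) with h | h
  · obtain ⟨g, g', d, d', μ₁, μ₂, eA, eC, M⟩ := tm.exists_lForm hA cB hm (meets_mt _ _ _) nB hA2 h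
    have mg : g ∈ A := by simp [eA]
    have mg' : g' ∈ A := by simp [eA]
    have md : d ∈ B := sB (by simp [eC])
    have md' : d' ∈ B := sB (by simp [eC])
    have hd := eq2 mg mg'
    have m1 := M.a'₁
    have hgg : g ≠ g' := fun e => by
      rw [← e] at m1
      exact ne_cp _ m1
    have d1 := hd μ₁ M.mem₁ (by rw [m1]; exact ne_cp _)
    have d2 := hd μ₂ M.mem₂ (by rw [M.a₂, M.a'₂]; exact M.b₂.symm)
    have hg := (mA _).1 mg
    have hg' := (mA _).1 mg'
    have hh : (g = a ∧ g' = a') ∨ (g = a' ∧ g' = a) := by grind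
    have l1 := L.a₂
    have l2 := L.a'₂
    have l3 := L.b₂
    have l4 := L.b₂'
    have l5 := L.a'₁
    have e1 : μ₁ = κ₁ := by
      rcases d1 with d1 | d1
      · exact d1
      · rw [d1] at m1
        rcases hh with ⟨rfl, rfl⟩ | ⟨rfl, rfl⟩ <;> grind
    have e2 : μ₂ = κ₂ := by
      rcases d2 with d2 | d2
      · exact absurd (e1.trans d2.symm) M.ne
      · exact d2
    subst e1 e2
    have m2 := M.a₂
    have m3 := M.a'₂
    have m4 := M.b₁
    have m5 := M.b'₁
    have m6 := M.b'₂
    have l6 := L.b₁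
    have l7 := L.b'₁
    have l8 := L.b'₂
    rcases hh with ⟨rfl, rfl⟩ | ⟨rfl, rfl⟩
    · refine ⟨?_, by rw [← m2, l1]⟩
      by_contra hne
      have hbd : b ≠ d := fun e => hne (by rw [← m4, ← l6, e])
      obtain ⟨⟨k, hk, e⟩, hT⟩ := hB b mb d md hbd
      have eoff : ∀ k ∈ K, k ≠ μ₁ → k ≠ μ₂ → d k = b k := fun k hk n1 n2 => by
        rw [(M.off k hk n1 n2).2.1, (L.off k hk n1 n2).2.1]
      have e2 : d μ₂ = b μ₂ := by rw [← m3, l2]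
      have e1 : k = μ₁ := by
        by_contra n1
        by_cases n2 : k = μ₂
        · subst n2
          exact ne_cp _ (e2.symm.trans e)
        · exact ne_cp _ ((eoff k hk n1 n2).symm.trans e)
      subst e1
      refine hT ⟨k, hk, e, fun k' hk' n1 => ?_⟩
      by_cases n2 : k' = μ₂
      · rw [n2, e2]
      · exact eoff k' hk' n1 n2
    · exfalso
      have n1 : d ≠ b := fun e => by rw [e] at m3; exact l3 (m3.symm.trans l1)
      have n2 : d ≠ b' := fun e => by rw [e] at m3; grind
      have n3 : d' ≠ b := fun e => by rw [e] at m6; grind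
      have n4 : d' ≠ b' := fun e => by rw [e] at m6; grind
      have n5 : d ≠ d' := fun e => by rw [e] at m6; exact cp_ne _ m6.symm
      have n6 : b ≠ b' := fun e => by rw [e] at l8; exact cp_ne _ l8.symm
      have : ({b, b', d, d'} : Finset (ι → S)) ⊆ B := fun v hv => by
        simp only [Finset.mem_insert, Finset.mem_singleton] at hv
        rcases hv with rfl | rfl | rfl | rfl <;> assumption
      have := Finset.card_le_card this
      rw [Finset.card_insert_of_notMem, Finset.card_insert_of_notMem,
        Finset.card_insert_of_notMem, Finset.card_singleton] at this
      · omega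
      all_goals simp only [Finset.mem_insert, Finset.mem_singleton]; grind
  · obtain ⟨g, g', b₀, b₁, b₂, μ₁, μ₂, μ₃, eA, -, M | M⟩ :=
      tm.exists_hForm hA cB hm (meets_mt _ _ _) nB hA2 h
    all_goals
      have hd := eq2 (g := g) (g' := g') (by simp [eA]) (by simp [eA])
      have d1 := hd μ₁ M.mem₁ (by rw [M.a'_1]; exact ne_cp _)
      have d2 := hd μ₂ M.mem₂ (by have := M.b₀_2; have := M.a_2; have := M.a'_2; grind)
      have d3 := hd μ₃ M.mem₃ (by have := M.b₀_3; have := M.a_3; have := M.a'_3; grind)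
      have := M.ne₁₂
      have := M.ne₁₃
      have := M.ne₂₃
      grind

theorem Act.exists_corner (h : Act I U i s j z m) {a a' b b' y y₀ : ι → S} {κ₁ κ₂ k : ι}
    (mA : ∀ v, v ∈ sl (sl U i s) j z ↔ v = a ∨ v = a') (mb : b ∈ sl (sl U i s) j (cp z))
    (mb' : b' ∈ sl (sl U i s) j (cp z)) (L : LForm ((I.erase i).erase j) a a' b b' y₀ κ₁ κ₂)
    (hy : y ∈ sl U i (cp s)) (h1 : y j ≠ z) (h2 : y j ≠ cp z)
    (hd : ¬ Dic ((I.erase i).erase j) a y) (e1 : y κ₁ = y₀ κ₁) (e2 : y κ₂ = y₀ κ₂)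
    (hk : k ∈ (I.erase i).erase j) (n1 : k ≠ κ₁) (n2 : k ≠ κ₂) (k1 : y k ≠ a k)
    (k2 : y k ≠ cp (a k)) :
    ∃ f ∈ sl (sl U i s) j (y j), f κ₁ = cp (a κ₁) ∧ f k = y k := by
  have hp := h.full.eqPair
  have hj := h.mem
  obtain ⟨kj, hkK⟩ := Finset.mem_erase.1 hk
  have ma : a ∈ sl (sl U i s) j z := (mA _).2 (Or.inl rfl)
  have ma' : a' ∈ sl (sl U i s) j z := (mA _).2 (Or.inr rfl)
  obtain ⟨va, aj⟩ := mem_sl.1 ma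
  have la₁' := L.a₁'
  have la'₁ := L.a'₁
  have la₂ := L.a₂
  have la'₂ := L.a'₂
  have lb'₁ := L.b'₁
  have lb'₂ := L.b'₂
  have lb₂ := L.b₂
  have lb₂' := L.b₂'
  obtain ⟨x₀, hxa, hxy⟩ := exists_inn_two hd
  obtain ⟨ω, hω, -⟩ := exists_sel_two (ne_cp (y j))
  obtain ⟨x, hx, p1, p2, p3, p4⟩ := exists_upd_two (Function.update x₀ j ω) L.ne (s₁ := y κ₁)
    (t₁ := cp (a κ₁)) (s₂ := y κ₂) (t₂ := cp (b κ₂)) (by have := L.a₁; grind) (by grind)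
  have j1 := (Finset.mem_erase.1 L.mem₁)
  have j2 := (Finset.mem_erase.1 L.mem₂)
  have xj : x j = ω := by rw [hx j j1.1.symm j2.1.symm, Function.update_self]
  have xk : ∀ k ∈ (I.erase i).erase j, k ≠ κ₁ → k ≠ κ₂ → (x k).val (a k) ∧ (x k).val (y k) := by
    intro k hk n1 n2
    rw [hx k n1 n2, Function.update_of_ne (Finset.ne_of_mem_erase hk)]
    exact ⟨hxa k hk, hxy k hk⟩
  have hxy' : Inn ((I.erase i).erase j) x y :=
    inn_of_off (fun k hk n1 n2 => (xk k hk n1 n2).2) (fun _ _ _ _ => rfl) p1 p3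
  have hxyK : Inn (I.erase i) x y := (inn_iff_erase hj).2 ⟨by rw [xj]; exact hω, hxy'⟩
  rw [Sel.val_cp] at p2 p4
  have nA : ¬ Cov ((I.erase i).erase j) (sl (sl U i s) j z) x := by
    rintro ⟨v, hv, hxv⟩
    rcases (mA _).1 hv with rfl | rfl
    · exact p2 (hxv κ₁ L.mem₁)
    · exact p4 (la'₂ ▸ hxv κ₂ L.mem₂)
  have nB := fun hc => nA ((hp.trEq hj hy h1 h2 x hxy').2 hc)
  obtain ⟨f, hf, f1, f2, hxf⟩ := hp.symm.exists_word ⟨y, hy, hxyK⟩ nA nB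
  have d1 := hp.left.dic_two hf ma' f1 f2 hxf (κ₁ := κ₁) (κ₂ := κ₂) (fun k hk n1 n2 => by
    rw [(L.off k hk n1 n2).1]; exact (xk k hk n1 n2).1)
  have d2 := hp.left.dic_two hf mb' f2 (by rwa [cp_cp]) hxf (κ₁ := κ₁) (κ₂ := κ₂)
    (fun k hk n1 n2 => by rw [(L.off k hk n1 n2).2.2]; exact (xk k hk n1 n2).1)
  have v1 := hxf κ₁ j1.2
  have v2 := hxf κ₂ j2.2
  have q2 : f κ₂ = cp (b κ₂) := by
    rcases d1 with d1 | d1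
    · rw [show f κ₁ = a κ₁ by grind] at v1
      exact absurd v1 p2
    · grind
  have q1 : f κ₁ = cp (a κ₁) := by
    rcases d2 with d2 | d2
    · grind
    · rw [show f κ₂ = b κ₂ by grind] at v2
      exact absurd v2 p4
  have fj : f j = y j := by
    rcases (h.of_cross hy h1 h2).letters (Or.inl hf) with e | e | e | e
    · exact absurd e f1
    · exact absurd e f2
    · exact e
    · have := hxf j hj
      rw [e, Sel.val_cp, xj] at this
      exact absurd hω this
  refine ⟨f, mem_sl.2 ⟨hf, fj⟩, q1, ?_⟩
  have hact := h.full.act hkK (Or.inl va) (Or.inr hy) k1 k2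
  have vk := hxf k hkK
  obtain ⟨v3, v4⟩ := xk k hk n1 n2
  rcases hact.letters (Or.inl hf) with e | e | e | e
  · exfalso
    have hle := hact.le_four.1
    have o := L.off k hk n1 n2
    have vb := mem_sl.1 mb
    have vb' := mem_sl.1 mb'
    have va' := mem_sl.1 ma'
    have n12 : a ≠ a' := fun e => by rw [← e] at la'₁; exact ne_cp _ la'₁
    have n34 : b ≠ b' := fun e => by rw [← e] at lb'₂; exact ne_cp _ lb'₂
    have zc := ne_cp z
    have : ({a, a', b, b', f} : Finset (ι → S)) ⊆ sl (sl U i s) k (a k) := fun v hv => by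
      simp only [Finset.mem_insert, Finset.mem_singleton] at hv
      rcases hv with rfl | rfl | rfl | rfl | rfl
      · exact mem_sl.2 ⟨va, rfl⟩
      · exact mem_sl.2 ⟨va'.1, o.1⟩
      · exact mem_sl.2 ⟨vb.1, o.2.1⟩
      · exact mem_sl.2 ⟨vb'.1, o.2.2⟩
      · exact mem_sl.2 ⟨hf, e⟩
    have := Finset.card_le_card this
    rw [Finset.card_insert_of_notMem, Finset.card_insert_of_notMem,
      Finset.card_insert_of_notMem, Finset.card_insert_of_notMem, Finset.card_singleton] at this
    · omega
    all_goals simp only [Finset.mem_insert, Finset.mem_singleton]; grind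
  · rw [e, Sel.val_cp] at vk
    exact absurd v3 vk
  · exact e
  · rw [e, Sel.val_cp] at vk
    exact absurd v4 vk

theorem Act.exists_corner_two (h : Act I U i s j z m) {a a' b b' y₀ : ι → S} {κ₁ κ₂ : ι}
    (mA : ∀ v, v ∈ sl (sl U i s) j z ↔ v = a ∨ v = a') (mb : b ∈ sl (sl U i s) j (cp z))
    (mb' : b' ∈ sl (sl U i s) j (cp z)) (L : LForm ((I.erase i).erase j) a a' b b' y₀ κ₁ κ₂)
    {t : S} {Y : Finset (ι → S)} (hY : Y ⊆ sl (sl U i (cp s)) j t) (hY2 : 2 ≤ Y.card)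
    (h1 : t ≠ z) (h2 : t ≠ cp z)
    (hd : ∀ y ∈ Y, ¬ Dic ((I.erase i).erase j) a y ∧ y κ₁ = y₀ κ₁ ∧ y κ₂ = y₀ κ₂) :
    ∃ f ∈ sl (sl U i s) j t, ∃ f' ∈ sl (sl U i s) j t, f ≠ f' ∧ f κ₁ = cp (a κ₁) ∧
      f' κ₁ = cp (a κ₁) := by
  obtain ⟨y, hy, y', hy', hne⟩ := Finset.one_lt_card.1 hY2
  obtain ⟨k, hk, e⟩ := (h.full.eqPair.right.sl j t y (hY hy) y' (hY hy') hne).1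
  obtain ⟨d1, d2, d3⟩ := hd y hy
  obtain ⟨d1', d2', d3'⟩ := hd y' hy'
  obtain ⟨wy, ey⟩ := mem_sl.1 (hY hy)
  obtain ⟨wy', ey'⟩ := mem_sl.1 (hY hy')
  have n1 : k ≠ κ₁ := fun g => by subst g; rw [d2, d2'] at e; exact ne_cp _ e
  have n2 : k ≠ κ₂ := fun g => by subst g; rw [d3, d3'] at e; exact ne_cp _ e
  have k2 : y k ≠ cp (a k) := fun g => d1 ⟨k, hk, g⟩
  have k2' : y' k ≠ cp (a k) := fun g => d1' ⟨k, hk, g⟩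
  have k1 : y k ≠ a k := fun g => k2' (by rw [e, g])
  have k1' : y' k ≠ a k := fun g => k2 (by rw [← g, e, cp_cp])
  obtain ⟨f, hf, f1, fk⟩ := h.exists_corner mA mb mb' L wy (ey ▸ h1) (ey ▸ h2) d1 d2 d3 hk n1 n2 k1 k2
  obtain ⟨f', hf', f1', fk'⟩ :=
    h.exists_corner mA mb mb' L wy' (ey' ▸ h1) (ey' ▸ h2) d1' d2' d3' hk n1 n2 k1' k2'
  rw [ey] at hf
  rw [ey'] at hf'
  exact ⟨f, hf, f', hf', fun g => ne_cp (y k) (by rw [← e, ← fk', ← g, fk]), f1, f1'⟩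

theorem HForm.letter {K : Finset ι} {a a' b₀ b₁ b₂ y : ι → S} {κ₁ κ₂ κ₃ k : ι}
    (H : HForm K a a' b₀ b₁ b₂ y κ₁ κ₂ κ₃ ∨ HForm' K a a' b₀ b₁ b₂ y κ₁ κ₂ κ₃) (hk : k ∈ K) :
    (a k = y k ∨ a' k = y k ∨ b₀ k = y k) ∨
      (a' k = a k ∧ b₀ k = a k ∧ b₁ k = a k ∧ b₂ k = a k) := by
  by_cases n1 : k = κ₁
  · rcases H with H | H <;> exact Or.inl (Or.inr (Or.inr (n1 ▸ H.b₀_1)))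
  by_cases n2 : k = κ₂
  · rcases H with H | H
    · exact Or.inl (Or.inl (n2 ▸ H.a_2))
    · exact Or.inl (Or.inr (Or.inl (n2 ▸ H.a'_2)))
  by_cases n3 : k = κ₃
  · rcases H with H | H <;> exact Or.inl (Or.inr (Or.inl (n3 ▸ H.a'_3)))
  · rcases H with H | H <;> exact Or.inr (H.off k hk n1 n2 n3)

/-- A slice at an active coordinate has at least three words. -/
theorem Act.three_le (h : Act I U i s j z m) : 3 ≤ (sl (sl U i s) j z).card := by
  by_contra hlt
  have hp := h.full.eqPair
  have hj := h.mem
  have hA : (sl (sl U i s) j z).card = 2 := by have := h.two_le; omega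
  have hB : (sl (sl U i s) j (cp z)).card ≤ 3 := by
    have := h.two_le
    have := h.full.vertical_false hj hA
    have := h.full.eqPair.card_sl hj z
    have := h.card_z
    have := h.le_four
    by_contra hc
    exact h.full.vertical_false hj hA (by omega) (by omega)
  obtain ⟨a₀, ha₀, w₀, hw₀, o1, o2, hd₀⟩ := h.exists_cross
  obtain ⟨hI, hJ⟩ := h.card_traces' ha₀ hw₀ o1 o2 hd₀
  have cA := hp.left.sl j z
  have cB := hp.left.sl j (cp z)
  have no := hp.left.noC_sl hj z
  have meet : ∀ y ∈ sl U i (cp s), y j ≠ z → y j ≠ cp z → ¬ Dic ((I.erase i).erase j) a₀ y →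
      Meets ((I.erase i).erase j) (sl (sl U i s) j z) y ∧
        2 ≤ (mt ((I.erase i).erase j) (sl (sl U i s) j (cp z)) y).card := by
    intro y hy h1 h2 hd
    obtain ⟨t1, t2⟩ := h.card_traces ha₀ hy h1 h2 hd
    refine ⟨?_, t2⟩
    have := meets_mt ((I.erase i).erase j) (sl (sl U i s) j z) y
    rwa [mt_eq_of_card (by omega)] at this
  have mt_word : ∀ {t : S} {y : ι → S}, t = w₀ j ∨ t = cp (w₀ j) →
      y ∈ mt ((I.erase i).erase j) (sl (sl U i (cp s)) j t) a₀ → y ∈ sl U i (cp s) ∧ y j ≠ z ∧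
        y j ≠ cp z ∧ ¬ Dic ((I.erase i).erase j) a₀ y := by
    intro t y ht hy
    obtain ⟨hy, hdy⟩ := mem_mt.1 hy
    obtain ⟨hy, ey⟩ := mem_sl.1 hy
    exact ⟨hy, by grind, by grind, fun g => hdy g.symm⟩
  by_cases hL : ∃ y ∈ sl U i (cp s), y j ≠ z ∧ y j ≠ cp z ∧ ¬ Dic ((I.erase i).erase j) a₀ y ∧
      (mt ((I.erase i).erase j) (sl (sl U i s) j (cp z)) y).card = 2
  · obtain ⟨y₀, hy₀, h1, h2, hd, hc⟩ := hL
    obtain ⟨m0, -⟩ := meet y₀ hy₀ h1 h2 hd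
    have tm := (hp.trEq hj hy₀ h1 h2).mt
    rw [mt_eq_of_card (A := sl (sl U i s) j z) (Finset.card_le_card fun v hv => mem_mt.2 ⟨hv, m0 v hv⟩)]
      at tm
    have sB := mt_subset ((I.erase i).erase j) (sl (sl U i s) j (cp z)) y₀
    obtain ⟨a, a', b, b', κ₁, κ₂, eA, eB, L⟩ := tm.exists_lForm cA (cB.mono sB) m0 (meets_mt _ _ _)
      (no.mono (Finset.Subset.refl _) sB) hA hc
    have mA : ∀ v, v ∈ sl (sl U i s) j z ↔ v = a ∨ v = a' := by simp [eA]
    have mb : b ∈ sl (sl U i s) j (cp z) := sB (by simp [eB])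
    have mb' : b' ∈ sl (sl U i s) j (cp z) := sB (by simp [eB])
    have fin : ∀ t, t = w₀ j ∨ t = cp (w₀ j) → ∃ f ∈ sl (sl U i s) j t, ∃ f' ∈ sl (sl U i s) j t,
        f ≠ f' ∧ f κ₁ = cp (a κ₁) ∧ f' κ₁ = cp (a κ₁) := by
      intro t ht
      refine h.exists_corner_two mA mb mb' L (mt_subset ((I.erase i).erase j) _ a₀)
        (by rcases ht with rfl | rfl <;> assumption) (by grind) (by grind) fun y hy => ?_
      obtain ⟨wy, g1, g2, g3⟩ := mt_word ht hy
      obtain ⟨u1, u2⟩ := meet y wy g1 g2 g3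
      exact ⟨u1 a ((mA _).2 (Or.inl rfl)), L.unique mA hA mb mb' hB cA cB no
        (hp.trEq hj wy g1 g2) u1 u2⟩
    obtain ⟨f, hf, f', hf', hne, e1, e2⟩ := fin _ (Or.inl rfl)
    obtain ⟨g, hg, g', hg', hne', e3, e4⟩ := fin _ (Or.inr rfl)
    have ma := mem_sl.1 ((mA a).2 (Or.inl rfl))
    have ma' := mem_sl.1 ((mA a').2 (Or.inr rfl))
    have e5 := L.a'₁
    rw [mem_sl] at hf hf' hg hg'
    have q := ne_cp (w₀ j)
    have : ({a', f, f', g, g'} : Finset (ι → S)) ⊆ sl (sl U i s) κ₁ (cp (a κ₁)) := fun v hv => by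
      simp only [Finset.mem_insert, Finset.mem_singleton] at hv
      rcases hv with rfl | rfl | rfl | rfl | rfl <;> rw [mem_sl]
      · exact ⟨ma'.1, e5⟩
      · exact ⟨hf.1, e1⟩
      · exact ⟨hf'.1, e2⟩
      · exact ⟨hg.1, e3⟩
      · exact ⟨hg'.1, e4⟩
    have := Finset.card_le_card this
    rw [Finset.card_insert_of_notMem, Finset.card_insert_of_notMem,
      Finset.card_insert_of_notMem, Finset.card_insert_of_notMem, Finset.card_singleton] at this
    · exact ne_cp _ (h.full.const_of_five (Finset.mem_of_mem_erase L.mem₁) this (Or.inl ma.1))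
    all_goals simp only [Finset.mem_insert, Finset.mem_singleton]; grind
  · have key : ∀ y ∈ sl U i (cp s), y j ≠ z → y j ≠ cp z → ¬ Dic ((I.erase i).erase j) a₀ y →
        ∀ k ∈ (I.erase i).erase j, (∃ v ∈ sl U i s, (v j = z ∨ v j = cp z) ∧ v k = y k) ∨
          5 ≤ (sl (sl U i s) k (a₀ k)).card := by
      intro y hy h1 h2 hd k hk
      obtain ⟨m0, hc⟩ := meet y hy h1 h2 hd
      have lc := card_mt_le ((I.erase i).erase j) (sl (sl U i s) j (cp z)) y
      have hc2 : (mt ((I.erase i).erase j) (sl (sl U i s) j (cp z)) y).card ≠ 2 :=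
        fun g => hL ⟨y, hy, h1, h2, hd, g⟩
      have tm := (hp.trEq hj hy h1 h2).mt
      rw [mt_eq_of_card (A := sl (sl U i s) j z)
        (Finset.card_le_card fun v hv => mem_mt.2 ⟨hv, m0 v hv⟩)] at tm
      have sB := mt_subset ((I.erase i).erase j) (sl (sl U i s) j (cp z)) y
      obtain ⟨a, a', b₀, b₁, b₂, κ₁, κ₂, κ₃, eA, eB, H⟩ := tm.exists_hForm cA (cB.mono sB) m0
        (meets_mt _ _ _) (no.mono (Finset.Subset.refl _) sB) hA (by omega)
      have ma : a ∈ sl (sl U i s) j z := by simp [eA]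
      have ma' : a' ∈ sl (sl U i s) j z := by simp [eA]
      have mb : ∀ b, b = b₀ ∨ b = b₁ ∨ b = b₂ → b ∈ sl (sl U i s) j (cp z) := fun b hb =>
        sB (by rw [eB]; simpa using hb)
      rw [mem_sl] at ma ma'
      have mb0 := mem_sl.1 (mb b₀ (by simp))
      rcases HForm.letter H hk with g | g
      · rcases g with g | g | g
        · exact Or.inl ⟨a, ma.1, Or.inl ma.2, g⟩
        · exact Or.inl ⟨a', ma'.1, Or.inl ma'.2, g⟩
        · exact Or.inl ⟨b₀, mb0.1, Or.inr mb0.2, g⟩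
      · refine Or.inr ?_
        have e0 : a₀ k = a k := by
          rw [eA] at ha₀
          simp only [Finset.mem_insert, Finset.mem_singleton] at ha₀
          rcases ha₀ with rfl | rfl
          · rfl
          · exact g.1
        have sub : sl (sl U i s) j z ∪ mt ((I.erase i).erase j) (sl (sl U i s) j (cp z)) y ⊆
            sl (sl U i s) k (a₀ k) := by
          intro v hv
          rcases Finset.mem_union.1 hv with hv | hv
          · have v1 := (mem_sl.1 hv).1
            rw [eA] at hv
            simp only [Finset.mem_insert, Finset.mem_singleton] at hv
            refine mem_sl.2 ⟨v1, ?_⟩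
            rcases hv with rfl | rfl <;> grind
          · have v1 := (mem_sl.1 (sB hv)).1
            rw [eB] at hv
            simp only [Finset.mem_insert, Finset.mem_singleton] at hv
            refine mem_sl.2 ⟨v1, ?_⟩
            rcases hv with rfl | rfl | rfl <;> grind
        have dis : Disjoint (sl (sl U i s) j z)
            (mt ((I.erase i).erase j) (sl (sl U i s) j (cp z)) y) := by
          rw [Finset.disjoint_left]
          intro v hv hv'
          exact ne_cp z ((mem_sl.1 hv).2.symm.trans (mem_sl.1 (sB hv')).2)
        have := Finset.card_le_card sub
        rw [Finset.card_union_of_disjoint dis] at this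
        omega
    obtain ⟨y, hy, y', hy', hne⟩ := Finset.one_lt_card.1 hI
    have g1 := mt_word (Or.inl rfl) hy
    have g2 := mt_word (Or.inl rfl) hy'
    obtain ⟨k, hk, e⟩ :=
      (hp.right.sl j (w₀ j) y (mt_subset _ _ _ hy) y' (mt_subset _ _ _ hy') hne).1
    have hkK := Finset.mem_of_mem_erase hk
    have all : ∀ y ∈ sl U i (cp s), y j ≠ z ∧ y j ≠ cp z ∧ ¬ Dic ((I.erase i).erase j) a₀ y →
        ∀ v ∈ sl U i s, v j = z ∨ v j = cp z → ¬ Dic ((I.erase i).erase j) v y := by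
      rintro y hy ⟨h1, h2, hd⟩ v hv (hvj | hvj)
      · exact (meet y hy h1 h2 hd).1 v (mem_sl.2 ⟨hv, hvj⟩)
      · have hc := (meet y hy h1 h2 hd).2
        have lc := card_mt_le ((I.erase i).erase j) (sl (sl U i s) j (cp z)) y
        have hc2 : (mt ((I.erase i).erase j) (sl (sl U i s) j (cp z)) y).card ≠ 2 :=
          fun g => hL ⟨y, hy, h1, h2, hd, g⟩
        have := meets_mt ((I.erase i).erase j) (sl (sl U i s) j (cp z)) y
        rw [mt_eq_of_card (by omega)] at this
        exact this v (mem_sl.2 ⟨hv, hvj⟩)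
    rcases key y g1.1 g1.2.1 g1.2.2.1 g1.2.2.2 k hk with ⟨v, hv, hvj, hvk⟩ | h5
    · exact all y' g2.1 g2.2 v hv hvj ⟨k, hk, by rw [hvk, e]⟩
    · have r1 := h.full.const_of_five hkK h5 (Or.inr g1.1)
      have r2 := h.full.const_of_five hkK h5 (Or.inr g2.1)
      rw [r1, r2] at e
      exact ne_cp _ e

end PairKill

section ThreeKill

variable {S : Type} [Cpl S] [Finite S] {ι : Type} [DecidableEq ι] [Fintype ι]

variable {I : Finset ι} {U : Finset (ι → S)} {i j : ι} {s z m : S}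

theorem Act.card_three (h : Act I U i s j z m) :
    (sl (sl U i s) j z).card = 3 ∧ (sl (sl U i s) j (cp z)).card = 3 ∧
      (sl (sl U i (cp s)) j z).card = 3 ∧ (sl (sl U i (cp s)) j (cp z)).card = 3 := by
  have h1 := h.three_le
  have h2 := h.flip.three_le
  have h3 := h.symm.three_le
  have h4 := h.symm.flip.three_le
  have := h.card_z
  have := h.full.eqPair.card_sl h.mem z
  omega

theorem Full.const_of_four (h : Full I U i s) (hj : j ∈ I.erase i)
    (h4 : 4 ≤ (sl (sl U i s) j z).card) {w : ι → S} (hw : w ∈ sl U i s ∨ w ∈ sl U i (cp s)) :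
    w j = z := by
  obtain ⟨v, hv⟩ := Finset.card_pos.1 (by omega : 0 < (sl (sl U i s) j z).card)
  refine h.const_of_not_act hj (fun m hm => ?_) (Or.inl (mem_sl.1 hv).1) (mem_sl.1 hv).2 hw
  have := hm.card_three
  omega

theorem IsCode.eq_of_agr_off {K : Finset ι} {A : Finset (ι → S)} (hA : IsCode K A) {v w : ι → S}
    (hv : v ∈ A) (hw : w ∈ A) {κ : ι} (h : ∀ k ∈ K, k ≠ κ → w k = v k) : v = w := by
  by_contra hne
  obtain ⟨⟨k, hk, e⟩, hT⟩ := hA v hv w hw hne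
  have e1 : k = κ := by
    by_contra n1
    exact ne_cp _ ((h k hk n1).symm.trans e)
  subst e1
  exact hT ⟨k, hk, e, h⟩

theorem Act.exists_at (h : Act I U i s j z m) {y : ι → S} (hy : y ∈ sl U i (cp s))
    (h1 : y j ≠ z) (h2 : y j ≠ cp z) {x : ι → Sel S} (hx : Inn ((I.erase i).erase j) x y)
    (nA : ¬ Cov ((I.erase i).erase j) (sl (sl U i s) j z) x) :
    ∃ f ∈ sl (sl U i s) j (y j), Inn ((I.erase i).erase j) x f := by
  have hp := h.full.eqPair
  have hj := h.mem
  obtain ⟨ω, hω, -⟩ := exists_sel_two (ne_cp (y j))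
  have ho : ∀ v, Inn ((I.erase i).erase j) (Function.update x j ω) v ↔
      Inn ((I.erase i).erase j) x v := fun v => by
    constructor
    all_goals
      intro g k hk
      have := g k hk
      rwa [Function.update_of_ne (Finset.ne_of_mem_erase hk)] at *
  have hc : ∀ A, Cov ((I.erase i).erase j) A (Function.update x j ω) ↔
      Cov ((I.erase i).erase j) A x := fun A => by simp only [Cov, ho]
  have nB := fun g => nA ((hp.trEq hj hy h1 h2 x hx).2 g)
  obtain ⟨f, hf, f1, f2, hxf⟩ := hp.symm.exists_word (x := Function.update x j ω) (z := z)
    ⟨y, hy, (inn_iff_erase hj).2 ⟨by simpa using hω, (ho y).2 hx⟩⟩ (by rwa [hc]) (by rwa [hc])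
  obtain ⟨v1, v2⟩ := (inn_iff_erase hj).1 hxf
  refine ⟨f, mem_sl.2 ⟨hf, ?_⟩, (ho f).1 v2⟩
  rcases (h.of_cross hy h1 h2).letters (Or.inl hf) with e | e | e | e
  · exact absurd e f1
  · exact absurd e f2
  · exact e
  · rw [e, Sel.val_cp, Function.update_self] at v1
    exact absurd hω v1

/-- A word through a corner of the box of `y`. -/
theorem Act.exists_corner_three (h : Act I U i s j z m) {y r : ι → S} (hy : y ∈ sl U i (cp s))
    (h1 : y j ≠ z) (h2 : y j ≠ cp z) {κ₁ κ₂ κ₃ : ι} (n12 : κ₁ ≠ κ₂) (n13 : κ₁ ≠ κ₃) (n23 : κ₂ ≠ κ₃)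
    (m1 : κ₁ ∈ (I.erase i).erase j) (m2 : κ₂ ∈ (I.erase i).erase j)
    (m3 : κ₃ ∈ (I.erase i).erase j)
    (hoff : ∀ k ∈ (I.erase i).erase j, k ≠ κ₁ → k ≠ κ₂ → k ≠ κ₃ → ∀ w,
      w ∈ sl U i s ∨ w ∈ sl U i (cp s) → w k = r k) {t₁ t₂ t₃ : S} (q1 : t₁ ≠ cp (y κ₁))
    (q2 : t₂ ≠ cp (y κ₂)) (q3 : t₃ ≠ cp (y κ₃))
    (hA : ∀ v ∈ mt ((I.erase i).erase j) (sl (sl U i s) j z) y,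
      v κ₁ = cp t₁ ∨ v κ₂ = cp t₂ ∨ v κ₃ = cp t₃) :
    ∃ f ∈ sl (sl U i s) j (y j), (f κ₁ ≠ cp t₁ ∧ f κ₁ ≠ cp (y κ₁)) ∧
      (f κ₂ ≠ cp t₂ ∧ f κ₂ ≠ cp (y κ₂)) ∧ (f κ₃ ≠ cp t₃ ∧ f κ₃ ≠ cp (y κ₃)) ∧
      ∀ v ∈ sl (sl U i s) j z, v κ₁ = cp (f κ₁) ∨ v κ₂ = cp (f κ₂) ∨ v κ₃ = cp (f κ₃) := by
  obtain ⟨x, hx⟩ := exists_pt ((I.erase i).erase j) (fun k ω => ω.val (y k) ∧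
      (k = κ₁ → ω.val t₁) ∧ (k = κ₂ → ω.val t₂) ∧ (k = κ₃ → ω.val t₃)) (fun k hk => by
    by_cases g1 : k = κ₁
    · obtain ⟨ω, w1, w2⟩ := exists_sel_two q1
      exact ⟨ω, g1 ▸ w1, fun _ => w2, fun g => absurd (g1.symm.trans g) n12,
        fun g => absurd (g1.symm.trans g) n13⟩
    by_cases g2 : k = κ₂
    · obtain ⟨ω, w1, w2⟩ := exists_sel_two q2
      exact ⟨ω, g2 ▸ w1, fun g => absurd g g1, fun _ => w2,
        fun g => absurd (g2.symm.trans g) n23⟩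
    by_cases g3 : k = κ₃
    · obtain ⟨ω, w1, w2⟩ := exists_sel_two q3
      exact ⟨ω, g3 ▸ w1, fun g => absurd g g1, fun g => absurd g g2, fun _ => w2⟩
    obtain ⟨ω, w1, -⟩ := exists_sel_two (ne_cp (y k))
    exact ⟨ω, w1, fun g => absurd g g1, fun g => absurd g g2, fun g => absurd g g3⟩)
  have x1 := (hx κ₁ m1).2.1 rfl
  have x2 := (hx κ₂ m2).2.2.1 rfl
  have x3 := (hx κ₃ m3).2.2.2 rfl
  have hxy : Inn ((I.erase i).erase j) x y := fun k hk => (hx k hk).1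
  obtain ⟨f, hf, hxf⟩ := h.exists_at hy h1 h2 hxy (by
    rw [← cov_mt hxy]
    rintro ⟨v, hv, hxv⟩
    rcases hA v hv with g | g | g
    · have := hxv κ₁ m1
      rw [g, Sel.val_cp] at this
      exact this x1
    · have := hxv κ₂ m2
      rw [g, Sel.val_cp] at this
      exact this x2
    · have := hxv κ₃ m3
      rw [g, Sel.val_cp] at this
      exact this x3)
  have sep : ∀ {k t}, k ∈ (I.erase i).erase j → (x k).val t → f k ≠ cp t := fun hk ht g => by
    have := hxf _ hk
    rw [g, Sel.val_cp] at this
    exact this ht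
  obtain ⟨vf, fj⟩ := mem_sl.1 hf
  refine ⟨f, hf, ⟨sep m1 x1, sep m1 (hxy κ₁ m1)⟩, ⟨sep m2 x2, sep m2 (hxy κ₂ m2)⟩,
    ⟨sep m3 x3, sep m3 (hxy κ₃ m3)⟩, fun v hv => ?_⟩
  obtain ⟨k, hk, e⟩ := h.full.eqPair.left.dic_of_ne vf hv (fj ▸ h1) (fj ▸ h2)
  by_cases g1 : k = κ₁
  · exact Or.inl (g1 ▸ e)
  by_cases g2 : k = κ₂
  · exact Or.inr (Or.inl (g2 ▸ e))
  by_cases g3 : k = κ₃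
  · exact Or.inr (Or.inr (g3 ▸ e))
  rw [hoff k hk g1 g2 g3 f (Or.inl vf), hoff k hk g1 g2 g3 v (Or.inl (mem_sl.1 hv).1)] at e
  exact absurd e (ne_cp _)

/-- The words with a fourth letter agree too much. -/
theorem Act.pigeon (h : Act I U i s j z m) {a a' r : ι → S} {t : S} (h1 : t ≠ z) (h2 : t ≠ cp z)
    (hG : (sl (sl U i s) j t).card = 3) (ma : a ∈ sl (sl U i s) j z) (ma' : a' ∈ sl (sl U i s) j z)
    {κ₁ κ₂ κ₃ : ι} (e1 : a' κ₁ = cp (a κ₁)) (e2 : a' κ₂ ≠ a κ₂)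
    (e3 : a' κ₃ ≠ a κ₃) {q : S} (hact : Act I U i s κ₁ (a κ₁) q)
    (hoff : ∀ k ∈ (I.erase i).erase j, k ≠ κ₁ → k ≠ κ₂ → k ≠ κ₃ → ∀ w,
      w ∈ sl U i s ∨ w ∈ sl U i (cp s) → w k = r k)
    (c1 : 3 ≤ ((sl (sl U i s) κ₁ (a κ₁)).filter fun v => v j ≠ t).card)
    (c2 : 3 ≤ ((sl (sl U i s) κ₁ (cp (a κ₁))).filter fun v => v j ≠ t).card) : False := by
  have hp := h.full.eqPair
  have full : ∀ l, (sl (sl U i s) κ₁ l).card = 3 →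
      3 ≤ ((sl (sl U i s) κ₁ l).filter fun v => v j ≠ t).card →
      ∀ g ∈ sl (sl U i s) j t, g κ₁ ≠ l := by
    intro l hl h3 g hg e
    have := Finset.eq_of_subset_of_card_le
      (Finset.filter_subset (fun v => v j ≠ t) (sl (sl U i s) κ₁ l)) (by omega)
    obtain ⟨vg, gj⟩ := mem_sl.1 hg
    have hm : g ∈ sl (sl U i s) κ₁ l := mem_sl.2 ⟨vg, e⟩
    rw [← this, Finset.mem_filter] at hm
    exact hm.2 gj
  have f1 := full _ hact.card_three.1 c1
  have f2 := full _ hact.card_three.2.1 c2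
  have sep : ∀ g ∈ sl (sl U i s) j t, ∀ v ∈ sl (sl U i s) j z, v κ₁ ≠ cp (g κ₁) →
      v κ₂ = cp (g κ₂) ∨ v κ₃ = cp (g κ₃) := by
    intro g hg v hv n
    obtain ⟨vg, gj⟩ := mem_sl.1 hg
    obtain ⟨k, hk, e⟩ := hp.left.dic_of_ne vg hv (gj ▸ h1) (gj ▸ h2)
    by_cases g1 : k = κ₁
    · exact absurd (g1 ▸ e) n
    by_cases g2 : k = κ₂
    · exact Or.inl (g2 ▸ e)
    by_cases g3 : k = κ₃
    · exact Or.inr (g3 ▸ e)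
    rw [hoff k hk g1 g2 g3 g (Or.inl vg), hoff k hk g1 g2 g3 v (Or.inl (mem_sl.1 hv).1)] at e
    exact absurd e (ne_cp _)
  have opt : ∀ g ∈ sl (sl U i s) j t, (g κ₂ = cp (a κ₂) ∧ g κ₃ = cp (a' κ₃)) ∨
      (g κ₂ = cp (a' κ₂) ∧ g κ₃ = cp (a κ₃)) := by
    intro g hg
    have n1 := f1 g hg
    have n2 := f2 g hg
    have s1 := sep g hg a ma (by grind)
    have s2 := sep g hg a' ma' (by grind)
    grind
  have same : ∀ g ∈ sl (sl U i s) j t, ∀ g' ∈ sl (sl U i s) j t, g κ₂ = g' κ₂ → g κ₃ = g' κ₃ →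
      g = g' := by
    intro g hg g' hg' u2 u3
    refine (hp.left.sl j t).eq_of_agr_off hg hg' (κ := κ₁) fun k hk g1 => ?_
    by_cases g2 : k = κ₂
    · rw [g2, u2]
    by_cases g3 : k = κ₃
    · rw [g3, u3]
    rw [hoff k hk g1 g2 g3 g (Or.inl (mem_sl.1 hg).1),
      hoff k hk g1 g2 g3 g' (Or.inl (mem_sl.1 hg').1)]
  obtain ⟨g₁, hg₁, g₂, hg₂, g₃, hg₃, n1, n2, n3⟩ := Finset.two_lt_card.1 (by rw [hG]; norm_num)
  have o1 := opt _ hg₁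
  have o2 := opt _ hg₂
  have o3 := opt _ hg₃
  have p1 := same _ hg₁ _ hg₂
  have p2 := same _ hg₁ _ hg₃
  have p3 := same _ hg₂ _ hg₃
  grind

theorem three_le_filter {A : Finset (ι → S)} {P : (ι → S) → Prop}
    [DecidablePred P] {a b c : ι → S} (ha : a ∈ A)
    (hb : b ∈ A) (hc : c ∈ A) (pa : P a) (pb : P b) (pc : P c) (hab : a ≠ b) (hac : a ≠ c)
    (hbc : b ≠ c) : 3 ≤ (A.filter P).card := by
  have : ({a, b, c} : Finset (ι → S)) ⊆ A.filter P := by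
    intro v hv
    simp only [Finset.mem_insert, Finset.mem_singleton] at hv
    rw [Finset.mem_filter]
    rcases hv with rfl | rfl | rfl <;> exact ⟨by assumption, by assumption⟩
  have hc := Finset.card_le_card this
  rwa [Finset.card_eq_three.2 ⟨a, b, c, hab, hac, hbc, rfl⟩] at hc

theorem Act.hForm_false (h : Act I U i s j z m) {a a' b₀ b₁ b₂ y : ι → S} {κ₁ κ₂ κ₃ : ι}
    (hy : y ∈ sl U i (cp s)) (h1 : y j ≠ z) (h2 : y j ≠ cp z)
    (mA : ∀ v, v ∈ mt ((I.erase i).erase j) (sl (sl U i s) j z) y ↔ v = a ∨ v = a')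
    (mb₁ : b₁ ∈ sl (sl U i s) j (cp z)) (mb₂ : b₂ ∈ sl (sl U i s) j (cp z))
    (H : HForm ((I.erase i).erase j) a a' b₀ b₁ b₂ y κ₁ κ₂ κ₃)
    (hoff : ∀ k ∈ (I.erase i).erase j, k ≠ κ₁ → k ≠ κ₂ → k ≠ κ₃ → ∀ w,
      w ∈ sl U i s ∨ w ∈ sl U i (cp s) → w k = a k) : False := by
  have ma := mt_subset _ _ _ ((mA a).2 (Or.inl rfl))
  have ma' := mt_subset _ _ _ ((mA a').2 (Or.inr rfl))
  have va := mem_sl.1 ma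
  have va' := mem_sl.1 ma'
  have vb₁ := mem_sl.1 mb₁
  have vb₂ := mem_sl.1 mb₂
  have a_1 := H.a_1
  have a_1' := H.a_1'
  have a'_1 := H.a'_1
  have b₁_1 := H.b₁_1
  have b₂_1 := H.b₂_1
  have b₀_2 := H.b₀_2
  have b₀_2' := H.b₀_2'
  have a_2 := H.a_2
  have a'_2 := H.a'_2
  have b₀_3 := H.b₀_3
  have b₀_3' := H.b₀_3'
  have a_3 := H.a_3
  have a'_3 := H.a'_3
  have hg := h.of_cross hy h1 h2
  obtain ⟨f, hf, u1, u2, u3, u⟩ := h.exists_corner_three hy h1 h2 H.ne₁₂ H.ne₁₃ H.ne₂₃ H.mem₁ H.mem₂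
    H.mem₃ hoff (t₁ := a κ₁) (t₂ := b₀ κ₂) (t₃ := cp (b₀ κ₃)) (by grind) (by grind) (by grind)
    (fun v hv => by
      rcases (mA v).1 hv with rfl | rfl
      · exact Or.inr (Or.inr (by grind))
      · exact Or.inl a'_1)
  obtain ⟨f', hf', u1', u2', u3', u'⟩ := h.exists_corner_three hy h1 h2 H.ne₁₂ H.ne₁₃ H.ne₂₃ H.mem₁
    H.mem₂ H.mem₃ hoff (t₁ := cp (a κ₁)) (t₂ := cp (b₀ κ₂)) (t₃ := b₀ κ₃) (by grind) (by grind)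
    (by grind) (fun v hv => by
      rcases (mA v).1 hv with rfl | rfl
      · exact Or.inl (by grind)
      · exact Or.inr (Or.inl (by grind)))
  have e1 : f κ₁ = a κ₁ := by
    have := u a' ma'
    grind
  have e2 : f' κ₁ = cp (a κ₁) := by
    have := u' a ma
    grind
  have vf := mem_sl.1 hf
  have vf' := mem_sl.1 hf'
  have zc := ne_cp z
  have yc := ne_cp (y j)
  have hne : ∀ {v w : ι → S}, v j ≠ w j → v ≠ w := fun hv e => hv (e ▸ rfl)
  refine h.pigeon (t := cp (y j)) (by grind) (by grind) hg.swap.card_three.2.1 ma ma'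
    a'_1 (κ₂ := κ₂) (κ₃ := κ₃) (by rw [a_2, a'_2]; exact b₀_2) (by rw [a_3, a'_3]; exact b₀_3.symm)
    (h.full.act (Finset.mem_of_mem_erase H.mem₁) (Or.inl va.1) (Or.inr hy) a_1.symm (by grind))
    hoff ?_ ?_
  · exact three_le_filter (P := fun v => v j ≠ cp (y j)) (a := a) (b := b₁) (c := f) (mem_sl.2 ⟨va.1, rfl⟩) (mem_sl.2 ⟨vb₁.1, b₁_1⟩)
      (mem_sl.2 ⟨vf.1, e1⟩) (by grind) (by grind) (by grind) (hne (by grind)) (hne (by grind))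
      (hne (by grind))
  · exact three_le_filter (P := fun v => v j ≠ cp (y j)) (a := a') (b := b₂) (c := f') (mem_sl.2 ⟨va'.1, a'_1⟩)
      (mem_sl.2 ⟨vb₂.1, b₂_1⟩) (mem_sl.2 ⟨vf'.1, e2⟩) (by grind) (by grind) (by grind)
      (hne (by grind)) (hne (by grind)) (hne (by grind))

theorem Act.hForm'_false (h : Act I U i s j z m) {a a' b₀ b₁ b₂ y : ι → S} {κ₁ κ₂ κ₃ : ι}
    (hy : y ∈ sl U i (cp s)) (h1 : y j ≠ z) (h2 : y j ≠ cp z)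
    (mA : ∀ v, v ∈ mt ((I.erase i).erase j) (sl (sl U i s) j z) y ↔ v = a ∨ v = a')
    (mb₁ : b₁ ∈ sl (sl U i s) j (cp z)) (mb₂ : b₂ ∈ sl (sl U i s) j (cp z))
    (H : HForm' ((I.erase i).erase j) a a' b₀ b₁ b₂ y κ₁ κ₂ κ₃)
    (hoff : ∀ k ∈ (I.erase i).erase j, k ≠ κ₁ → k ≠ κ₂ → k ≠ κ₃ → ∀ w,
      w ∈ sl U i s ∨ w ∈ sl U i (cp s) → w k = a k) : False := by
  have ma := mt_subset _ _ _ ((mA a).2 (Or.inl rfl))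
  have ma' := mt_subset _ _ _ ((mA a').2 (Or.inr rfl))
  have va := mem_sl.1 ma
  have va' := mem_sl.1 ma'
  have vb₁ := mem_sl.1 mb₁
  have vb₂ := mem_sl.1 mb₂
  have a_1 := H.a_1
  have a_1' := H.a_1'
  have a'_1 := H.a'_1
  have b₁_1 := H.b₁_1
  have b₂_1 := H.b₂_1
  have b₁_3 := H.b₁_3
  have b₂_3 := H.b₂_3
  have b₀_2 := H.b₀_2
  have b₀_2' := H.b₀_2'
  have a_2 := H.a_2
  have a'_2 := H.a'_2
  have b₀_3 := H.b₀_3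
  have b₀_3' := H.b₀_3'
  have a_3 := H.a_3
  have a'_3 := H.a'_3
  have hg := h.of_cross hy h1 h2
  obtain ⟨f, hf, u1, u2, u3, u⟩ := h.exists_corner_three hy h1 h2 H.ne₁₂ H.ne₁₃ H.ne₂₃ H.mem₁ H.mem₂
    H.mem₃ hoff (t₁ := a κ₁) (t₂ := cp (b₀ κ₂)) (t₃ := b₀ κ₃) (by grind) (by grind) (by grind)
    (fun v hv => by
      rcases (mA v).1 hv with rfl | rfl
      · exact Or.inr (Or.inl (by grind))
      · exact Or.inl a'_1)
  obtain ⟨f', hf', u1', u2', u3', u'⟩ := h.exists_corner_three hy h1 h2 H.ne₁₂ H.ne₁₃ H.ne₂₃ H.mem₁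
    H.mem₂ H.mem₃ hoff (t₁ := a κ₁) (t₂ := b₀ κ₂) (t₃ := cp (b₀ κ₃)) (by grind) (by grind)
    (by grind) (fun v hv => by
      rcases (mA v).1 hv with rfl | rfl
      · exact Or.inr (Or.inr (by grind))
      · exact Or.inl a'_1)
  have e1 : f κ₁ = a κ₁ := by
    have := u a' ma'
    grind
  have e2 : f' κ₁ = a κ₁ := by
    have := u' a' ma'
    grind
  have e3 : f κ₂ = cp (b₀ κ₂) := by
    have := u a ma
    grind
  have vf := mem_sl.1 hf
  have vf' := mem_sl.1 hf'
  have zc := ne_cp z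
  have yc := ne_cp (y j)
  have hne : ∀ {v w : ι → S}, v j ≠ w j → v ≠ w := fun hv e => hv (e ▸ rfl)
  refine h.pigeon (t := cp (y j)) (by grind) (by grind) hg.swap.card_three.2.1 ma ma'
    a'_1 (κ₂ := κ₂) (κ₃ := κ₃) (by rw [a_2, a'_2]; exact b₀_2.symm)
    (by rw [a_3, a'_3]; exact b₀_3.symm)
    (h.full.act (Finset.mem_of_mem_erase H.mem₁) (Or.inl va.1) (Or.inr hy) a_1.symm (by grind))
    hoff ?_ ?_
  · exact three_le_filter (P := fun v => v j ≠ cp (y j)) (a := a) (b := f) (c := f') (mem_sl.2 ⟨va.1, rfl⟩) (mem_sl.2 ⟨vf.1, e1⟩)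
      (mem_sl.2 ⟨vf'.1, e2⟩) (by grind) (by grind) (by grind) (hne (by grind)) (hne (by grind))
      (fun e => u2'.1 (e ▸ e3))
  · exact three_le_filter (P := fun v => v j ≠ cp (y j)) (a := a') (b := b₁) (c := b₂) (mem_sl.2 ⟨va'.1, a'_1⟩)
      (mem_sl.2 ⟨vb₁.1, b₁_1⟩) (mem_sl.2 ⟨vb₂.1, b₂_1⟩) (by grind) (by grind) (by grind)
      (hne (by grind)) (hne (by grind)) (fun e => ne_cp _ (b₁_3.symm.trans (e ▸ b₂_3)))

theorem Act.mt_ne_two (h : Act I U i s j z m) {y : ι → S} (hy : y ∈ sl U i (cp s)) (h1 : y j ≠ z)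
    (h2 : y j ≠ cp z) : (mt ((I.erase i).erase j) (sl (sl U i s) j z) y).card ≠ 2 := by
  intro hc
  have hp := h.full.eqPair
  have hj := h.mem
  obtain ⟨n1, n2, -, -⟩ := h.card_three
  have cA := hp.left.sl j z
  have cB := hp.left.sl j (cp z)
  have no := hp.left.noC_sl hj z
  have sA := mt_subset ((I.erase i).erase j) (sl (sl U i s) j z) y
  have sB := mt_subset ((I.erase i).erase j) (sl (sl U i s) j (cp z)) y
  have tm := (hp.trEq hj hy h1 h2).mt
  obtain ⟨v, hv⟩ := Finset.card_pos.1 (by omega : 0 < (mt ((I.erase i).erase j) (sl (sl U i s) j z) y).card)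
  obtain ⟨-, cc⟩ := h.card_traces (sA hv) hy h1 h2 (mem_mt.1 hv).2
  have lc := card_mt_le ((I.erase i).erase j) (sl (sl U i s) j (cp z)) y
  have const : ∀ {a : ι → S} {k : ι}, k ∈ (I.erase i).erase j →
      (∀ v ∈ mt ((I.erase i).erase j) (sl (sl U i s) j z) y, v k = a k) →
      (∀ v ∈ mt ((I.erase i).erase j) (sl (sl U i s) j (cp z)) y, v k = a k) →
      ∀ w, w ∈ sl U i s ∨ w ∈ sl U i (cp s) → w k = a k := by
    intro a k hk g1 g2 w hw
    refine h.full.const_of_four (Finset.mem_of_mem_erase hk) ?_ hw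
    have dis : Disjoint (mt ((I.erase i).erase j) (sl (sl U i s) j z) y)
        (mt ((I.erase i).erase j) (sl (sl U i s) j (cp z)) y) := by
      rw [Finset.disjoint_left]
      intro v hv hv'
      exact ne_cp z ((mem_sl.1 (sA hv)).2.symm.trans (mem_sl.1 (sB hv')).2)
    have := Finset.card_le_card (Finset.union_subset
      (fun v hv => mem_sl.2 ⟨(mem_sl.1 (sA hv)).1, g1 v hv⟩ :
        mt ((I.erase i).erase j) (sl (sl U i s) j z) y ⊆ sl (sl U i s) k (a k))
      (fun v hv => mem_sl.2 ⟨(mem_sl.1 (sB hv)).1, g2 v hv⟩))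
    rw [Finset.card_union_of_disjoint dis] at this
    omega
  rcases (by omega : (mt ((I.erase i).erase j) (sl (sl U i s) j (cp z)) y).card = 2 ∨
    (mt ((I.erase i).erase j) (sl (sl U i s) j (cp z)) y).card = 3) with g | g
  · obtain ⟨a, a', b, b', κ₁, κ₂, eA, eB, L⟩ := tm.exists_lForm (cA.mono sA) (cB.mono sB)
      (meets_mt _ _ _) (meets_mt _ _ _) (no.mono sA sB) hc g
    have hoff : ∀ k ∈ (I.erase i).erase j, k ≠ κ₁ → k ≠ κ₂ → ∀ w,
        w ∈ sl U i s ∨ w ∈ sl U i (cp s) → w k = a k := by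
      intro k hk k1 k2
      have o := L.off k hk k1 k2
      exact const hk (by rw [eA]; simp [o]) (by rw [eB]; simp [o])
    have := card_le_two_of_agr cA κ₁ κ₂ fun v hv w hw k hk k1 k2 => by
      rw [hoff k hk k1 k2 v (Or.inl (mem_sl.1 hv).1), hoff k hk k1 k2 w (Or.inl (mem_sl.1 hw).1)]
    omega
  · obtain ⟨a, a', b₀, b₁, b₂, κ₁, κ₂, κ₃, eA, eB, H⟩ := tm.exists_hForm (cA.mono sA) (cB.mono sB)
      (meets_mt _ _ _) (meets_mt _ _ _) (no.mono sA sB) hc g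
    have mA : ∀ v, v ∈ mt ((I.erase i).erase j) (sl (sl U i s) j z) y ↔ v = a ∨ v = a' := by
      simp [eA]
    have mb₁ : b₁ ∈ sl (sl U i s) j (cp z) := sB (by simp [eB])
    have mb₂ : b₂ ∈ sl (sl U i s) j (cp z) := sB (by simp [eB])
    have off : ∀ k ∈ (I.erase i).erase j, k ≠ κ₁ → k ≠ κ₂ → k ≠ κ₃ →
        a' k = a k ∧ b₀ k = a k ∧ b₁ k = a k ∧ b₂ k = a k := by
      rcases H with H | H <;> exact H.off
    have hoff : ∀ k ∈ (I.erase i).erase j, k ≠ κ₁ → k ≠ κ₂ → k ≠ κ₃ → ∀ w,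
        w ∈ sl U i s ∨ w ∈ sl U i (cp s) → w k = a k := by
      intro k hk k1 k2 k3
      have o := off k hk k1 k2 k3
      exact const hk (by rw [eA]; simp [o]) (by rw [eB]; simp [o])
    rcases H with H | H
    · exact h.hForm_false hy h1 h2 mA mb₁ mb₂ H hoff
    · exact h.hForm'_false hy h1 h2 mA mb₁ mb₂ H hoff

/-- One crossing pair of words makes all the words of the two slices meet. -/
theorem Act.meets_of_cross (h : Act I U i s j z m) {a y v : ι → S} (ha : a ∈ sl U i s)
    (haj : a j = z ∨ a j = cp z) (hy : y ∈ sl U i (cp s)) (h1 : y j ≠ z) (h2 : y j ≠ cp z)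
    (hd : ¬ Dic ((I.erase i).erase j) a y) (hv : v ∈ sl U i s) (hvj : v j = z ∨ v j = cp z) :
    ¬ Dic ((I.erase i).erase j) v y := by
  wlog hz : a j = z generalizing z
  · have e := haj.resolve_left hz
    exact this h.flip (Or.inl e) h2 (by rwa [cp_cp]) (by rw [cp_cp]; exact hvj.symm) e
  obtain ⟨c1, c2⟩ := h.card_traces (mem_sl.2 ⟨ha, hz⟩) hy h1 h2 hd
  have n1 := h.mt_ne_two hy h1 h2
  have n2 := h.flip.mt_ne_two hy h2 (by rwa [cp_cp])
  obtain ⟨s1, s2, -, -⟩ := h.card_three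
  have l1 := card_mt_le ((I.erase i).erase j) (sl (sl U i s) j z) y
  have l2 := card_mt_le ((I.erase i).erase j) (sl (sl U i s) j (cp z)) y
  rcases hvj with e | e
  · have := meets_mt ((I.erase i).erase j) (sl (sl U i s) j z) y
    rw [mt_eq_of_card (by omega)] at this
    exact this v (mem_sl.2 ⟨hv, e⟩)
  · have := meets_mt ((I.erase i).erase j) (sl (sl U i s) j (cp z)) y
    rw [mt_eq_of_card (by omega)] at this
    exact this v (mem_sl.2 ⟨hv, e⟩)

theorem Act.meets (h : Act I U i s j z m) {v w : ι → S} (hv : v ∈ sl U i s)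
    (hvj : v j = z ∨ v j = cp z) (hw : w ∈ sl U i (cp s)) (h1 : w j ≠ z) (h2 : w j ≠ cp z) :
    ¬ Dic ((I.erase i).erase j) v w := by
  obtain ⟨a, ha, y, hy, y1, y2, hd⟩ := h.exists_cross
  obtain ⟨ha, aj⟩ := mem_sl.1 ha
  have g := (h.of_cross hy y1 y2).swap.symm
  have hwj : w j = y j ∨ w j = cp (y j) := by
    rcases (h.of_cross hy y1 y2).letters (Or.inr hw) with e | e | e | e
    · exact absurd e h1
    · exact absurd e h2
    · exact Or.inl e
    · exact Or.inr e
  have hwa := g.meets_of_cross hy (Or.inl rfl) (by rwa [cp_cp]) (by rw [aj]; exact y1.symm)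
    (by rw [aj]; exact fun e => y2 (by rw [e, cp_cp])) (fun e => hd e.symm) hw hwj
  exact h.meets_of_cross ha (Or.inl aj) hw h1 h2 (fun e => hwa e.symm) hv hvj

end ThreeKill

section NoFull

variable {S : Type} [Cpl S] [Finite S] {ι : Type} [DecidableEq ι] [Fintype ι]

variable {I : Finset ι} {U : Finset (ι → S)} {i j : ι} {s z m : S}

theorem sl_union_card {A : Finset (ι → S)} {k : ι} {p q : S} (h : p ≠ q) :
    (sl A k p ∪ sl A k q).card = (sl A k p).card + (sl A k q).card := by
  refine Finset.card_union_of_disjoint (Finset.disjoint_left.2 fun v h1 h2 => h ?_)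
  rw [← (mem_sl.1 h1).2, ← (mem_sl.1 h2).2]

/-- Two words of a slice that is covered by the words meeting it agree at an active position. -/
theorem Act.letter_of_avoid (h : Act I U i s j z m) {y : ι → S} (hy : y ∈ sl U i (cp s))
    (h1 : y j ≠ z) (h2 : y j ≠ cp z) {k : ι} (hk : k ∈ (I.erase i).erase j) {ζ q : S}
    (ha : Act I U i s k ζ q)
    (hv : ∀ v ∈ sl U i s, v j = z ∨ v j = cp z → v k ≠ cp ζ)
    {a : ι → S} (va : a ∈ sl U i s) (aj : a j = z) (ak : a k = ζ) (hyk : y k ≠ cp ζ) :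
    y k = ζ := by
  by_contra hn
  have hp := h.full.eqPair
  have cA := hp.left.sl j z
  have cB := hp.left.sl j (cp z)
  have hsq := fun x hx => ((hp.trEq h.mem hy h1 h2).square cA cB hk (z := ζ) (x := x) (Ne.symm hn)
    (by grind) hx).2
  have ht : TrEq (((I.erase i).erase j).erase k) (sl (sl (sl U i s) j z) k ζ)
      (sl (sl (sl U i s) j (cp z)) k ζ) y := by
    intro x hx
    have e1 : ¬ Cov (((I.erase i).erase j).erase k) (sl (sl (sl U i s) j z) k (cp ζ)) x := by
      rintro ⟨v, g, -⟩
      obtain ⟨g1, g2⟩ := mem_sl.1 g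
      exact hv v (mem_sl.1 g1).1 (Or.inl (mem_sl.1 g1).2) g2
    have e2 : ¬ Cov (((I.erase i).erase j).erase k) (sl (sl (sl U i s) j (cp z)) k (cp ζ)) x := by
      rintro ⟨v, g, -⟩
      obtain ⟨g1, g2⟩ := mem_sl.1 g
      exact hv v (mem_sl.1 g1).1 (Or.inr (mem_sl.1 g1).2) g2
    have := hsq x hx
    rwa [or_iff_left e2, or_iff_right e1] at this
  have hno : NoC (((I.erase i).erase j).erase k) (sl (sl (sl U i s) j z) k ζ)
      (sl (sl (sl U i s) j (cp z)) k ζ) := by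
    intro v hv w hw e
    obtain ⟨g1, g2⟩ := mem_sl.1 hv
    obtain ⟨g3, g4⟩ := mem_sl.1 hw
    refine hp.left.noC_sl h.mem z v g1 w g3 fun l hl => ?_
    by_cases el : l = k
    · rw [el, g2, g4]
    · exact e l (Finset.mem_erase.2 ⟨el, hl⟩)
  obtain ⟨x, hxa, hxy⟩ := exists_inn_two (h.meets va (Or.inl aj) hy h1 h2)
  have hc := ht.card_mt (cA.sl k ζ) (cB.sl k ζ) hno (hxy.erase k)
    ⟨a, mem_sl.2 ⟨mem_sl.2 ⟨va, aj⟩, ak⟩, hxa.erase k⟩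
  have c1 := card_mt_le (((I.erase i).erase j).erase k) (sl (sl (sl U i s) j z) k ζ) y
  have c2 := card_mt_le (((I.erase i).erase j).erase k) (sl (sl (sl U i s) j (cp z)) k ζ) y
  have hsub : sl (sl (sl U i s) j z) k ζ ∪ sl (sl (sl U i s) j (cp z)) k ζ ⊆ sl (sl U i s) k ζ := by
    intro v hv
    rcases Finset.mem_union.1 hv with g | g
    all_goals exact mem_sl.2 ⟨(mem_sl.1 (mem_sl.1 g).1).1, (mem_sl.1 g).2⟩
  have hd : Disjoint (sl (sl (sl U i s) j z) k ζ) (sl (sl (sl U i s) j (cp z)) k ζ) := by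
    refine Finset.disjoint_left.2 fun v g1 g2 => ne_cp z ?_
    exact (mem_sl.1 (mem_sl.1 g1).1).2.symm.trans (mem_sl.1 (mem_sl.1 g2).1).2
  have hle := Finset.card_le_card hsub
  rw [Finset.card_union_of_disjoint hd] at hle
  have := ha.card_three.1
  omega

theorem Act.false (h : Act I U i s j z m) : False := by
  have hp := h.full.eqPair
  obtain ⟨n1, n2, n3, n4⟩ := h.card_three
  obtain ⟨m1, m2, m3, m4⟩ := h.swap.card_three
  have hmz := h.ne
  have hmz' := h.ne'
  obtain ⟨a, ha⟩ := Finset.card_pos.1 (by omega : 0 < (sl (sl U i s) j z).card)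
  obtain ⟨f, hf⟩ := Finset.card_pos.1 (by omega : 0 < (sl (sl U i s) j m).card)
  obtain ⟨va, aj⟩ := mem_sl.1 ha
  obtain ⟨vf, fj⟩ := mem_sl.1 hf
  obtain ⟨k, hk, e⟩ := hp.left.dic_of_ne vf ha (fj ▸ hmz) (fj ▸ hmz')
  have hkK := Finset.mem_of_mem_erase hk
  obtain ⟨q, hq⟩ : ∃ q, Act I U i s k (a k) q := by
    by_contra! hn
    have := h.full.const_of_not_act hkK hn (Or.inl va) rfl (Or.inl vf)
    rw [this] at e
    exact ne_cp _ e
  obtain ⟨z1, z2, z3, z4⟩ := hq.card_three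
  obtain ⟨q1, q2, q3, q4⟩ := hq.swap.card_three
  have av : ∀ y ∈ sl U i (cp s), y j ≠ z → y j ≠ cp z → ∀ v ∈ sl U i s, v j = z ∨ v j = cp z →
      y k ≠ cp (v k) := fun y hy g1 g2 v hv g3 g4 => h.meets hv g3 hy g1 g2 ⟨k, hk, g4⟩
  have cY : (sl (sl U i (cp s)) j m ∪ sl (sl U i (cp s)) j (cp m)).card = 6 := by
    rw [sl_union_card (ne_cp m)]
    omega
  have cA : (sl (sl U i s) j z ∪ sl (sl U i s) j (cp z)).card = 6 := by
    rw [sl_union_card (ne_cp z)]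
    omega
  have hY : ∀ y ∈ sl (sl U i (cp s)) j m ∪ sl (sl U i (cp s)) j (cp m),
      y ∈ sl U i (cp s) ∧ y j ≠ z ∧ y j ≠ cp z := by
    intro y hy
    simp only [Finset.mem_union, mem_sl (k := j)] at hy
    grind
  have hlt : ∀ l, (sl (sl U i (cp s)) k l).card = 3 →
      ¬ ∀ y ∈ sl (sl U i (cp s)) j m ∪ sl (sl U i (cp s)) j (cp m), y k = l := by
    intro l hl g
    have := Finset.card_le_card (fun y hy => mem_sl.2 ⟨(hY y hy).1, g y hy⟩ :
      sl (sl U i (cp s)) j m ∪ sl (sl U i (cp s)) j (cp m) ⊆ sl (sl U i (cp s)) k l)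
    omega
  by_cases hv : ∃ v ∈ sl U i s, (v j = z ∨ v j = cp z) ∧ v k = cp (a k)
  · obtain ⟨v, hv, vj, vk⟩ := hv
    have hq2 : ∀ y ∈ sl (sl U i (cp s)) j m ∪ sl (sl U i (cp s)) j (cp m), y k = q ∨ y k = cp q := by
      intro y hy
      obtain ⟨g1, g2, g3⟩ := hY y hy
      have b1 := av y g1 g2 g3 a va (Or.inl aj)
      have b2 := av y g1 g2 g3 v hv vj
      rw [vk, cp_cp] at b2
      rcases hq.letters (Or.inr g1) with g | g | g | g
      · exact absurd g b2
      · exact absurd g b1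
      · exact Or.inl g
      · exact Or.inr g
    have b1 := hlt _ q3
    have b2 := hlt _ q4
    push Not at b1 b2
    obtain ⟨y, hy, yk⟩ := b1
    obtain ⟨w, hw, wk⟩ := b2
    have yk' := (hq2 y hy).resolve_left yk
    have wk' := (hq2 w hw).resolve_right wk
    have hsub : sl (sl U i s) j z ∪ sl (sl U i s) j (cp z) ⊆
        sl (sl U i s) k (a k) ∪ sl (sl U i s) k (cp (a k)) := by
      intro u hu
      obtain ⟨vu, uj⟩ : u ∈ sl U i s ∧ (u j = z ∨ u j = cp z) := by
        simp only [Finset.mem_union, mem_sl (k := j)] at hu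
        grind
      obtain ⟨g1, g2, g3⟩ := hY y hy
      obtain ⟨g4, g5, g6⟩ := hY w hw
      have c1 := av y g1 g2 g3 u vu uj
      have c2 := av w g4 g5 g6 u vu uj
      rw [Finset.mem_union, mem_sl (k := k), mem_sl (k := k)]
      rcases hq.letters (Or.inl vu) with g | g | g | g
      · exact Or.inl ⟨vu, g⟩
      · exact Or.inr ⟨vu, g⟩
      · exact absurd (by rw [yk', g]) c1
      · exact absurd (by rw [wk', g, cp_cp]) c2
    have heq := Finset.eq_of_subset_of_card_le hsub (by
      rw [sl_union_card (ne_cp (a k)), cA]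
      omega)
    have hfm : f ∈ sl (sl U i s) j z ∪ sl (sl U i s) j (cp z) := by
      rw [heq, Finset.mem_union]
      exact Or.inr (mem_sl.2 ⟨vf, by grind⟩)
    simp only [Finset.mem_union, mem_sl (k := j)] at hfm
    grind
  · push Not at hv
    refine hlt _ z3 fun y hy => ?_
    obtain ⟨g1, g2, g3⟩ := hY y hy
    exact h.letter_of_avoid g1 g2 g3 hk hq hv va aj rfl (av y g1 g2 g3 a va (Or.inl aj))

theorem Full.false (h : Full I U i s) : False := by
  have hp := h.eqPair
  have h8 := hp.eight_le h.ne
  obtain ⟨v, hv, w, hw, hne⟩ := Finset.one_lt_card.1 (by omega : 1 < (sl U i s).card)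
  obtain ⟨⟨k, hk, e⟩, -⟩ := hp.left v hv w hw hne
  have := h.const_of_not_act hk (fun _ g => g.false) (Or.inl hv) rfl (Or.inl hw)
  exact ne_cp _ (this.symm.trans e)

end NoFull

section Cover

variable {S : Type} [Cpl S] [Finite S] {ι : Type} [DecidableEq ι] [Fintype ι]

theorem card_sel (s : S) : Fintype.card (Sel S) = 2 * halfSel S := by
  have := card_sel_and (fun _ : Sel S => True) s (fun _ => Iff.rfl)
  simp only [true_and, Finset.filter_true, Finset.card_univ, card_sel_val] at this
  exact this.symm

theorem IsCode.card_cov_univ {U : Finset (ι → S)} (hU : IsCode Finset.univ U) (j : ι) :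
    (Finset.univ.filter fun x : ι → Sel S => Cov Finset.univ U x).card =
      U.card * halfSel S ^ Fintype.card ι := by
  have := card_cov hU (Finset.mem_univ j) (fun _ => True)
  simp only [and_true, card_sel_val, Finset.sum_const, smul_eq_mul, Finset.mem_univ, if_true,
    Finset.prod_const, Finset.card_erase_of_mem, Finset.card_univ] at this
  rw [this, mul_assoc, ← pow_succ', Nat.sub_add_cancel (Fintype.card_pos_iff.2 ⟨j⟩)]

/-- A code with `2 ^ d` words is an exact cover. -/
theorem IsCode.cover_of_le {U : Finset (ι → S)} (hU : IsCode Finset.univ U) (j : ι) (s : S)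
    (hc : 2 ^ Fintype.card ι ≤ U.card) :
    U.card = 2 ^ Fintype.card ι ∧ ∀ x, Cov Finset.univ U x := by
  have h1 := hU.card_cov_univ j
  have h2 : Fintype.card (ι → Sel S) = 2 ^ Fintype.card ι * halfSel S ^ Fintype.card ι := by
    rw [Fintype.card_fun, card_sel s, mul_pow]
  have h3 : 0 < halfSel S ^ Fintype.card ι := pow_pos (halfSel_pos s) _
  have h4 := Finset.card_filter_le Finset.univ fun x : ι → Sel S => Cov Finset.univ U x
  rw [h1, Finset.card_univ, h2] at h4
  have h5 : U.card = 2 ^ Fintype.card ι := le_antisymm (Nat.le_of_mul_le_mul_right h4 h3) hc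
  refine ⟨h5, fun x => ?_⟩
  rw [h5, ← h2, ← Finset.card_univ] at h1
  exact (Finset.mem_filter.1 ((Finset.card_eq_iff_eq_univ _).1 (h1.trans Finset.card_univ) ▸
    Finset.mem_univ x)).2

theorem IsCode.card_lt {U : Finset (Fin 7 → S)} (hU : IsCode Finset.univ U) (i : Fin 7)
    (l : Fin 5 → S) (hl : ∀ n m, n ≠ m → l n ≠ l m ∧ l n ≠ cp (l m))
    (hne : ∀ n, (Keller.sl U i (l n)).Nonempty) : U.card < 128 := by
  by_contra! hc
  obtain ⟨h1, h2⟩ := hU.cover_of_le i (l 0) (by simpa using hc)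
  have hsum := sl_sum_le U i [l 0, cp (l 0), l 1, cp (l 1), l 2, cp (l 2), l 3, cp (l 3), l 4,
    cp (l 4)] (by
      have h01 := hl 0 1 (by decide)
      have h02 := hl 0 2 (by decide)
      have h03 := hl 0 3 (by decide)
      have h04 := hl 0 4 (by decide)
      have h12 := hl 1 2 (by decide)
      have h13 := hl 1 3 (by decide)
      have h14 := hl 1 4 (by decide)
      have h23 := hl 2 3 (by decide)
      have h24 := hl 2 4 (by decide)
      have h34 := hl 3 4 (by decide)
      simp only [List.nodup_cons, List.mem_cons, List.not_mem_nil, or_false, not_or,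
        not_false_eq_true, List.nodup_nil, and_true]
      grind)
  simp only [List.map_cons, List.map_nil, List.sum_cons, List.sum_nil] at hsum
  obtain ⟨j, hj⟩ : ∃ j, j ∈ (Finset.univ : Finset (Fin 7)).erase i :=
    ⟨i + 1, Finset.mem_erase.2 ⟨by simp, Finset.mem_univ _⟩⟩
  have heq := fun n => (hU.eqPair (Finset.mem_univ i) h2 (l n)).card_eq hj
  have key : ∀ n, 13 ≤ (Keller.sl U i (l n)).card := by
    intro n
    by_contra! hlt
    exact Full.false (I := Finset.univ) (U := U) (i := i) (s := l n)
      ⟨hU, Finset.mem_univ i, by simp, h2, by omega, by have := heq n; omega, hne n⟩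
  have := heq 0
  have := heq 1
  have := heq 2
  have := heq 3
  have := heq 4
  have := key 0
  have := key 1
  have := key 2
  have := key 3
  have := key 4
  norm_num at h1
  omega

end Cover

end Keller

theorem keller_clique_dim7_lt_128 [Fintype S] (c : S → S)
    (hinv : Function.Involutive c) (hfix : ∀ s, c s ≠ s)
    (U : Set (Fin 7 → S)) (hclique : U.Pairwise (KellerAdj c))
    (u : Fin 5 → Fin 7 → S) (hu : ∀ n, u n ∈ U)
    (h : ∃ i : Fin 7, ∀ n m, n ≠ m → u n i ≠ u m i ∧ u n i ≠ c (u m i)) :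
    U.ncard < 128 := by
  let _ : Keller.Cpl S := ⟨c, hinv, hfix⟩
  obtain ⟨i, hi⟩ := h
  have hf := Set.toFinite U
  rw [Set.ncard_eq_toFinset_card U hf]
  have hU : Keller.IsCode Finset.univ hf.toFinset := by
    intro v hv w hw hne
    obtain ⟨⟨j, hj⟩, hT⟩ := hclique (hf.mem_toFinset.1 hv) (hf.mem_toFinset.1 hw) hne
    refine ⟨⟨j, Finset.mem_univ j, hj⟩, ?_⟩
    rintro ⟨k, -, e, g⟩
    exact hT ⟨k, e, fun k' hk' => g k' (Finset.mem_univ k') hk'⟩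
  exact hU.card_lt i (fun n => u n i) hi
    fun n => ⟨u n, Keller.mem_sl.2 ⟨hf.mem_toFinset.2 (hu n), rfl⟩⟩
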